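/- Let C be a dumb-bell in a ray category P, with points x, y, loops λ at x and ρ at y and arrow μ : x → y, such that the quotient P/ρ²μ is representation-finite. Assume that τ : y → z is an arrow of P different from ρ. Then: (a) τ and ρ are the only arrows of P starting at y; (b) λ and μ are the only arrows of P starting or ending at x; (c) λ³ = 0 and ρ³ = 0; (d) if τμ ≠ 0, then τ is the only arrow of P ending at z and ζτ = 0 holds for every arrow ζ of P starting at z. -/

import Mathlib

set_option autoImplicit false

/-- A ray category (Bautista–Gabriel–Roiter–Salmerón).  The fields `pipow x`
record the powers of the generator `π(x)` of the radical of `P(x,x)`. -/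
structure RayCategory : Type 1 where
  Obj : Type
  Hom : Obj → Obj → Type
  id : ∀ x : Obj, Hom x x
  comp : ∀ {x y z : Obj}, Hom y z → Hom x y → Hom x z
  zero : ∀ x y : Obj, Hom x y
  comp_id : ∀ {x y : Obj} (f : Hom x y), comp f (id x) = f
  id_comp : ∀ {x y : Obj} (f : Hom x y), comp (id y) f = f
  assoc : ∀ {x y z w : Obj} (h : Hom z w) (g : Hom y z) (f : Hom x y),
      comp (comp h g) f = comp h (comp g f)
  /-- axiom b : zero morphisms -/
  zero_comp : ∀ {x y z : Obj} (f : Hom x y), comp (zero y z) f = zero x z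
  comp_zero : ∀ {x y z : Obj} (f : Hom y z), comp f (zero x y) = zero x z
  /-- axiom a : the objects are pairwise non-isomorphic -/
  no_iso : ∀ {x y : Obj} (f : Hom x y) (g : Hom y x),
      comp g f = id x → comp f g = id y → x = y
  /-- axiom c : local finiteness -/
  finite_target : ∀ x : Obj, {y : Obj | ∃ f : Hom x y, f ≠ zero x y}.Finite
  finite_source : ∀ x : Obj, {y : Obj | ∃ f : Hom y x, f ≠ zero y x}.Finite
  /-- the powers of the generator `π(x)` of `P(x,x)`; `pipow x 1 = π(x)`. -/
  pipow : ∀ x : Obj, ℕ → Hom x x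
  pipow_zero : ∀ x, pipow x 0 = id x
  pipow_succ : ∀ x n, pipow x (n + 1) = comp (pipow x 1) (pipow x n)
  nilp : Obj → ℕ
  nilp_pos : ∀ x, 1 ≤ nilp x
  /-- axiom d : `P(x,x) = {id, σ, …, σ^{n-1} ≠ 0 = σ^n}` -/
  endo_cyclic : ∀ (x : Obj) (f : Hom x x), ∃ i : ℕ, f = pipow x i
  pipow_nilp : ∀ x, pipow x (nilp x) = zero x x
  pipow_nilp_ne : ∀ x, pipow x (nilp x - 1) ≠ zero x x
  /-- axiom e : `P(x,y)` is cyclic under the action of `P(x,x)` or of `P(y,y)` -/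
  hom_cyclic : ∀ x y : Obj, ∃ g : Hom x y,
      (∀ f : Hom x y, ∃ i : ℕ, f = comp (pipow y i) g) ∨
      (∀ f : Hom x y, ∃ i : ℕ, f = comp g (pipow x i))
  /-- axiom f : cancellation -/
  cancel : ∀ {x y z w : Obj} (kappa : Hom x y) (mu nu : Hom y z) (lam : Hom z w),
      comp lam (comp mu kappa) = comp lam (comp nu kappa) →
      comp lam (comp mu kappa) ≠ zero x w → mu = nu

namespace RayCategory

variable (P : RayCategory)

/-- the generator of the radical of `P(x,x)` -/
def pi (x : P.Obj) : P.Hom x x := P.pipow x 1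

/-- powers of an endomorphism -/
def pow {x : P.Obj} (f : P.Hom x x) : ℕ → P.Hom x x
  | 0 => P.id x
  | n + 1 => P.comp f (pow f n)

/-- `f` is an identity morphism -/
def IsId {x y : P.Obj} (f : P.Hom x y) : Prop := ∃ _ : x = y, HEq f (P.id x)

/-- irreducible morphisms (= arrows of the quiver of `P`): nonzero morphisms which are
not identities and cannot be written as a product of two non-identity morphisms -/
def IsIrreducible {x y : P.Obj} (f : P.Hom x y) : Prop :=
  f ≠ P.zero x y ∧ ¬ P.IsId f ∧
    ∀ (z : P.Obj) (g : P.Hom z y) (h : P.Hom x z), f = P.comp g h → P.IsId g ∨ P.IsId h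

/-- irreducibility inside the full subcategory supported by `S` -/
def IsIrreducibleOn (S : Set P.Obj) {x y : P.Obj} (f : P.Hom x y) : Prop :=
  f ≠ P.zero x y ∧ ¬ P.IsId f ∧
    ∀ z ∈ S, ∀ (g : P.Hom z y) (h : P.Hom x z), f = P.comp g h → P.IsId g ∨ P.IsId h

/-- the sub-bimodule `P(y,y) μ P(x,x)` of `P(x,y)` generated by `μ` -/
def Bimod {x y : P.Obj} (mu : P.Hom x y) : Set (P.Hom x y) :=
  {f | ∃ i j : ℕ, f = P.comp (P.pipow y i) (P.comp mu (P.pipow x j))}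

/-- `μ` is transit : the sub-bimodule generated by `μ` is cyclic over `P(y,y)` -/
def IsTransit {x y : P.Obj} (mu : P.Hom x y) : Prop :=
  mu ≠ P.zero x y ∧
    ∃ g ∈ P.Bimod mu, ∀ f ∈ P.Bimod mu, ∃ i : ℕ, f = P.comp (P.pipow y i) g

/-- `μ` is cotransit : the sub-bimodule generated by `μ` is cyclic over `P(x,x)` -/
def IsCotransit {x y : P.Obj} (mu : P.Hom x y) : Prop :=
  mu ≠ P.zero x y ∧
    ∃ g ∈ P.Bimod mu, ∀ f ∈ P.Bimod mu, ∃ j : ℕ, f = P.comp g (P.pipow x j)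

/-- `μ` is deep : `π(y)μ = 0 = μπ(x)` -/
def IsDeep {x y : P.Obj} (mu : P.Hom x y) : Prop :=
  mu ≠ P.zero x y ∧ P.comp (P.pi y) mu = P.zero x y ∧ P.comp mu (P.pi x) = P.zero x y

/-- transport of a morphism along equalities of objects -/
def castHom {a b c d : P.Obj} (h1 : a = c) (h2 : b = d) (f : P.Hom a b) : P.Hom c d :=
  cast (by rw [h1, h2]) f

/-- the composite `a_{i+j-1} ⋯ a_{i+1} a_i : x_i → x_{i+j}` of a chain of morphisms -/
def chain (x : ℕ → P.Obj) (a : ∀ i : ℕ, P.Hom (x i) (x (i + 1))) (i : ℕ) :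
    ∀ j : ℕ, P.Hom (x i) (x (i + j))
  | 0 => P.id (x i)
  | j + 1 => P.comp (a (i + j)) (chain x a i j)

end RayCategory

/-- Paths in the quiver `Q_P` of a ray category `P` (the arrow `f` of `cons f hf p`
is the *last* arrow of the path). -/
inductive RPath (P : RayCategory) : P.Obj → P.Obj → Type
  | nil (x : P.Obj) : RPath P x x
  | cons {x y z : P.Obj} (f : P.Hom y z) (hf : P.IsIrreducible f) (p : RPath P x y) :
      RPath P x z

namespace RPath

variable {P : RayCategory}

/-- the morphism `v⃗` of `P` obtained by composing the arrows of a path `v` -/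
def toHom : ∀ {x y : P.Obj}, RPath P x y → P.Hom x y
  | _, _, .nil x => P.id x
  | _, _, .cons f _ p => P.comp f p.toHom

def length : ∀ {x y : P.Obj}, RPath P x y → ℕ
  | _, _, .nil _ => 0
  | _, _, .cons _ _ p => p.length + 1

/-- the set of points visited by a path -/
def points : ∀ {x y : P.Obj}, RPath P x y → Set P.Obj
  | _, _, .nil x => {x}
  | _, _, @RPath.cons _ _ _ z _ _ p => insert z p.points

/-- concatenation of paths -/
def append : ∀ {x y z : P.Obj}, RPath P y z → RPath P x y → RPath P x z
  | _, _, _, .nil _, p => p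
  | _, _, _, .cons f hf q, p => .cons f hf (q.append p)

/-- the arrow `g` occurs in the path -/
def HasArrow : ∀ {x y : P.Obj}, RPath P x y → ∀ {a b : P.Obj}, P.Hom a b → Prop
  | _, _, .nil _, _, _, _ => False
  | _, _, .cons f _ p, _, _, g => HEq f g ∨ p.HasArrow g

/-- one step of the interlacing relation: `v = p v' q`, `w = p w' q` with
`v⃗' = w⃗' ≠ 0` and `p`, `q` not both identities -/
def InterlaceStep {x y : P.Obj} (v w : RPath P x y) : Prop :=
  ∃ (a b : P.Obj) (p : RPath P b y) (v' w' : RPath P a b) (q : RPath P x a),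
    v = p.append (v'.append q) ∧ w = p.append (w'.append q) ∧
    v'.toHom = w'.toHom ∧ v'.toHom ≠ P.zero a b ∧ ¬ (p.length = 0 ∧ q.length = 0)

/-- two paths are interlaced if they lie in the transitive closure of the relation above -/
def Interlaced {x y : P.Obj} (v w : RPath P x y) : Prop :=
  Relation.TransGen (fun v' w' : RPath P x y => InterlaceStep v' w') v w

end RPath

/-- a chain of arrows as a path -/
def pchain (P : RayCategory) (x : ℕ → P.Obj) (a : ∀ i : ℕ, P.Hom (x i) (x (i + 1)))
    (ha : ∀ i, P.IsIrreducible (a i)) (i : ℕ) : ∀ j : ℕ, RPath P (x i) (x (i + j))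
  | 0 => .nil (x i)
  | j + 1 => .cons (a (i + j)) (ha (i + j)) (pchain P x a ha i j)

/-- A contour `C = {v,w}` of `P` from `x` to `y` : a pair of different, non-interlaced
paths with `v⃗ = w⃗ ≠ 0`. -/
structure Contour (P : RayCategory) (x y : P.Obj) : Type where
  v : RPath P x y
  w : RPath P x y
  ne : v ≠ w
  hom_eq : v.toHom = w.toHom
  nz : v.toHom ≠ P.zero x y
  nint : ¬ RPath.Interlaced v w
/-- A module over the linearization `k(D/I)` of the quotient by the ideal generated by the
morphisms in `I` of the full subcategory of `P` supported by `D`: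
a `k`-linear functor defined on the morphisms between points of `D`, vanishing on `I`.
For `D = Set.univ` and `I = fun _ _ _ => False` this is exactly a `k(P)`-module. -/
structure RMod (P : RayCategory) (k : Type) [Field k] (D : Set P.Obj)
    (I : ∀ a b : P.Obj, P.Hom a b → Prop) where
  M : P.Obj → Type
  [acg : ∀ x, AddCommGroup (M x)]
  [mod : ∀ x, Module k (M x)]
  act : ∀ {x y : P.Obj}, P.Hom x y → (M x →ₗ[k] M y)
  act_id : ∀ x ∈ D, act (P.id x) = LinearMap.id
  act_comp : ∀ {x y z : P.Obj}, x ∈ D → y ∈ D → z ∈ D →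
      ∀ (g : P.Hom y z) (f : P.Hom x y), act (P.comp g f) = (act g).comp (act f)
  act_zero : ∀ {x y : P.Obj}, x ∈ D → y ∈ D → act (P.zero x y) = 0
  supp : ∀ x : P.Obj, x ∉ D → ∀ m : M x, m = 0
  killed : ∀ {a b : P.Obj} (f : P.Hom a b), I a b f → act f = 0

attribute [instance] RMod.acg RMod.mod

/-- morphisms of modules -/
structure RModHom {P : RayCategory} {k : Type} [Field k] {D : Set P.Obj}
    {I : ∀ a b : P.Obj, P.Hom a b → Prop} (M N : RMod P k D I) where
  app : ∀ x : P.Obj, M.M x →ₗ[k] N.M x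
  natural : ∀ {x y : P.Obj} (f : P.Hom x y), (N.act f).comp (app x) = (app y).comp (M.act f)

/-- isomorphism of modules -/
def RModIso {P : RayCategory} {k : Type} [Field k] {D : Set P.Obj}
    {I : ∀ a b : P.Obj, P.Hom a b → Prop} (M N : RMod P k D I) : Prop :=
  ∃ φ : RModHom M N, ∀ x, Function.Bijective (φ.app x)

namespace RMod

variable {P : RayCategory} {k : Type} [Field k] {D : Set P.Obj}
  {I : ∀ a b : P.Obj, P.Hom a b → Prop}

/-- finite-dimensional: the sum of the dimensions of all `M x` is finite -/
def FinDim (M : RMod P k D I) : Prop :=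
  (∀ x, FiniteDimensional k (M.M x)) ∧ {x : P.Obj | ∃ m : M.M x, m ≠ 0}.Finite

def Nonzero (M : RMod P k D I) : Prop := ∃ x, ∃ m : M.M x, m ≠ 0

/-- indecomposable: nonzero, and the only idempotent endomorphisms are `0` and `id` -/
def Indec (M : RMod P k D I) : Prop :=
  M.Nonzero ∧ ∀ e : RModHom M M, (∀ x, (e.app x).comp (e.app x) = e.app x) →
    (∀ x, e.app x = 0) ∨ (∀ x, e.app x = LinearMap.id)

end RMod

/-- the full subcategory supported by `D` of the quotient of `P` by the ideal generated
by `I` is (locally) representation-finite: for any field `k`, every point lies in the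
support of only finitely many isomorphism classes of finite-dimensional indecomposables -/
def RepFin (P : RayCategory) (D : Set P.Obj) (I : ∀ a b : P.Obj, P.Hom a b → Prop) : Prop :=
  ∀ (k : Type) [Field k], ∀ x : P.Obj,
    ∃ (ι : Type) (_ : Finite ι) (rep : ι → RMod P k D I),
      ∀ M : RMod P k D I, M.FinDim → M.Indec → (∃ m : M.M x, m ≠ 0) →
        ∃ i : ι, RModIso (rep i) M

/-- the trivial ideal -/
def RayCategory.noIdeal (P : RayCategory) : ∀ a b : P.Obj, P.Hom a b → Prop :=
  fun _ _ _ => False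

/-- `P` is locally representation-finite -/
def LocRepFin (P : RayCategory) : Prop := RepFin P Set.univ P.noIdeal

/-- the ideal of `P` generated by the morphism `μ` -/
def IdealOf (P : RayCategory) {a b : P.Obj} (mu : P.Hom a b) :
    ∀ s t : P.Obj, P.Hom s t → Prop :=
  fun s t f => ∃ (g : P.Hom b t) (h : P.Hom s a), f = P.comp g (P.comp mu h)

/-- an ideal of a ray category -/
structure RIdeal (P : RayCategory) where
  mem : ∀ a b : P.Obj, P.Hom a b → Prop
  zero_mem : ∀ a b : P.Obj, mem a b (P.zero a b)
  comp_mem_left : ∀ {a b c : P.Obj} (g : P.Hom b c) (f : P.Hom a b),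
      mem a b f → mem a c (P.comp g f)
  comp_mem_right : ∀ {a b c : P.Obj} (g : P.Hom b c) (f : P.Hom a b),
      mem b c g → mem a c (P.comp g f)

/-- `P` is minimal representation-infinite: not locally representation-finite, but every
proper quotient (quotient by an ideal containing a nonzero morphism) is locally
representation-finite -/
def MinRepInfinite (P : RayCategory) : Prop :=
  ¬ LocRepFin P ∧ ∀ J : RIdeal P,
    (∃ (a b : P.Obj) (f : P.Hom a b), f ≠ P.zero a b ∧ J.mem a b f) →
      RepFin P Set.univ J.mem

/-- support of the indecomposable projective module `P_x` over the quotient of `P` by `I` -/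
def ProjSupp (P : RayCategory) (I : ∀ a b : P.Obj, P.Hom a b → Prop) (x : P.Obj) :
    Set P.Obj :=
  {y : P.Obj | ∃ f : P.Hom x y, f ≠ P.zero x y ∧ ¬ I x y f}

/-- support of the indecomposable injective module `I_y` over the quotient of `P` by `I` -/
def InjSupp (P : RayCategory) (I : ∀ a b : P.Obj, P.Hom a b → Prop) (y : P.Obj) :
    Set P.Obj :=
  {z : P.Obj | ∃ f : P.Hom z y, f ≠ P.zero z y ∧ ¬ I z y f}

namespace Contour

variable {P : RayCategory} {x y : P.Obj} (C : Contour P x y)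

/-- points of the contour = points of the full subcategory `P(C)` -/
def points : Set P.Obj := C.v.points ∪ C.w.points

/-- the contour is non-deep -/
def NonDeep : Prop := ¬ P.IsDeep C.v.toHom

/-- the ideal generated by `π(y)v⃗`, so that `P' = P/π(y)v⃗` (transit case) -/
def It : ∀ a b : P.Obj, P.Hom a b → Prop := IdealOf P (P.comp (P.pi y) C.v.toHom)

/-- the ideal generated by `v⃗π(x)` (cotransit case) -/
def Ic : ∀ a b : P.Obj, P.Hom a b → Prop := IdealOf P (P.comp C.v.toHom (P.pi x))

/-- decisive subcategories of `P' = P/π(y)v⃗` for `C` (transit case) -/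
def DecisiveT (D : Set P.Obj) : Prop :=
  x ∈ D ∧ y ∈ D ∧ D ⊆ ProjSupp P C.It x ∪ InjSupp P C.It y

/-- decisive subcategories (cotransit case) -/
def DecisiveC (D : Set P.Obj) : Prop :=
  x ∈ D ∧ y ∈ D ∧ D ⊆ ProjSupp P C.Ic x ∪ InjSupp P C.Ic y

/-- mildness in the transit case: `C` is non-deep, `v⃗` is transit, and every decisive
full subcategory of `P/π(y)v⃗` with at most 4 points is representation-finite -/
def MildTransit : Prop :=
  C.NonDeep ∧ P.IsTransit C.v.toHom ∧
    ∀ D : Set P.Obj, C.DecisiveT D → D.Finite → D.ncard ≤ 4 → RepFin P D C.It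

/-- mildness in the cotransit case (dual) -/
def MildCotransit : Prop :=
  C.NonDeep ∧ P.IsCotransit C.v.toHom ∧
    ∀ D : Set P.Obj, C.DecisiveC D → D.Finite → D.ncard ≤ 4 → RepFin P D C.Ic

/-- a mild contour -/
def Mild : Prop := C.MildTransit ∨ C.MildCotransit

/-- equality of contours (with possibly different endpoints), as sets `{v,w}` -/
def Same {x' y' : P.Obj} (C' : Contour P x' y') : Prop :=
  ∃ (_ : x = x') (_ : y = y'),
    (HEq C.v C'.v ∧ HEq C.w C'.w) ∨ (HEq C.v C'.w ∧ HEq C.w C'.v)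

end Contour
/-- the full subcategory on `{x,y}` is a dumb-bell with loops `lam`, `rho`, arrow `mu`
and nilpotency indices `r`, `s` -/
def DumbBellData (P : RayCategory) (x y : P.Obj) (lam : P.Hom x x) (mu : P.Hom x y)
    (rho : P.Hom y y) (r s : ℕ) : Prop :=
  x ≠ y ∧
  P.IsIrreducibleOn {x, y} lam ∧ P.IsIrreducibleOn {x, y} mu ∧ P.IsIrreducibleOn {x, y} rho ∧
  (∀ a b : P.Obj, a ∈ ({x, y} : Set P.Obj) → b ∈ ({x, y} : Set P.Obj) →
      ∀ f : P.Hom a b, P.IsIrreducibleOn {x, y} f → HEq f lam ∨ HEq f mu ∨ HEq f rho) ∧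
  P.comp mu lam = P.comp rho mu ∧
  P.pow lam r = P.zero x x ∧ P.pow rho s = P.zero y y ∧
  P.pow lam (r - 1) ≠ P.zero x x ∧ P.pow rho (s - 1) ≠ P.zero y y ∧
  min r s = 3 ∧ max r s ≤ 5 ∧
  (∀ f : P.Hom x x, ∃ i : ℕ, f = P.pow lam i) ∧
  (∀ f : P.Hom y y, ∃ i : ℕ, f = P.pow rho i) ∧
  (∀ f : P.Hom x y, f = P.zero x y ∨ ∃ i : ℕ, f = P.comp mu (P.pow lam i)) ∧
  (∀ i : ℕ, i < min r s → P.comp mu (P.pow lam i) ≠ P.zero x y) ∧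
  (∀ f : P.Hom y x, f = P.zero y x)

/-- the full subcategory supported by `S` is a dumb-bell -/
def IsDumbBellOn (P : RayCategory) (S : Set P.Obj) : Prop :=
  ∃ (x y : P.Obj) (lam : P.Hom x x) (mu : P.Hom x y) (rho : P.Hom y y) (r s : ℕ),
    DumbBellData P x y lam mu rho r s ∧ S = {x, y}

/-- the full subcategory on the points `x 0, …, x (n-1)` is a penny-farthing with arrows
`a i` (`a i = α_{i+1} : x_i → x_{i+1}`, indices mod `n`) and loop `rho` at `x 0` -/
def PennyData (P : RayCategory) (n : ℕ) (x : ℕ → P.Obj)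
    (a : ∀ i : ℕ, P.Hom (x i) (x (i + 1))) (rho : P.Hom (x 0) (x 0)) : Prop :=
  1 ≤ n ∧
  (∀ i, x (i + n) = x i) ∧ (∀ i, HEq (a (i + n)) (a i)) ∧
  (∀ i j, i < n → j < n → x i = x j → i = j) ∧
  (∀ i, P.IsIrreducibleOn (Set.range x) (a i)) ∧
  P.IsIrreducibleOn (Set.range x) rho ∧
  (∀ b c : P.Obj, b ∈ Set.range x → c ∈ Set.range x → ∀ f : P.Hom b c,
      P.IsIrreducibleOn (Set.range x) f → HEq f rho ∨ ∃ i, i < n ∧ HEq f (a i)) ∧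
  -- relation α₁αₙ = 0
  P.chain x a (n - 1) 2 = P.zero (x (n - 1)) (x (n - 1 + 2)) ∧
  -- relation αₙ⋯α₁ = ρ²
  (∀ h : x (0 + n) = x 0, P.castHom rfl h (P.chain x a 0 n) = P.comp rho rho) ∧
  -- relations 0 = α_{e i}⋯α₁ ρ αₙ⋯α_{i+1} for a non-decreasing e : {1,…,n-1} → {1,…,n}
  ∃ e : ℕ → ℕ,
    (∀ i, 1 ≤ i → i ≤ n - 1 → 1 ≤ e i ∧ e i ≤ n) ∧
    (∀ i j, 1 ≤ i → i ≤ j → j ≤ n - 1 → e i ≤ e j) ∧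
    (∀ i, 1 ≤ i → i ≤ n - 1 → ∀ h : x (i + (n - i)) = x 0,
      P.comp (P.chain x a 0 (e i))
        (P.comp rho (P.castHom rfl h (P.chain x a i (n - i)))) =
      P.zero (x i) (x (0 + e i)))

/-- the full subcategory supported by `S` is a penny-farthing -/
def IsPennyFarthingOn (P : RayCategory) (S : Set P.Obj) : Prop :=
  ∃ (n : ℕ) (x : ℕ → P.Obj) (a : ∀ i : ℕ, P.Hom (x i) (x (i + 1))) (rho : P.Hom (x 0) (x 0)),
    PennyData P n x a rho ∧ S = Set.range x

/-- the full subcategory on `{x,z,t,y}` is a diamond with arrows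
`gam : x → z`, `lam : z → x`, `del : x → t`, `bet : t → y`, `alp : z → y`, `kap : y → z` -/
def DiamondData (P : RayCategory) (x z t y : P.Obj) (gam : P.Hom x z) (lam : P.Hom z x)
    (del : P.Hom x t) (bet : P.Hom t y) (alp : P.Hom z y) (kap : P.Hom y z) : Prop :=
  (x ≠ z ∧ x ≠ t ∧ x ≠ y ∧ z ≠ t ∧ z ≠ y ∧ t ≠ y) ∧
  P.IsIrreducibleOn {x, z, t, y} gam ∧ P.IsIrreducibleOn {x, z, t, y} lam ∧
  P.IsIrreducibleOn {x, z, t, y} del ∧ P.IsIrreducibleOn {x, z, t, y} bet ∧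
  P.IsIrreducibleOn {x, z, t, y} alp ∧ P.IsIrreducibleOn {x, z, t, y} kap ∧
  (∀ a b : P.Obj, a ∈ ({x, z, t, y} : Set P.Obj) → b ∈ ({x, z, t, y} : Set P.Obj) →
      ∀ f : P.Hom a b, P.IsIrreducibleOn {x, z, t, y} f →
        HEq f gam ∨ HEq f lam ∨ HEq f del ∨ HEq f bet ∨ HEq f alp ∨ HEq f kap) ∧
  P.comp alp gam = P.comp bet del ∧
  P.comp lam kap = P.zero y x ∧
  P.comp kap alp = P.comp gam lam

/-- the full subcategory supported by `S` is a diamond -/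
def IsDiamondOn (P : RayCategory) (S : Set P.Obj) : Prop :=
  ∃ (x z t y : P.Obj) (gam : P.Hom x z) (lam : P.Hom z x) (del : P.Hom x t)
    (bet : P.Hom t y) (alp : P.Hom z y) (kap : P.Hom y z),
    DiamondData P x z t y gam lam del bet alp kap ∧ S = {x, z, t, y}

namespace RModHom

variable {P : RayCategory} {k : Type} [Field k] {I : ∀ a b : P.Obj, P.Hom a b → Prop}

/-- composition of module morphisms -/
def comp {D : Set P.Obj} {L M N : RMod P k D I} (g : RModHom M N) (f : RModHom L M) :
    RModHom L N where
  app x := (g.app x).comp (f.app x)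
  natural h := by
    rw [← LinearMap.comp_assoc, g.natural, LinearMap.comp_assoc, f.natural,
      LinearMap.comp_assoc]

/-- the identity of a module -/
def ident {D : Set P.Obj} (M : RMod P k D I) : RModHom M M where
  app _ := LinearMap.id
  natural _ := rfl

/-- the complement `1 - e` of an endomorphism -/
def compl {D : Set P.Obj} {M : RMod P k D I} (e : RModHom M M) : RModHom M M where
  app x := LinearMap.id - e.app x
  natural h := by
    ext m
    have := LinearMap.congr_fun (e.natural h) m
    simp only [LinearMap.comp_apply, LinearMap.sub_apply, LinearMap.id_apply, map_sub] at this ⊢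
    rw [this]

lemma natural_apply {D : Set P.Obj} {M N : RMod P k D I} (f : RModHom M N) {x y : P.Obj}
    (h : P.Hom x y) (m : M.M x) : N.act h (f.app x m) = f.app y (M.act h m) :=
  LinearMap.congr_fun (f.natural h) m

/-- the inverse of a bijective morphism -/
noncomputable def inv {D : Set P.Obj} {M N : RMod P k D I} (f : RModHom M N)
    (hf : ∀ x, Function.Bijective (f.app x)) : RModHom N M where
  app x := (LinearEquiv.ofBijective (f.app x) (hf x)).symm.toLinearMap
  natural {x y} h := by
    ext n
    obtain ⟨m, rfl⟩ := (hf x).2 n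
    have e1 : (LinearEquiv.ofBijective (f.app x) (hf x)).symm (f.app x m) = m :=
      (LinearEquiv.ofBijective (f.app x) (hf x)).symm_apply_apply m
    simp only [LinearMap.comp_apply, LinearEquiv.coe_coe]
    rw [e1, f.natural_apply]
    exact ((LinearEquiv.ofBijective (f.app y) (hf y)).symm_apply_apply _).symm

lemma app_inv {D : Set P.Obj} {M N : RMod P k D I} (f : RModHom M N)
    (hf : ∀ x, Function.Bijective (f.app x)) (x : P.Obj) (n : N.M x) :
    f.app x ((f.inv hf).app x n) = n :=
  (LinearEquiv.ofBijective (f.app x) (hf x)).apply_symm_apply n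

/-- the image of an endomorphism -/
def imageMod {M : RMod P k Set.univ I} (e : RModHom M M) : RMod P k Set.univ I where
  M x := LinearMap.range (e.app x)
  act {x y} f := (M.act f).restrict (by
    rintro _ ⟨m, rfl⟩
    exact ⟨M.act f m, (e.natural_apply f m).symm⟩)
  act_id x hx := by ext m; simp [M.act_id x hx]
  act_comp hx hy hz g f := by ext m; simp [M.act_comp hx hy hz]
  act_zero hx hy := by ext m; simp [M.act_zero hx hy]
  supp x hx := absurd (Set.mem_univ x) hx
  killed f hf := by ext m; simp [M.killed f hf]

/-- the inclusion of the image -/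
def imageIncl {M : RMod P k Set.univ I} (e : RModHom M M) : RModHom e.imageMod M where
  app x := (LinearMap.range (e.app x)).subtype
  natural _ := rfl

/-- the projection onto the image -/
def imageProj {M : RMod P k Set.univ I} (e : RModHom M M) : RModHom M e.imageMod where
  app x := (e.app x).rangeRestrict
  natural f := by
    ext1 m
    exact Subtype.ext (e.natural_apply f m)

end RModHom

section Finiteness

variable {P : RayCategory} {k : Type} [Field k] {I : ∀ a b : P.Obj, P.Hom a b → Prop}

/-- A module that detects a vector by a functional has an indecomposable retract-like
piece that still detects it. -/
theorem RMod.exists_indec (M : RMod P k Set.univ I) (hM : M.FinDim) (x0 : P.Obj)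
    (v : M.M x0) (ξ : M.M x0 →ₗ[k] k) (hv : ξ v ≠ 0) :
    ∃ X : RMod P k Set.univ I, X.FinDim ∧ X.Indec ∧
      ∃ (i : RModHom X M) (p : RModHom M X), ξ (i.app x0 (p.app x0 v)) ≠ 0 := by
  classical
  have hfd := hM.1
  let S : Set (RModHom M M) :=
    {e | (∀ x, (e.app x).comp (e.app x) = e.app x) ∧ ξ (e.app x0 v) ≠ 0}
  let rk : RModHom M M → ℕ := fun e =>
    ∑ x ∈ hM.2.toFinset, Module.finrank k (LinearMap.range (e.app x))
  have hne : ∃ e, e ∈ S := ⟨RModHom.ident M, fun _ => rfl, hv⟩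
  obtain ⟨e, he, hmin⟩ : ∃ e ∈ S, ∀ e' ∈ S, rk e ≤ rk e' := by
    let e := Function.argminOn rk S hne
    exact ⟨e, Function.argminOn_mem rk S hne,
      fun e' he' => Function.argminOn_le rk S he'⟩
  have hid : ∀ x (m : M.M x), e.app x (e.app x m) = e.app x m :=
    fun x m => LinearMap.congr_fun (he.1 x) m
  have hproj : ∀ x (u : e.imageMod.M x), e.imageProj.app x (e.imageIncl.app x u) = u := by
    rintro x ⟨_, m, rfl⟩
    exact Subtype.ext (hid x m)
  have key : ∀ g : RModHom e.imageMod e.imageMod,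
      (∀ x, (g.app x).comp (g.app x) = g.app x) →
      ξ (e.imageIncl.app x0 (g.app x0 (e.imageProj.app x0 v))) ≠ 0 →
      ∀ x, g.app x = LinearMap.id := by
    intro g hg hgv
    have hS : e.imageIncl.comp (g.comp e.imageProj) ∈ S := by
      refine ⟨fun x => ?_, hgv⟩
      ext m
      have h1 := hproj x (g.app x (e.imageProj.app x m))
      have h2 := LinearMap.congr_fun (hg x) (e.imageProj.app x m)
      simp only [LinearMap.comp_apply] at h2
      change e.imageIncl.app x (g.app x (e.imageProj.app x
        (e.imageIncl.app x (g.app x (e.imageProj.app x m))))) = _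
      rw [h1, h2]
      rfl
    have hle : ∀ x, LinearMap.range ((e.imageIncl.comp (g.comp e.imageProj)).app x) ≤
        LinearMap.range (e.app x) := by
      rintro x _ ⟨m, rfl⟩
      exact (g.app x (e.imageProj.app x m)).2
    have hfin : ∀ x ∈ hM.2.toFinset,
        Module.finrank k (LinearMap.range ((e.imageIncl.comp (g.comp e.imageProj)).app x)) =
        Module.finrank k (LinearMap.range (e.app x)) := by
      have h1 : ∀ x ∈ hM.2.toFinset,
          Module.finrank k (LinearMap.range ((e.imageIncl.comp (g.comp e.imageProj)).app x)) ≤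
          Module.finrank k (LinearMap.range (e.app x)) :=
        fun x _ => by
          have := hfd x
          exact Submodule.finrank_mono (hle x)
      exact (Finset.sum_eq_sum_iff_of_le h1).1 (le_antisymm (Finset.sum_le_sum h1) (hmin _ hS))
    intro x
    ext1 u
    by_cases hx : ∃ m : M.M x, m ≠ 0
    · have := hfd x
      have heq := Submodule.eq_of_le_of_finrank_eq (hle x) (hfin x (by simpa using hx))
      have hu : e.imageIncl.app x u ∈ LinearMap.range ((e.imageIncl.comp (g.comp e.imageProj)).app x) := by
        rw [heq]; exact Subtype.mem u
      obtain ⟨m, hm⟩ := hu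
      have hu' : u = g.app x (e.imageProj.app x m) := Subtype.ext hm.symm
      rw [hu']
      exact LinearMap.congr_fun (hg x) (e.imageProj.app x m)
    · push Not at hx
      exact Subtype.ext ((hx _).trans (hx _).symm)
  have hinc : e.imageIncl.app x0 (e.imageProj.app x0 v) = e.app x0 v := rfl
  refine ⟨e.imageMod, ⟨fun x => ?_, ?_⟩, ⟨⟨x0, e.imageProj.app x0 v, ?_⟩, ?_⟩,
    e.imageIncl, e.imageProj, he.2⟩
  · have := hfd x
    exact inferInstanceAs (FiniteDimensional k (LinearMap.range (e.app x)))
  · refine hM.2.subset ?_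
    rintro x ⟨m, hm⟩
    exact ⟨m.1, fun h => hm (Subtype.ext h)⟩
  · intro h
    apply he.2
    rw [← hinc, h, map_zero, map_zero]
  · intro g hg
    by_cases h : ξ (e.imageIncl.app x0 (g.app x0 (e.imageProj.app x0 v))) = 0
    · left
      have hc : ∀ x, (g.compl.app x).comp (g.compl.app x) = g.compl.app x := by
        intro x
        ext1 u
        have h2 := LinearMap.congr_fun (hg x) u
        simp only [LinearMap.comp_apply] at h2
        change (u - g.app x u) - g.app x (u - g.app x u) = u - g.app x u
        rw [map_sub, h2, sub_self, sub_zero]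
      have := key g.compl hc (by
        change ξ (e.imageIncl.app x0 (e.imageProj.app x0 v - g.app x0 (e.imageProj.app x0 v))) ≠ 0
        rw [map_sub, map_sub, h, sub_zero]
        exact he.2)
      intro x
      ext1 u
      have h3 : u - g.app x u = u := LinearMap.congr_fun (this x) u
      simpa using h3
    · exact Or.inr (key g hg h)

/-- An infinite family of finite-dimensional modules whose mutual homomorphisms are
separated by functionals contradicts representation-finiteness. -/
theorem RepFin.false_of_family (hrep : RepFin P Set.univ I) (x0 : P.Obj) {T : Type} [Infinite T]
    (M : T → RMod P k Set.univ I) (hM : ∀ t, (M t).FinDim) (v : ∀ t, (M t).M x0)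
    (ξ : ∀ t, (M t).M x0 →ₗ[k] k) (h1 : ∀ t, ξ t (v t) ≠ 0)
    (h2 : ∀ s t, s ≠ t → ∀ f : RModHom (M s) (M t), ξ t (f.app x0 (v s)) = 0) : False := by
  obtain ⟨ι, hι, rep, hrep⟩ := hrep k x0
  choose X hXfd hX i p hip using fun t => (M t).exists_indec (hM t) x0 (v t) (ξ t) (h1 t)
  have hX0 : ∀ t, ∃ m : (X t).M x0, m ≠ 0 := fun t =>
    ⟨(p t).app x0 (v t), fun h => hip t (by rw [h, map_zero, map_zero])⟩
  choose j φ hφ using fun t => hrep (X t) (hXfd t) (hX t) (hX0 t)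
  obtain ⟨c, hc⟩ := Finite.exists_infinite_fiber j
  obtain ⟨⟨t0, ht0⟩⟩ := hc.nonempty
  have ht0 : j t0 = c := ht0
  have hfd : FiniteDimensional k ((rep c).M x0) := by
    subst ht0
    have := (hXfd t0).1 x0
    exact (LinearEquiv.ofBijective ((φ t0).app x0) (hφ t0 x0)).symm.finiteDimensional
  have hφ' : ∀ t : j ⁻¹' {c}, ∃ ψ : RModHom (rep c) (X t), ∀ x, Function.Bijective (ψ.app x) := by
    rintro ⟨t, ht⟩
    have ht : j t = c := ht
    subst ht
    exact ⟨φ t, hφ t⟩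
  choose ψ hψ using hφ'
  let w : j ⁻¹' {c} → (rep c).M x0 := fun t =>
    ((ψ t).inv (hψ t)).app x0 ((p t).app x0 (v t))
  let η : j ⁻¹' {c} → (rep c).M x0 →ₗ[k] k := fun t =>
    (ξ t).comp (((i t).app x0).comp ((ψ t).app x0))
  have hη : ∀ s t, s ≠ t → η t (w s) = 0 := fun s t hst =>
    h2 s t (fun h => hst (Subtype.ext h))
      ((i t).comp ((ψ t).comp (((ψ s).inv (hψ s)).comp (p s))))
  have hη1 : ∀ t, η t (w t) ≠ 0 := by
    intro t
    change ξ t ((i t).app x0 ((ψ t).app x0 (((ψ t).inv (hψ t)).app x0 ((p t).app x0 (v t))))) ≠ 0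
    rw [RModHom.app_inv]
    exact hip t
  have hli : LinearIndependent k w := by
    classical
    rw [linearIndependent_iff']
    intro s g hg t ht
    have h3 := congrArg (η t) hg
    rw [map_sum, map_zero, Finset.sum_eq_single t] at h3
    · rw [map_smul, smul_eq_mul] at h3
      exact (mul_eq_zero.1 h3).resolve_right (hη1 t)
    · intro b _ hb
      rw [map_smul, hη b t hb, smul_zero]
    · exact fun h => absurd ht h
  exact hc.not_finite hli.finite

end Finiteness

namespace RayCategory

variable {P : RayCategory}

lemma pipow_eq_zero {x : P.Obj} {i : ℕ} (h : P.nilp x ≤ i) : P.pipow x i = P.zero x x := by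
  induction i, h using Nat.le_induction with
  | base => exact P.pipow_nilp x
  | succ n _ ih => rw [P.pipow_succ, ih, P.comp_zero]

lemma pipow_finite (x : P.Obj) : (Set.range (P.pipow x)).Finite := by
  refine ((Set.finite_Iic (P.nilp x)).image (P.pipow x)).subset ?_
  rintro _ ⟨i, rfl⟩
  rcases le_total i (P.nilp x) with h | h
  · exact ⟨i, h, rfl⟩
  · exact ⟨P.nilp x, Set.mem_Iic.2 le_rfl, by rw [pipow_eq_zero h, pipow_eq_zero le_rfl]⟩

instance finite_hom (x y : P.Obj) : Finite (P.Hom x y) := by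
  obtain ⟨g, h | h⟩ := P.hom_cyclic x y
  · refine Set.finite_univ_iff.1 (((pipow_finite y).image fun s => P.comp s g).subset ?_)
    intro f _
    obtain ⟨i, hi⟩ := h f
    exact ⟨_, ⟨i, rfl⟩, hi.symm⟩
  · refine Set.finite_univ_iff.1 (((pipow_finite x).image fun s => P.comp g s).subset ?_)
    intro f _
    obtain ⟨i, hi⟩ := h f
    exact ⟨_, ⟨i, rfl⟩, hi.symm⟩

lemma cancel_left {x y z : P.Obj} {g : P.Hom y z} {f f' : P.Hom x y}
    (h : P.comp g f = P.comp g f') (h0 : P.comp g f ≠ P.zero x z) : f = f' := by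
  apply P.cancel (P.id x) f f' g
  · rw [P.comp_id, P.comp_id, h]
  · rwa [P.comp_id]

lemma cancel_right {x y z : P.Obj} {g g' : P.Hom y z} {f : P.Hom x y}
    (h : P.comp g f = P.comp g' f) (h0 : P.comp g f ≠ P.zero x z) : g = g' := by
  apply P.cancel f g g' (P.id z)
  · rw [P.id_comp, P.id_comp, h]
  · rwa [P.id_comp]

lemma pipow_add (x : P.Obj) (i j : ℕ) :
    P.pipow x (i + j) = P.comp (P.pipow x i) (P.pipow x j) := by
  induction i with
  | zero => rw [P.pipow_zero, P.id_comp, Nat.zero_add]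
  | succ i ih => rw [Nat.succ_add, P.pipow_succ, ih, P.pipow_succ x i, P.assoc]

lemma pipow_ne_zero {x : P.Obj} {i : ℕ} (h : i < P.nilp x) : P.pipow x i ≠ P.zero x x := by
  intro h0
  apply P.pipow_nilp_ne x
  have : P.nilp x - 1 = (P.nilp x - 1 - i) + i := by omega
  rw [this, pipow_add, h0, P.comp_zero]

lemma id_ne_zero (x : P.Obj) : P.id x ≠ P.zero x x := by
  rw [← P.pipow_zero]
  exact pipow_ne_zero (P.nilp_pos x)

lemma isId_iff {x : P.Obj} {f : P.Hom x x} : P.IsId f ↔ f = P.id x :=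
  ⟨fun ⟨_, h⟩ => eq_of_heq h, fun h => ⟨rfl, heq_of_eq h⟩⟩

/-- A nonidentity endomorphism is a positive power of the generator. -/
lemma endo_pos {x : P.Obj} {f : P.Hom x x} (hf : f ≠ P.id x) :
    ∃ i : ℕ, f = P.comp (P.pipow x 1) (P.pipow x i) := by
  obtain ⟨i, hi⟩ := P.endo_cyclic x f
  cases i with
  | zero => exact absurd (hi.trans (P.pipow_zero x)) hf
  | succ i => exact ⟨i, by rw [hi, P.pipow_succ]⟩

lemma comp_eq_id_endo {x : P.Obj} {f g : P.Hom x x} (h : P.comp g f = P.id x) :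
    f = P.id x ∧ g = P.id x := by
  obtain ⟨i, hi⟩ := P.endo_cyclic x f
  obtain ⟨j, hj⟩ := P.endo_cyclic x g
  have key : i = 0 ∧ j = 0 := by
    by_contra hne
    have h1 : P.pipow x (j + i) = P.id x := by rw [pipow_add, ← hi, ← hj, h]
    have h2 : ∀ n, P.pipow x (n * (j + i)) = P.id x := by
      intro n
      induction n with
      | zero => rw [Nat.zero_mul, P.pipow_zero]
      | succ n ih => rw [Nat.succ_mul, pipow_add, ih, h1, P.id_comp]
    apply id_ne_zero x
    rw [← h2 (P.nilp x)]
    exact pipow_eq_zero (Nat.le_mul_of_pos_right _ (by omega))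
  rw [hi, hj, key.1, key.2, P.pipow_zero]
  exact ⟨rfl, rfl⟩

/-- A factor of an identity is an identity. -/
lemma isId_of_comp_eq_id {x y : P.Obj} {f : P.Hom x y} {g : P.Hom y x}
    (h : P.comp g f = P.id x) : P.IsId f ∧ P.IsId g := by
  have h2 : P.comp f g = P.id y := by
    by_contra hne
    obtain ⟨n, hn⟩ := endo_pos hne
    have step : P.comp (P.comp f g) (P.comp f g) = P.comp f g := by
      rw [P.assoc, ← P.assoc g, h, P.id_comp]
    rw [← P.pipow_succ] at hn
    have h5 : ∀ k, P.pipow y ((k + 1) * (n + 1)) = P.comp f g := by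
      intro k
      induction k with
      | zero => rw [Nat.zero_add, Nat.one_mul, hn]
      | succ k ih => rw [Nat.succ_mul, pipow_add, ih, ← hn, step]
    have h7 : P.comp f g = P.zero y y := by
      rw [← h5 (P.nilp y)]
      exact pipow_eq_zero (by nlinarith)
    apply id_ne_zero x
    have : P.id x = P.comp (P.comp g (P.comp f g)) f := by
      rw [P.assoc, P.assoc, h, P.comp_id, h]
    rw [this, h7, P.comp_zero, P.zero_comp]
  obtain rfl := P.no_iso f g h h2
  obtain ⟨h3, h4⟩ := comp_eq_id_endo h
  exact ⟨isId_iff.2 h3, isId_iff.2 h4⟩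

end RayCategory

/-- A two-sided ideal, as a predicate. -/
structure IsTwoSided (P : RayCategory) (I : ∀ a b : P.Obj, P.Hom a b → Prop) : Prop where
  zero : ∀ a b, I a b (P.zero a b)
  left : ∀ {a b c : P.Obj} (g : P.Hom b c) (f : P.Hom a b), I a b f → I a c (P.comp g f)
  right : ∀ {a b c : P.Obj} (g : P.Hom b c) (f : P.Hom a b), I b c g → I a c (P.comp g f)

/-- A finite acyclic diagram `m` in `P`, with arrows `Q` and nonzero composites `E`, is
*cleaving* if every factorization in `P` of a composite through an arrow comes from the
diagram. -/
structure IsCleaving (P : RayCategory) (I : ∀ a b : P.Obj, P.Hom a b → Prop) {S : Type}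
    (Q E : S → S → Prop) (o : S → P.Obj) (m : ∀ b b', P.Hom (o b) (o b')) : Prop where
  sub : ∀ {b b'}, Q b b' → E b b'
  irrefl : ∀ b, ¬ E b b
  acyclic : ∀ {b b'}, E b b' → ¬ Q b' b
  notId : ∀ {b b'}, Q b b' → ¬ P.IsId (m b b')
  id_notMem : ∀ b, ¬ I (o b) (o b) (P.id (o b))
  notMem : ∀ {b b'}, E b b' → ¬ I (o b) (o b') (m b b')
  comp_left : ∀ {b b' b''}, Q b' b'' → E b b' → E b b'' →
    P.comp (m b' b'') (m b b') = m b b''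
  comp_right : ∀ {b b' b''}, Q b b' → E b' b'' → E b b'' →
    P.comp (m b' b'') (m b b') = m b b''
  lift : ∀ {b b' b''}, Q b' b'' → E b b'' → b ≠ b' → ¬ E b b' →
    ∀ ν : P.Hom (o b) (o b'), P.comp (m b' b'') ν ≠ m b b''
  extend : ∀ {b b' b''}, Q b b' → E b b'' → b' ≠ b'' → ¬ E b' b'' →
    ∀ ν : P.Hom (o b') (o b''), P.comp ν (m b b') ≠ m b b''

/-- A representation of a diagram with arrows `Q` and nonzero composites `E`. -/
structure IsDiagRep (k : Type) [Field k] {S : Type} (Q E : S → S → Prop) (N : S → Type)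
    [∀ b, AddCommGroup (N b)] [∀ b, Module k (N b)] (n : ∀ b b', N b →ₗ[k] N b') : Prop where
  left : ∀ {b b' b''}, Q b' b'' → E b b' → E b b'' → ∀ v, n b' b'' (n b b' v) = n b b'' v
  left_zero : ∀ {b b' b''}, Q b' b'' → E b b' → ¬ E b b'' → ∀ v, n b' b'' (n b b' v) = 0
  right : ∀ {b b' b''}, Q b b' → E b' b'' → E b b'' → ∀ v, n b' b'' (n b b' v) = n b b'' v
  right_zero : ∀ {b b' b''}, Q b b' → E b' b'' → ¬ E b b'' → ∀ v, n b' b'' (n b b' v) = 0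

section Coinduced

variable {P : RayCategory} {I : ∀ a b : P.Obj, P.Hom a b → Prop} {S : Type}
  {Q E : S → S → Prop} {o : S → P.Obj} {m : ∀ b b', P.Hom (o b) (o b')}
  {k : Type} [Field k] {N : S → Type} [∀ b, AddCommGroup (N b)] [∀ b, Module k (N b)]

/-- the value at `a` of the module coinduced from a diagram representation -/
def coindSubmodule (I : ∀ a b : P.Obj, P.Hom a b → Prop) (Q : S → S → Prop)
    (m : ∀ b b', P.Hom (o b) (o b')) (n : ∀ b b', N b →ₗ[k] N b') (a : P.Obj) :
    Submodule k (∀ b : S, P.Hom a (o b) → N b) where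
  carrier := {φ | (∀ b b', Q b b' → ∀ ν : P.Hom a (o b),
    φ b' (P.comp (m b b') ν) = n b b' (φ b ν)) ∧ ∀ b ν, I a (o b) ν → φ b ν = 0}
  zero_mem' := ⟨fun b b' _ ν => (map_zero (n b b')).symm, fun _ _ _ => rfl⟩
  add_mem' := by
    rintro φ ψ ⟨h1, h2⟩ ⟨h3, h4⟩
    refine ⟨fun b b' h ν => ?_, fun b ν h => ?_⟩
    · rw [Pi.add_apply, Pi.add_apply, Pi.add_apply, Pi.add_apply, h1 b b' h, h3 b b' h, map_add]
    · rw [Pi.add_apply, Pi.add_apply, h2 b ν h, h4 b ν h, add_zero]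
  smul_mem' := by
    rintro c φ ⟨h1, h2⟩
    refine ⟨fun b b' h ν => ?_, fun b ν h => ?_⟩
    · rw [Pi.smul_apply, Pi.smul_apply, Pi.smul_apply, Pi.smul_apply, h1 b b' h, map_smul]
    · rw [Pi.smul_apply, Pi.smul_apply, h2 b ν h, smul_zero]

/-- the module coinduced from a diagram representation -/
def coindMod (hI : IsTwoSided P I) (Q : S → S → Prop) (m : ∀ b b', P.Hom (o b) (o b'))
    (n : ∀ b b', N b →ₗ[k] N b') : RMod P k Set.univ I where
  M a := coindSubmodule I Q m n a
  act {a a'} f :=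
    { toFun := fun φ => ⟨fun b ν => φ.1 b (P.comp ν f),
        fun b b' h ν => (congrArg (φ.1 b') (P.assoc _ ν f)).trans (φ.2.1 b b' h _),
        fun b ν h => φ.2.2 b _ (hI.right ν f h)⟩
      map_add' := fun _ _ => rfl
      map_smul' := fun _ _ => rfl }
  act_id a _ := by
    ext φ b ν
    exact congrArg (φ.1 b) (P.comp_id ν)
  act_comp _ _ _ g f := by
    ext φ b ν
    exact congrArg (φ.1 b) (P.assoc ν g f).symm
  act_zero {a a'} _ _ := by
    ext φ b ν
    refine φ.2.2 b _ ?_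
    rw [P.comp_zero]
    exact hI.zero _ _
  supp a h := absurd (Set.mem_univ a) h
  killed f hf := by
    ext φ b ν
    exact φ.2.2 b _ (hI.left ν f hf)

lemma coindMod_finDim (hI : IsTwoSided P I) [Finite S] [∀ b, FiniteDimensional k (N b)]
    (n : ∀ b b', N b →ₗ[k] N b') : (coindMod hI Q m n).FinDim := by
  refine ⟨fun a => inferInstanceAs (FiniteDimensional k (coindSubmodule I Q m n a)), ?_⟩
  refine (Set.finite_iUnion fun b => P.finite_source (o b)).subset ?_
  rintro a ⟨φ, hφ⟩
  by_contra hne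
  apply hφ
  refine Subtype.ext (funext fun b => funext fun ν => φ.2.2 b ν ?_)
  by_contra h
  exact hne (Set.mem_iUnion.2 ⟨b, ν, fun h0 => h (h0 ▸ hI.zero _ _)⟩)

/-- evaluation of the coinduced module at the identity of a point of the diagram -/
def coindEval (hI : IsTwoSided P I) (Q : S → S → Prop) (m : ∀ b b', P.Hom (o b) (o b'))
    (n : ∀ b b', N b →ₗ[k] N b') (b : S) : (coindMod hI Q m n).M (o b) →ₗ[k] N b where
  toFun φ := φ.1 b (P.id (o b))
  map_add' _ _ := rfl
  map_smul' _ _ := rfl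

open Classical in
/-- the section of `coindEval` as a function -/
noncomputable def secFun (E : S → S → Prop) (m : ∀ b b', P.Hom (o b) (o b'))
    (n : ∀ b b', N b →ₗ[k] N b') (b : S) (v : N b) (b' : S) (ν : P.Hom (o b) (o b')) : N b' :=
  if h : b = b' then if HEq ν (P.id (o b)) then h ▸ v else 0
  else if E b b' ∧ ν = m b b' then n b b' v else 0

lemma secFun_id (n : ∀ b b', N b →ₗ[k] N b') (b : S) (v : N b) :
    secFun E m n b v b (P.id (o b)) = v := by
  simp [secFun]

lemma secFun_self (n : ∀ b b', N b →ₗ[k] N b') (b : S) (v : N b) {ν : P.Hom (o b) (o b)}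
    (h : ν ≠ P.id (o b)) : secFun E m n b v b ν = 0 := by
  simp [secFun, h]

lemma secFun_edge (h1 : ∀ b, ¬ E b b) (n : ∀ b b', N b →ₗ[k] N b') {b b' : S} (v : N b)
    (h : E b b') : secFun E m n b v b' (m b b') = n b b' v := by
  have hne : b ≠ b' := by rintro rfl; exact h1 b h
  simp [secFun, hne, h]

lemma secFun_zero (n : ∀ b b', N b →ₗ[k] N b') {b b' : S} (v : N b) (hne : b ≠ b')
    {ν : P.Hom (o b) (o b')} (h : E b b' → ν ≠ m b b') : secFun E m n b v b' ν = 0 := by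
  rw [secFun, dif_neg hne, if_neg fun h' => h h'.1 h'.2]

lemma secFun_add (n : ∀ b b', N b →ₗ[k] N b') {b b' : S} (v w : N b) (ν : P.Hom (o b) (o b')) :
    secFun E m n b (v + w) b' ν = secFun E m n b v b' ν + secFun E m n b w b' ν := by
  unfold secFun
  split_ifs with h
  · subst h; rfl
  · rw [add_zero]
  · rw [map_add]
  · rw [add_zero]

lemma secFun_smul (n : ∀ b b', N b →ₗ[k] N b') {b b' : S} (c : k) (v : N b)
    (ν : P.Hom (o b) (o b')) : secFun E m n b (c • v) b' ν = c • secFun E m n b v b' ν := by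
  unfold secFun
  split_ifs with h
  · subst h; rfl
  · rw [smul_zero]
  · rw [map_smul]
  · rw [smul_zero]

lemma IsTwoSided.ne_zero (hI : IsTwoSided P I) {a b : P.Obj} {f : P.Hom a b}
    (h : ¬ I a b f) : f ≠ P.zero a b := fun h0 => h (h0 ▸ hI.zero _ _)

lemma secFun_mem (hI : IsTwoSided P I) (hc : IsCleaving P I Q E o m)
    {n : ∀ b b', N b →ₗ[k] N b'} (hn : IsDiagRep k Q E N n) (b : S) (v : N b) :
    secFun E m n b v ∈ coindSubmodule I Q m n (o b) := by
  refine ⟨fun b' b'' hQ ν => ?_, fun b' ν hν => ?_⟩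
  · by_cases hbb : b = b'
    · subst hbb
      have hne : b ≠ b'' := by rintro rfl; exact hc.irrefl _ (hc.sub hQ)
      by_cases hν : ν = P.id (o b)
      · rw [hν, secFun_id, P.comp_id, secFun_edge hc.irrefl n v (hc.sub hQ)]
      · rw [secFun_self n b v hν, map_zero]
        refine secFun_zero n v hne fun hE h => hν ?_
        refine P.cancel_left (g := m b b'') (h.trans (P.comp_id _).symm) ?_
        rw [h]
        exact hI.ne_zero (hc.notMem hE)
    · by_cases hν : E b b' ∧ ν = m b b'
      · obtain ⟨hE, rfl⟩ := hν
        rw [secFun_edge hc.irrefl n v hE]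
        by_cases hE2 : E b b''
        · rw [hc.comp_left hQ hE hE2, secFun_edge hc.irrefl n v hE2, hn.left hQ hE hE2]
        · rw [hn.left_zero hQ hE hE2]
          refine secFun_zero n v ?_ fun h => absurd h hE2
          rintro rfl
          exact hc.acyclic hE hQ
      · rw [secFun_zero n v hbb fun h1 h2 => hν ⟨h1, h2⟩, map_zero]
        by_cases hb2 : b = b''
        · subst hb2
          refine secFun_self n b v fun h => hc.notId hQ ?_
          exact (P.isId_of_comp_eq_id h).2
        · refine secFun_zero n v hb2 fun hE h => ?_
          by_cases hE2 : E b b'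
          · refine hν ⟨hE2, P.cancel_left (g := m b' b'') ?_ ?_⟩
            · rw [h, hc.comp_left hQ hE2 hE]
            · rw [h]
              exact hI.ne_zero (hc.notMem hE)
          · exact hc.lift hQ hE hbb hE2 ν h
  · by_cases hbb : b = b'
    · subst hbb
      exact secFun_self n b v fun h => hc.id_notMem b (h ▸ hν)
    · exact secFun_zero n v hbb fun hE h => hc.notMem hE (h ▸ hν)

lemma secFun_naturality (hI : IsTwoSided P I) (hc : IsCleaving P I Q E o m)
    {n : ∀ b b', N b →ₗ[k] N b'} (hn : IsDiagRep k Q E N n) {b b' : S} (hQ : Q b b') (v : N b)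
    (b'' : S) (ν : P.Hom (o b') (o b'')) :
    secFun E m n b v b'' (P.comp ν (m b b')) = secFun E m n b' (n b b' v) b'' ν := by
  by_cases hbb : b' = b''
  · subst hbb
    have hne : b ≠ b' := by rintro rfl; exact hc.irrefl _ (hc.sub hQ)
    by_cases hν : ν = P.id (o b')
    · rw [hν, secFun_id, P.id_comp, secFun_edge hc.irrefl n v (hc.sub hQ)]
    · rw [secFun_self n b' _ hν]
      refine secFun_zero n v hne fun hE h => hν ?_
      refine P.cancel_right (f := m b b') (h.trans (P.id_comp _).symm) ?_
      rw [h]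
      exact hI.ne_zero (hc.notMem hE)
  · by_cases hν : E b' b'' ∧ ν = m b' b''
    · obtain ⟨hE, rfl⟩ := hν
      rw [secFun_edge hc.irrefl n _ hE]
      by_cases hE2 : E b b''
      · rw [hc.comp_right hQ hE hE2, secFun_edge hc.irrefl n v hE2, hn.right hQ hE hE2]
      · rw [hn.right_zero hQ hE hE2]
        refine secFun_zero n v ?_ fun h => absurd h hE2
        rintro rfl
        exact hc.acyclic hE hQ
    · rw [secFun_zero n (n b b' v) hbb fun h1 h2 => hν ⟨h1, h2⟩]
      by_cases hb2 : b = b''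
      · subst hb2
        refine secFun_self n b v fun h => hc.notId hQ ?_
        exact (P.isId_of_comp_eq_id h).1
      · refine secFun_zero n v hb2 fun hE h => ?_
        by_cases hE2 : E b' b''
        · refine hν ⟨hE2, P.cancel_right (f := m b b') ?_ ?_⟩
          · rw [h, hc.comp_right hQ hE2 hE]
          · rw [h]
            exact hI.ne_zero (hc.notMem hE)
        · exact hc.extend hQ hE hbb hE2 ν h

/-- Infinitely many diagram representations separated by functionals contradict
representation-finiteness. -/
theorem RepFin.false_of_diagReps (hrep : RepFin P Set.univ I) (hI : IsTwoSided P I) [Finite S]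
    (hc : IsCleaving P I Q E o m) {T : Type} [Infinite T] (N : T → S → Type)
    [∀ t b, AddCommGroup (N t b)] [∀ t b, Module k (N t b)]
    [∀ t b, FiniteDimensional k (N t b)] (n : ∀ t b b', N t b →ₗ[k] N t b')
    (hn : ∀ t, IsDiagRep k Q E (N t) (n t)) (b0 : S) (v : ∀ t, N t b0)
    (ξ : ∀ t, N t b0 →ₗ[k] k) (h1 : ∀ t, ξ t (v t) ≠ 0)
    (h2 : ∀ s t, s ≠ t → ∀ f : (∀ b, N s b →ₗ[k] N t b),
      (∀ b b', Q b b' → ∀ u, f b' (n s b b' u) = n t b b' (f b u)) →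
      ξ t (f b0 (v s)) = 0) : False := by
  refine hrep.false_of_family (o b0) (fun t => coindMod hI Q m (n t))
    (fun t => coindMod_finDim hI (n t))
    (fun t => ⟨secFun E m (n t) b0 (v t), secFun_mem hI hc (hn t) b0 (v t)⟩)
    (fun t => (ξ t).comp (coindEval hI Q m (n t) b0)) (fun t => ?_) (fun s t hst F => ?_)
  · change ξ t (secFun E m (n t) b0 (v t) b0 (P.id (o b0))) ≠ 0
    rw [secFun_id]
    exact h1 t
  · let sec : ∀ b, N s b →ₗ[k] (coindMod hI Q m (n s)).M (o b) := fun b =>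
      { toFun := fun u => ⟨secFun E m (n s) b u, secFun_mem hI hc (hn s) b u⟩
        map_add' := fun u w => Subtype.ext (funext fun b' => funext fun ν =>
          secFun_add (n s) u w ν)
        map_smul' := fun c u => Subtype.ext (funext fun b' => funext fun ν =>
          secFun_smul (n s) c u ν) }
    refine h2 s t hst (fun b => (coindEval hI Q m (n t) b).comp ((F.app (o b)).comp (sec b))) ?_
    intro b b' hQ u
    have e1 : (coindMod hI Q m (n s)).act (m b b') (sec b u) = sec b' (n s b b' u) :=
      Subtype.ext (funext fun b'' => funext fun ν =>
        secFun_naturality hI hc (hn s) hQ u b'' ν)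
    change coindEval hI Q m (n t) b' (F.app (o b') (sec b' (n s b b' u))) = _
    rw [← e1, ← F.natural_apply]
    have e2 := (F.app (o b) (sec b u)).2.1 b b' hQ (P.id (o b))
    rw [P.comp_id] at e2
    rw [← P.id_comp (m b b')] at e2
    exact e2

end Coinduced

section Subquotients

variable {P : RayCategory} {I : ∀ a b : P.Obj, P.Hom a b → Prop} {S : Type}
  {Q E : S → S → Prop} {o : S → P.Obj} {m : ∀ b b', P.Hom (o b) (o b')}
  {V : Type} [AddCommGroup V] [Module ℚ V]

/-- the subquotient `(U + L) / L` of a vector space, presented as `U / (U ∩ L)` -/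
abbrev Subquot (U L : Submodule ℚ V) : Type := U ⧸ L.comap U.subtype

open Classical in
/-- the map of subquotients induced by the identity (`0` when there is none) -/
noncomputable def subquotMap (U L U' L' : Submodule ℚ V) : Subquot U L →ₗ[ℚ] Subquot U' L' :=
  if h : U ≤ U' ∧ L ≤ L' then
    Submodule.mapQ _ _ (Submodule.inclusion h.1) fun _ hv => h.2 hv
  else 0

lemma subquotMap_mk {U L U' L' : Submodule ℚ V} (h : U ≤ U' ∧ L ≤ L') (v : U) :
    subquotMap U L U' L' (Submodule.Quotient.mk v) =
      Submodule.Quotient.mk (Submodule.inclusion h.1 v) := by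
  rw [subquotMap, dif_pos h]
  rfl

/-- A family of linear relations between two systems of subquotients `U / L` and `U' / L'`
of a vector space, compatible with the arrows `Q` of a diagram. -/
structure IsSubquotHom (Q : S → S → Prop) (U L U' L' : S → Submodule ℚ V)
    (R : S → Submodule ℚ (V × V)) : Prop where
  mem : ∀ {b v w}, (v, w) ∈ R b → w ∈ U' b
  total : ∀ {b v}, v ∈ U b → ∃ w, (v, w) ∈ R b
  zero : ∀ {b v w}, (v, w) ∈ R b → v ∈ L b → w ∈ L' b
  mono : ∀ {b b'}, Q b b' → R b ≤ R b'

lemma IsSubquotHom.sub_mem {U L U' L' : S → Submodule ℚ V} {R : S → Submodule ℚ (V × V)}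
    (h : IsSubquotHom Q U L U' L' R) {b : S} {v w w' : V} (h1 : (v, w) ∈ R b)
    (h2 : (v, w') ∈ R b) : w - w' ∈ L' b := by
  have h3 := (R b).sub_mem h1 h2
  rw [Prod.mk_sub_mk, sub_self] at h3
  exact h.zero h3 (L b).zero_mem

/-- Infinitely many systems of subquotients of a vector space separated by functionals
contradict representation-finiteness. -/
theorem RepFin.false_of_subquotients (hrep : RepFin P Set.univ I) (hI : IsTwoSided P I)
    [Finite S] (hc : IsCleaving P I Q E o m) [FiniteDimensional ℚ V] (U L : ℕ → S → Submodule ℚ V)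
    (mono : ∀ t b b', E b b' → U t b ≤ U t b' ∧ L t b ≤ L t b')
    (vanish : ∀ t b b' b'', Q b b' ∧ E b' b'' ∨ E b b' ∧ Q b' b'' → ¬ E b b'' →
      U t b ≤ L t b'')
    (b0 : S) (v0 : V) (ξ : V →ₗ[ℚ] ℚ) (hv0 : ∀ t, v0 ∈ U t b0) (hξ : ξ v0 ≠ 0)
    (hL : ∀ t, ∀ w ∈ L t b0, ξ w = 0)
    (star : ∀ s t, s ≠ t → ∀ R : S → Submodule ℚ (V × V),
      IsSubquotHom Q (U s) (L s) (U t) (L t) R → ∀ w, (v0, w) ∈ R b0 → ξ w = 0) : False := by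
  have hrepr : ∀ t, IsDiagRep ℚ Q E (fun b => Subquot (U t b) (L t b))
      (fun b b' => subquotMap (U t b) (L t b) (U t b') (L t b')) := by
    intro t
    constructor
    · intro b b' b'' hQ hE hE2 v
      obtain ⟨v, rfl⟩ := Submodule.Quotient.mk_surjective _ v
      rw [subquotMap_mk (mono t _ _ hE), subquotMap_mk (mono t _ _ (hc.sub hQ)),
        subquotMap_mk (mono t _ _ hE2)]
      rfl
    · intro b b' b'' hQ hE hE2 v
      obtain ⟨v, rfl⟩ := Submodule.Quotient.mk_surjective _ v
      rw [subquotMap_mk (mono t _ _ hE), subquotMap_mk (mono t _ _ (hc.sub hQ)),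
        Submodule.Quotient.mk_eq_zero]
      exact vanish t _ _ _ (Or.inr ⟨hE, hQ⟩) hE2 v.2
    · intro b b' b'' hQ hE hE2 v
      obtain ⟨v, rfl⟩ := Submodule.Quotient.mk_surjective _ v
      rw [subquotMap_mk (mono t _ _ (hc.sub hQ)), subquotMap_mk (mono t _ _ hE),
        subquotMap_mk (mono t _ _ hE2)]
      rfl
    · intro b b' b'' hQ hE hE2 v
      obtain ⟨v, rfl⟩ := Submodule.Quotient.mk_surjective _ v
      rw [subquotMap_mk (mono t _ _ (hc.sub hQ)), subquotMap_mk (mono t _ _ hE),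
        Submodule.Quotient.mk_eq_zero]
      exact vanish t _ _ _ (Or.inl ⟨hQ, hE⟩) hE2 v.2
  refine hrep.false_of_diagReps hI hc (fun t b => Subquot (U t b) (L t b)) _ hrepr b0
    (fun t => Submodule.Quotient.mk ⟨v0, hv0 t⟩)
    (fun t => Submodule.liftQ _ (ξ.comp (U t b0).subtype) fun w hw => hL t _ hw)
    (fun t => hξ) ?_
  intro s t hst f hf
  let R : S → Submodule ℚ (V × V) := fun b =>
    { carrier := {p | ∃ (h : p.1 ∈ U s b) (h' : p.2 ∈ U t b),
        f b (Submodule.Quotient.mk ⟨p.1, h⟩) = Submodule.Quotient.mk ⟨p.2, h'⟩}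
      zero_mem' := ⟨zero_mem _, zero_mem _, map_zero (f b)⟩
      add_mem' := by
        rintro ⟨p1, p2⟩ ⟨q1, q2⟩ ⟨h1, h2, h3⟩ ⟨h4, h5, h6⟩
        refine ⟨add_mem h1 h4, add_mem h2 h5, ?_⟩
        have := congrArg₂ (· + ·) h3 h6
        rw [← map_add] at this
        exact this
      smul_mem' := by
        rintro c ⟨p1, p2⟩ ⟨h1, h2, h3⟩
        refine ⟨Submodule.smul_mem _ c h1, Submodule.smul_mem _ c h2, ?_⟩
        have := congrArg (c • ·) h3
        rw [← map_smul] at this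
        exact this }
  have hR : IsSubquotHom Q (U s) (L s) (U t) (L t) R := by
    constructor
    · rintro b v w ⟨_, h, _⟩
      exact h
    · intro b v hv
      obtain ⟨w, hw⟩ := Submodule.Quotient.mk_surjective _ (f b (Submodule.Quotient.mk ⟨v, hv⟩))
      exact ⟨w, hv, w.2, hw.symm⟩
    · rintro b v w ⟨h, h', h2⟩ hv
      have h3 : (Submodule.Quotient.mk ⟨v, h⟩ : Subquot (U s b) (L s b)) = 0 :=
        (Submodule.Quotient.mk_eq_zero _).2 hv
      rw [h3, map_zero] at h2
      exact (Submodule.Quotient.mk_eq_zero ((L t b).comap (U t b).subtype)).1 h2.symm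
    · rintro b b' hQ ⟨v, w⟩ ⟨h, h', h2⟩
      have hm := mono s _ _ (hc.sub hQ)
      have hm' := mono t _ _ (hc.sub hQ)
      refine ⟨hm.1 h, hm'.1 h', ?_⟩
      have h3 := hf b b' hQ (Submodule.Quotient.mk ⟨v, h⟩)
      rw [h2, subquotMap_mk hm, subquotMap_mk hm'] at h3
      exact h3
  obtain ⟨w, hw⟩ := hR.total (hv0 s)
  have h1 := star s t hst R hR w hw
  obtain ⟨h, h', h2⟩ := hw
  rw [h2]
  exact h1

end Subquotients

/-- The subspace of `ℚⁿ` cut out by a list of linear equations. -/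
def lin {n : ℕ} (l : List (Fin n → ℚ)) : Submodule ℚ (Fin n → ℚ) where
  carrier := {v | ∀ c ∈ l, ∑ i, c i * v i = 0}
  zero_mem' := fun c _ => by simp
  add_mem' := by
    intro v w hv hw c hc
    simp only [Pi.add_apply, mul_add, Finset.sum_add_distrib]
    rw [hv c hc, hw c hc, add_zero]
  smul_mem' := by
    intro a v hv c hc
    have h : ∀ i, c i * (a • v) i = a * (c i * v i) := fun i => by
      rw [Pi.smul_apply, smul_eq_mul]; ring
    simp only [h]
    rw [← Finset.mul_sum, hv c hc, mul_zero]

@[simp] lemma mem_lin_nil {n : ℕ} (v : Fin n → ℚ) : v ∈ lin [] := by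
  intro c hc
  exact absurd hc List.not_mem_nil

@[simp] lemma mem_lin_cons {n : ℕ} (c : Fin n → ℚ) (l : List (Fin n → ℚ)) (v : Fin n → ℚ) :
    v ∈ lin (c :: l) ↔ ∑ i, c i * v i = 0 ∧ v ∈ lin l :=
  List.forall_mem_cons

inductive Crown | a1 | a2 | b1 | b2

namespace Crown

inductive Q : Crown → Crown → Prop
  | b1a1 : Q b1 a1
  | b1a2 : Q b1 a2
  | b2a1 : Q b2 a1
  | b2a2 : Q b2 a2

inductive E : Crown → Crown → Prop
  | b1a1 : E b1 a1
  | b1a2 : E b1 a2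
  | b2a1 : E b2 a1
  | b2a2 : E b2 a2

def U : Crown → Submodule ℚ (Fin 2 → ℚ)
  | b1 => lin [![0, 1]]
  | b2 => lin [![1, 0]]
  | _ => ⊤

def L (t : ℕ) : Crown → Submodule ℚ (Fin 2 → ℚ)
  | a1 => lin [![1, -1]]
  | a2 => lin [![(t : ℚ), -1]]
  | _ => ⊥

instance : Finite Crown := Finite.of_surjective ![a1, a2, b1, b2]
  (by rintro ⟨⟩ <;> simp [Fin.exists_fin_succ])

theorem false_of_isCleaving {P : RayCategory} {I : ∀ a b : P.Obj, P.Hom a b → Prop}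
    (hrep : RepFin P Set.univ I) (hI : IsTwoSided P I) {o : Crown → P.Obj}
    {m : ∀ b b', P.Hom (o b) (o b')} (hc : IsCleaving P I Q E o m) : False := by
  refine hrep.false_of_subquotients hI hc (fun _ => U) L ?_ ?_ b1 ![1, 0]
    (LinearMap.proj 0) ?_ ?_ ?_ ?_
  · rintro t _ _ ⟨⟩ <;> simp [U, L]
  · rintro t _ _ _ (⟨⟨⟩, ⟨⟩⟩ | ⟨⟨⟩, ⟨⟩⟩) hE
  · simp [U]
  · simp
  · simp [L]
  · intro s t hst R h w hw
    have e1 := h.mem hw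
    obtain ⟨w1, hw1⟩ := h.total (b := b2) (v := ![0, 1]) (by simp [U])
    have e2 := h.mem hw1
    have e3 := h.zero ((R a1).add_mem (h.mono .b1a1 hw) (h.mono .b2a1 hw1))
    have e4 := h.zero ((R a2).add_mem (h.mono .b1a2 hw) ((R a2).smul_mem (s : ℚ) (h.mono .b2a2
      hw1)))
    simp [U, L] at e1 e2 e3 e4 ⊢
    have h0 : ((s : ℚ) - t) * w 0 = 0 := by grind
    simpa [sub_eq_zero, hst] using h0

end Crown

inductive ShA | c1 | c2 | x1 | x2 | x3 | y0 | y1 | y2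

namespace ShA

inductive Q : ShA → ShA → Prop
  | x1c1 : Q x1 c1
  | c1x2 : Q c1 x2
  | x2c2 : Q x2 c2
  | c2x3 : Q c2 x3
  | c1y1 : Q c1 y1
  | c2y2 : Q c2 y2
  | y0y1 : Q y0 y1
  | y1y2 : Q y1 y2

inductive E : ShA → ShA → Prop
  | x1c1 : E x1 c1
  | c1x2 : E c1 x2
  | x2c2 : E x2 c2
  | c2x3 : E c2 x3
  | c1y1 : E c1 y1
  | c2y2 : E c2 y2
  | y0y1 : E y0 y1
  | y1y2 : E y1 y2
  | x1x2 : E x1 x2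
  | x1c2 : E x1 c2
  | x1x3 : E x1 x3
  | x1y1 : E x1 y1
  | x1y2 : E x1 y2
  | c1c2 : E c1 c2
  | c1x3 : E c1 x3
  | c1y2 : E c1 y2
  | x2x3 : E x2 x3
  | x2y2 : E x2 y2
  | y0y2 : E y0 y2

def U : ShA → Submodule ℚ (Fin 2 → ℚ)
  | x1 => lin [![0, 1]]
  | y0 => lin [![1, -1]]
  | _ => ⊤

def L (t : ℕ) : ShA → Submodule ℚ (Fin 2 → ℚ)
  | x3 => lin [![1, 0]]
  | y2 => lin [![(t : ℚ), -1]]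
  | _ => ⊥

instance : Finite ShA := Finite.of_surjective ![c1, c2, x1, x2, x3, y0, y1, y2]
  (by rintro ⟨⟩ <;> simp [Fin.exists_fin_succ])

theorem false_of_isCleaving {P : RayCategory} {I : ∀ a b : P.Obj, P.Hom a b → Prop}
    (hrep : RepFin P Set.univ I) (hI : IsTwoSided P I) {o : ShA → P.Obj}
    {m : ∀ b b', P.Hom (o b) (o b')} (hc : IsCleaving P I Q E o m) : False := by
  refine hrep.false_of_subquotients hI hc (fun _ => U) L ?_ ?_ x1 ![1, 0]
    (LinearMap.proj 0) ?_ ?_ ?_ ?_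
  · rintro t _ _ ⟨⟩ <;> simp [U, L]
  · rintro t _ _ _ (⟨⟨⟩, ⟨⟩⟩ | ⟨⟨⟩, ⟨⟩⟩) hE <;> exact absurd (by constructor) hE
  · simp [U]
  · simp
  · simp [L]
  · intro s t hst R h w hw
    have e1 := h.mem hw
    obtain ⟨w1, hw1⟩ := h.total (b := c1) (v := ![0, 1]) (by simp [U])
    have e2 := h.mem hw1
    obtain ⟨w2, hw2⟩ := h.total (b := y0) (v := ![1, 1]) (by simp [U])
    have e3 := h.mem hw2
    have e4 := h.zero (h.mono .c2x3 (h.mono .x2c2 (h.mono .c1x2 hw1)))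
    have e5 := h.zero (h.mono .y1y2 ((R y1).add_mem (h.mono .c1y1 (h.mono .x1c1 hw)) ((R
      y1).smul_mem (s : ℚ) (h.mono .c1y1 hw1))))
    have e6 := h.zero ((R y1).sub_mem (h.mono .y0y1 hw2) ((R y1).add_mem (h.mono .c1y1 (h.mono
      .x1c1 hw)) (h.mono .c1y1 hw1)))
    simp [U, L] at e1 e2 e3 e4 e5 e6 ⊢
    have f00 := congrFun e6 0
    have f01 := congrFun e6 1
    simp at f00 f01
    have h0 : ((s : ℚ) - t) * w 0 = 0 := by grind
    simpa [sub_eq_zero, hst] using h0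

end ShA

inductive ShB | c1 | c2 | x1 | x2 | x3 | y0 | y1 | y2

namespace ShB

inductive Q : ShB → ShB → Prop
  | x1c1 : Q x1 c1
  | c1x2 : Q c1 x2
  | x2c2 : Q x2 c2
  | c2x3 : Q c2 x3
  | x1y1 : Q x1 y1
  | x2y2 : Q x2 y2
  | y0y1 : Q y0 y1
  | y1y2 : Q y1 y2

inductive E : ShB → ShB → Prop
  | x1c1 : E x1 c1
  | c1x2 : E c1 x2
  | x2c2 : E x2 c2
  | c2x3 : E c2 x3
  | x1y1 : E x1 y1
  | x2y2 : E x2 y2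
  | y0y1 : E y0 y1
  | y1y2 : E y1 y2
  | x1x2 : E x1 x2
  | x1c2 : E x1 c2
  | x1x3 : E x1 x3
  | x1y2 : E x1 y2
  | c1c2 : E c1 c2
  | c1x3 : E c1 x3
  | c1y2 : E c1 y2
  | x2x3 : E x2 x3
  | y0y2 : E y0 y2

def U : ShB → Submodule ℚ (Fin 4 → ℚ)
  | x1 => lin [![0, 1, 0, 0], ![0, 0, 1, 0], ![0, 0, 0, 1]]
  | c1 => lin [![0, 0, 1, 0], ![0, 0, 0, 1]]
  | x2 => lin [![0, 0, 0, 1]]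
  | c2 => lin [![0, 0, 0, 1]]
  | x3 => lin [![0, 0, 0, 1]]
  | y1 => lin [![0, 1, 0, 0], ![0, 0, 1, 0]]
  | y0 => lin [![1, 0, 0, 0], ![0, 1, 0, 0], ![0, 0, 1, 0]]
  | _ => ⊤

def L (t : ℕ) : ShB → Submodule ℚ (Fin 4 → ℚ)
  | c2 => lin [![1, 0, 0, 0], ![0, 1, 0, 0], ![0, 0, 0, 1]]
  | x3 => lin [![1, 0, 0, 0], ![0, 0, 0, 1]]
  | y2 => lin [![1, 1, -1, 0], ![1, (t : ℚ), 0, -1]]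
  | _ => ⊥

instance : Finite ShB := Finite.of_surjective ![c1, c2, x1, x2, x3, y0, y1, y2]
  (by rintro ⟨⟩ <;> simp [Fin.exists_fin_succ])

theorem false_of_isCleaving {P : RayCategory} {I : ∀ a b : P.Obj, P.Hom a b → Prop}
    (hrep : RepFin P Set.univ I) (hI : IsTwoSided P I) {o : ShB → P.Obj}
    {m : ∀ b b', P.Hom (o b) (o b')} (hc : IsCleaving P I Q E o m) : False := by
  refine hrep.false_of_subquotients hI hc (fun _ => U) L ?_ ?_ x1 ![1, 0, 0, 0]
    (LinearMap.proj 0) ?_ ?_ ?_ ?_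
  · rintro t _ _ ⟨⟩ <;> refine ⟨fun v hv => ?_, fun v hv => ?_⟩ <;>
      simp [U, L, Fin.sum_univ_succ] at hv ⊢ <;>
      first | grind | simp [hv]
  · rintro t _ _ _ (⟨⟨⟩, ⟨⟩⟩ | ⟨⟨⟩, ⟨⟩⟩) hE <;> exact absurd (by constructor) hE
  · simp [U, Fin.sum_univ_succ]
  · simp
  · simp [L]
  · intro s t hst R h w hw
    have e1 := h.mem hw
    obtain ⟨w1, hw1⟩ := h.total (b := c1) (v := ![0, 1, 0, 0]) (by simp [U, Fin.sum_univ_succ])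
    have e2 := h.mem hw1
    obtain ⟨w2, hw2⟩ := h.total (b := x2) (v := ![0, 0, 1, 0]) (by simp [U, Fin.sum_univ_succ])
    have e3 := h.mem hw2
    obtain ⟨w3, hw3⟩ := h.total (b := y0) (v := ![0, 0, 0, 1]) (by simp [U, Fin.sum_univ_succ])
    have e4 := h.mem hw3
    have e5 := h.zero (h.mono .x2c2 hw2)
    have e6 := h.zero (h.mono .c2x3 (h.mono .x2c2 (h.mono .c1x2 hw1)))
    have e7 := h.zero ((R y2).add_mem (h.mono .x2y2 (h.mono .c1x2 (h.mono .x1c1 hw))) ((R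
      y2).add_mem (h.mono .x2y2 hw2) (h.mono .y1y2 (h.mono .y0y1 hw3))))
    have e8 := h.zero ((R y2).add_mem (h.mono .x2y2 (h.mono .c1x2 hw1)) ((R y2).add_mem (h.mono
      .x2y2 hw2) ((R y2).smul_mem (s : ℚ) (h.mono .y1y2 (h.mono .y0y1 hw3)))))
    simp [U, L, Fin.sum_univ_succ] at e1 e2 e3 e4 e5 e6 e7 e8 ⊢
    have h0 : ((s : ℚ) - t) * w 0 = 0 := by grind
    simpa [sub_eq_zero, hst] using h0

end ShB

inductive ShC | c1 | c2 | c3 | x2 | x3 | x4 | y0 | y1 | y2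

namespace ShC

inductive Q : ShC → ShC → Prop
  | c1y1 : Q c1 y1
  | y0y1 : Q y0 y1
  | y1y2 : Q y1 y2
  | x2x3 : Q x2 x3
  | x3x4 : Q x3 x4
  | x2c2 : Q x2 c2
  | c2y2 : Q c2 y2
  | x3c3 : Q x3 c3

inductive E : ShC → ShC → Prop
  | c1y1 : E c1 y1
  | y0y1 : E y0 y1
  | y1y2 : E y1 y2
  | x2x3 : E x2 x3
  | x3x4 : E x3 x4
  | x2c2 : E x2 c2
  | c2y2 : E c2 y2
  | x3c3 : E x3 c3
  | c1y2 : E c1 y2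
  | y0y2 : E y0 y2
  | x2x4 : E x2 x4
  | x2y2 : E x2 y2
  | x2c3 : E x2 c3

def U : ShC → Submodule ℚ (Fin 2 → ℚ)
  | c1 => lin [![0, 1]]
  | y0 => lin [![1, 0]]
  | _ => ⊤

def L (t : ℕ) : ShC → Submodule ℚ (Fin 2 → ℚ)
  | c3 => lin [![1, -1]]
  | x4 => lin [![(t : ℚ), -1]]
  | _ => ⊥

instance : Finite ShC := Finite.of_surjective ![c1, c2, c3, x2, x3, x4, y0, y1, y2]
  (by rintro ⟨⟩ <;> simp [Fin.exists_fin_succ])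

theorem false_of_isCleaving {P : RayCategory} {I : ∀ a b : P.Obj, P.Hom a b → Prop}
    (hrep : RepFin P Set.univ I) (hI : IsTwoSided P I) {o : ShC → P.Obj}
    {m : ∀ b b', P.Hom (o b) (o b')} (hc : IsCleaving P I Q E o m) : False := by
  refine hrep.false_of_subquotients hI hc (fun _ => U) L ?_ ?_ c1 ![1, 0]
    (LinearMap.proj 0) ?_ ?_ ?_ ?_
  · rintro t _ _ ⟨⟩ <;> simp [U, L]
  · rintro t _ _ _ (⟨⟨⟩, ⟨⟩⟩ | ⟨⟨⟩, ⟨⟩⟩) hE <;> exact absurd (by constructor) hE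
  · simp [U]
  · simp
  · simp [L]
  · intro s t hst R h w hw
    have e1 := h.mem hw
    obtain ⟨w1, hw1⟩ := h.total (b := y0) (v := ![0, 1]) (by simp [U])
    have e2 := h.mem hw1
    obtain ⟨a, hwa⟩ := h.total (b := x2) (v := ![1, 0]) (by simp [U])
    have e3 := h.mem hwa
    obtain ⟨b, hwb⟩ := h.total (b := x2) (v := ![0, 1]) (by simp [U])
    have e4 := h.mem hwb
    have e5 := h.zero (h.mono .x3c3 (h.mono .x2x3 ((R x2).add_mem hwa hwb)))
    have e6 := h.zero (h.mono .x3x4 (h.mono .x2x3 ((R x2).add_mem hwa ((R x2).smul_mem (s : ℚ)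
      hwb))))
    have e7 := h.zero ((R y2).sub_mem (h.mono .c2y2 (h.mono .x2c2 hwa)) (h.mono .y1y2 (h.mono
      .c1y1 hw)))
    have e8 := h.zero ((R y2).sub_mem (h.mono .c2y2 (h.mono .x2c2 hwb)) (h.mono .y1y2 (h.mono
      .y0y1 hw1)))
    simp [U, L] at e1 e2 e3 e4 e5 e6 e7 e8 ⊢
    have f00 := congrFun e7 0
    have f01 := congrFun e7 1
    have f10 := congrFun e8 0
    have f11 := congrFun e8 1
    simp at f00 f01 f10 f11
    have h0 : ((s : ℚ) - t) * w 0 = 0 := by grind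
    simpa [sub_eq_zero, hst] using h0

end ShC

inductive ShD | c0 | c1 | x1 | x2 | y0 | y1

namespace ShD

inductive Q : ShD → ShD → Prop
  | x1x2 : Q x1 x2
  | x1c1 : Q x1 c1
  | x1y1 : Q x1 y1
  | y0y1 : Q y0 y1
  | c0y1 : Q c0 y1

inductive E : ShD → ShD → Prop
  | x1x2 : E x1 x2
  | x1c1 : E x1 c1
  | x1y1 : E x1 y1
  | y0y1 : E y0 y1
  | c0y1 : E c0 y1

def U : ShD → Submodule ℚ (Fin 2 → ℚ)
  | y0 => lin [![0, 1]]
  | c0 => lin [![1, 0]]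
  | _ => ⊤

def L (t : ℕ) : ShD → Submodule ℚ (Fin 2 → ℚ)
  | x2 => lin [![1, -1]]
  | c1 => lin [![(t : ℚ), -1]]
  | _ => ⊥

instance : Finite ShD := Finite.of_surjective ![c0, c1, x1, x2, y0, y1]
  (by rintro ⟨⟩ <;> simp [Fin.exists_fin_succ])

theorem false_of_isCleaving {P : RayCategory} {I : ∀ a b : P.Obj, P.Hom a b → Prop}
    (hrep : RepFin P Set.univ I) (hI : IsTwoSided P I) {o : ShD → P.Obj}
    {m : ∀ b b', P.Hom (o b) (o b')} (hc : IsCleaving P I Q E o m) : False := by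
  refine hrep.false_of_subquotients hI hc (fun _ => U) L ?_ ?_ y0 ![1, 0]
    (LinearMap.proj 0) ?_ ?_ ?_ ?_
  · rintro t _ _ ⟨⟩ <;> simp [U, L]
  · rintro t _ _ _ (⟨⟨⟩, ⟨⟩⟩ | ⟨⟨⟩, ⟨⟩⟩) hE
  · simp [U]
  · simp
  · simp [L]
  · intro s t hst R h w hw
    have e1 := h.mem hw
    obtain ⟨w1, hw1⟩ := h.total (b := c0) (v := ![0, 1]) (by simp [U])
    have e2 := h.mem hw1
    obtain ⟨a, hwa⟩ := h.total (b := x1) (v := ![1, 0]) (by simp [U])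
    have e3 := h.mem hwa
    obtain ⟨b, hwb⟩ := h.total (b := x1) (v := ![0, 1]) (by simp [U])
    have e4 := h.mem hwb
    have e5 := h.zero (h.mono .x1x2 ((R x1).add_mem hwa hwb))
    have e6 := h.zero (h.mono .x1c1 ((R x1).add_mem hwa ((R x1).smul_mem (s : ℚ) hwb)))
    have e7 := h.zero ((R y1).sub_mem (h.mono .x1y1 hwa) (h.mono .y0y1 hw))
    have e8 := h.zero ((R y1).sub_mem (h.mono .x1y1 hwb) (h.mono .c0y1 hw1))
    simp [U, L] at e1 e2 e3 e4 e5 e6 e7 e8 ⊢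
    have f00 := congrFun e7 0
    have f01 := congrFun e7 1
    have f10 := congrFun e8 0
    have f11 := congrFun e8 1
    simp at f00 f01 f10 f11
    have h0 : ((s : ℚ) - t) * w 0 = 0 := by grind
    simpa [sub_eq_zero, hst] using h0

end ShD

inductive ShE | c0 | c1 | x1 | x2 | y0 | y1 | y2

namespace ShE

inductive Q : ShE → ShE → Prop
  | x1x2 : Q x1 x2
  | x1c1 : Q x1 c1
  | c0x2 : Q c0 x2
  | x1y1 : Q x1 y1
  | x2y2 : Q x2 y2
  | y0y1 : Q y0 y1
  | y1y2 : Q y1 y2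

inductive E : ShE → ShE → Prop
  | x1x2 : E x1 x2
  | x1c1 : E x1 c1
  | c0x2 : E c0 x2
  | x1y1 : E x1 y1
  | x2y2 : E x2 y2
  | y0y1 : E y0 y1
  | y1y2 : E y1 y2
  | x1y2 : E x1 y2
  | c0y2 : E c0 y2
  | y0y2 : E y0 y2

def U : ShE → Submodule ℚ (Fin 2 → ℚ)
  | c0 => lin [![0, 1]]
  | y0 => lin [![1, 0]]
  | _ => ⊤

def L (t : ℕ) : ShE → Submodule ℚ (Fin 2 → ℚ)
  | c1 => lin [![1, -1]]
  | y2 => lin [![(t : ℚ), -1]]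
  | _ => ⊥

instance : Finite ShE := Finite.of_surjective ![c0, c1, x1, x2, y0, y1, y2]
  (by rintro ⟨⟩ <;> simp [Fin.exists_fin_succ])

theorem false_of_isCleaving {P : RayCategory} {I : ∀ a b : P.Obj, P.Hom a b → Prop}
    (hrep : RepFin P Set.univ I) (hI : IsTwoSided P I) {o : ShE → P.Obj}
    {m : ∀ b b', P.Hom (o b) (o b')} (hc : IsCleaving P I Q E o m) : False := by
  refine hrep.false_of_subquotients hI hc (fun _ => U) L ?_ ?_ c0 ![1, 0]
    (LinearMap.proj 0) ?_ ?_ ?_ ?_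
  · rintro t _ _ ⟨⟩ <;> simp [U, L]
  · rintro t _ _ _ (⟨⟨⟩, ⟨⟩⟩ | ⟨⟨⟩, ⟨⟩⟩) hE <;> exact absurd (by constructor) hE
  · simp [U]
  · simp
  · simp [L]
  · intro s t hst R h w hw
    have e1 := h.mem hw
    obtain ⟨w1, hw1⟩ := h.total (b := y0) (v := ![0, 1]) (by simp [U])
    have e2 := h.mem hw1
    obtain ⟨a, hwa⟩ := h.total (b := x1) (v := ![1, 0]) (by simp [U])
    have e3 := h.mem hwa
    obtain ⟨b, hwb⟩ := h.total (b := x1) (v := ![0, 1]) (by simp [U])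
    have e4 := h.mem hwb
    have e5 := h.zero (h.mono .x1c1 ((R x1).add_mem hwa hwb))
    have e6 := h.zero ((R y2).add_mem (h.mono .x2y2 (h.mono .c0x2 hw)) ((R y2).smul_mem (s : ℚ)
      (h.mono .y1y2 (h.mono .y0y1 hw1))))
    have e7 := h.zero ((R x2).sub_mem (h.mono .x1x2 hwa) (h.mono .c0x2 hw))
    have e8 := h.zero ((R y1).sub_mem (h.mono .x1y1 hwb) (h.mono .y0y1 hw1))
    simp [U, L] at e1 e2 e3 e4 e5 e6 e7 e8 ⊢
    have f00 := congrFun e7 0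
    have f01 := congrFun e7 1
    have f10 := congrFun e8 0
    have f11 := congrFun e8 1
    simp at f00 f01 f10 f11
    have h0 : ((s : ℚ) - t) * w 0 = 0 := by grind
    simpa [sub_eq_zero, hst] using h0

end ShE

inductive ShF | c1 | x1 | x2 | x3 | y0 | y1 | y2

namespace ShF

inductive Q : ShF → ShF → Prop
  | x1x2 : Q x1 x2
  | x2x3 : Q x2 x3
  | x1y1 : Q x1 y1
  | x2y2 : Q x2 y2
  | y0y1 : Q y0 y1
  | y1y2 : Q y1 y2
  | x1c1 : Q x1 c1

inductive E : ShF → ShF → Prop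
  | x1x2 : E x1 x2
  | x2x3 : E x2 x3
  | x1y1 : E x1 y1
  | x2y2 : E x2 y2
  | y0y1 : E y0 y1
  | y1y2 : E y1 y2
  | x1c1 : E x1 c1
  | x1x3 : E x1 x3
  | x1y2 : E x1 y2
  | y0y2 : E y0 y2

def U : ShF → Submodule ℚ (Fin 2 → ℚ)
  | y0 => lin [![0, 1]]
  | _ => ⊤

def L (t : ℕ) : ShF → Submodule ℚ (Fin 2 → ℚ)
  | x3 => lin [![1, 0]]
  | y2 => lin [![1, -1]]
  | c1 => lin [![(t : ℚ), -1]]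
  | _ => ⊥

instance : Finite ShF := Finite.of_surjective ![c1, x1, x2, x3, y0, y1, y2]
  (by rintro ⟨⟩ <;> simp [Fin.exists_fin_succ])

theorem false_of_isCleaving {P : RayCategory} {I : ∀ a b : P.Obj, P.Hom a b → Prop}
    (hrep : RepFin P Set.univ I) (hI : IsTwoSided P I) {o : ShF → P.Obj}
    {m : ∀ b b', P.Hom (o b) (o b')} (hc : IsCleaving P I Q E o m) : False := by
  refine hrep.false_of_subquotients hI hc (fun _ => U) L ?_ ?_ y0 ![1, 0]
    (LinearMap.proj 0) ?_ ?_ ?_ ?_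
  · rintro t _ _ ⟨⟩ <;> simp [U, L]
  · rintro t _ _ _ (⟨⟨⟩, ⟨⟩⟩ | ⟨⟨⟩, ⟨⟩⟩) hE <;> exact absurd (by constructor) hE
  · simp [U]
  · simp
  · simp [L]
  · intro s t hst R h w hw
    have e1 := h.mem hw
    obtain ⟨a, hwa⟩ := h.total (b := x1) (v := ![1, 0]) (by simp [U])
    have e2 := h.mem hwa
    obtain ⟨b, hwb⟩ := h.total (b := x1) (v := ![0, 1]) (by simp [U])
    have e3 := h.mem hwb
    have e4 := h.zero (h.mono .x2x3 (h.mono .x1x2 hwb))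
    have e5 := h.zero (h.mono .y1y2 (h.mono .x1y1 ((R x1).add_mem hwa hwb)))
    have e6 := h.zero (h.mono .x1c1 ((R x1).add_mem hwa ((R x1).smul_mem (s : ℚ) hwb)))
    have e7 := h.zero ((R y1).sub_mem (h.mono .x1y1 hwa) (h.mono .y0y1 hw))
    simp [U, L] at e1 e2 e3 e4 e5 e6 e7 ⊢
    have f00 := congrFun e7 0
    have f01 := congrFun e7 1
    simp at f00 f01
    have h0 : ((s : ℚ) - t) * w 0 = 0 := by grind
    simpa [sub_eq_zero, hst] using h0

end ShF

inductive ShG | c3 | x1 | x2 | x3 | y0 | y1 | y2 | z0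

namespace ShG

inductive Q : ShG → ShG → Prop
  | x1x2 : Q x1 x2
  | x2x3 : Q x2 x3
  | c3x3 : Q c3 x3
  | x1y1 : Q x1 y1
  | x2y2 : Q x2 y2
  | y0y1 : Q y0 y1
  | y1y2 : Q y1 y2
  | y0z0 : Q y0 z0

inductive E : ShG → ShG → Prop
  | x1x2 : E x1 x2
  | x2x3 : E x2 x3
  | c3x3 : E c3 x3
  | x1y1 : E x1 y1
  | x2y2 : E x2 y2
  | y0y1 : E y0 y1
  | y1y2 : E y1 y2
  | y0z0 : E y0 z0
  | x1x3 : E x1 x3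
  | x1y2 : E x1 y2
  | y0y2 : E y0 y2

def U : ShG → Submodule ℚ (Fin 4 → ℚ)
  | x1 => lin [![1, 0, 0, 0], ![0, 0, 0, 1]]
  | x2 => lin [![0, 0, 0, 1]]
  | x3 => lin [![0, 0, 0, 1]]
  | y0 => lin [![1, 0, 0, 0], ![0, 1, 0, 0]]
  | y1 => lin [![1, 0, 0, 0]]
  | z0 => lin [![1, 0, 0, 0], ![0, 1, 0, 0]]
  | c3 => lin [![0, 0, 1, 0], ![0, 0, 0, 1]]
  | _ => ⊤

def L (t : ℕ) : ShG → Submodule ℚ (Fin 4 → ℚ)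
  | x3 => lin [![0, 1, 0, 0], ![0, 0, 1, 0], ![0, 0, 0, 1]]
  | c3 => lin [![0, 1, 0, 0], ![0, 0, 1, 0], ![0, 0, 0, 1]]
  | z0 => lin [![1, 0, 0, 0], ![0, 1, 0, 0], ![0, 0, 1, 0]]
  | y2 => lin [![1, 1, -1, 0], ![1, (t : ℚ), 0, -1]]
  | _ => ⊥

instance : Finite ShG := Finite.of_surjective ![c3, x1, x2, x3, y0, y1, y2, z0]
  (by rintro ⟨⟩ <;> simp [Fin.exists_fin_succ])

theorem false_of_isCleaving {P : RayCategory} {I : ∀ a b : P.Obj, P.Hom a b → Prop}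
    (hrep : RepFin P Set.univ I) (hI : IsTwoSided P I) {o : ShG → P.Obj}
    {m : ∀ b b', P.Hom (o b) (o b')} (hc : IsCleaving P I Q E o m) : False := by
  refine hrep.false_of_subquotients hI hc (fun _ => U) L ?_ ?_ x1 ![0, 1, 0, 0]
    (LinearMap.proj 1) ?_ ?_ ?_ ?_
  · rintro t _ _ ⟨⟩ <;> refine ⟨fun v hv => ?_, fun v hv => ?_⟩ <;>
      simp [U, L, Fin.sum_univ_succ] at hv ⊢ <;>
      first | grind | simp [hv]
  · rintro t _ _ _ (⟨⟨⟩, ⟨⟩⟩ | ⟨⟨⟩, ⟨⟩⟩) hE <;> exact absurd (by constructor) hE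
  · simp [U, Fin.sum_univ_succ]
  · simp
  · simp [L]
  · intro s t hst R h w hw
    have e1 := h.mem hw
    obtain ⟨w0, hw0⟩ := h.total (b := x2) (v := ![1, 0, 0, 0]) (by simp [U, Fin.sum_univ_succ])
    have e2 := h.mem hw0
    obtain ⟨w2, hw2⟩ := h.total (b := x1) (v := ![0, 0, 1, 0]) (by simp [U, Fin.sum_univ_succ])
    have e3 := h.mem hw2
    obtain ⟨u, hwu⟩ := h.total (b := c3) (v := ![0, 1, 0, 0]) (by simp [U, Fin.sum_univ_succ])
    have e4 := h.mem hwu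
    obtain ⟨v, hwv⟩ := h.total (b := y0) (v := ![0, 0, 1, 0]) (by simp [U, Fin.sum_univ_succ])
    have e5 := h.mem hwv
    obtain ⟨w3, hw3⟩ := h.total (b := y0) (v := ![0, 0, 0, 1]) (by simp [U, Fin.sum_univ_succ])
    have e6 := h.mem hw3
    have e7 := h.zero (h.mono .x2x3 hw0)
    have e8 := h.zero ((R x3).sub_mem (h.mono .x2x3 (h.mono .x1x2 hw)) (h.mono .c3x3 hwu))
    have e9 := h.zero (h.mono .y0z0 hw3)
    have e10 := h.zero ((R y2).add_mem (h.mono .x2y2 hw0) ((R y2).add_mem (h.mono .x2y2 (h.mono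
      .x1x2 hw2)) (h.mono .y1y2 (h.mono .y0y1 hw3))))
    have e11 := h.zero ((R y2).add_mem (h.mono .x2y2 (h.mono .x1x2 hw)) ((R y2).add_mem (h.mono
      .x2y2 (h.mono .x1x2 hw2)) ((R y2).smul_mem (s : ℚ) (h.mono .y1y2 (h.mono .y0y1 hw3)))))
    have e12 := h.zero ((R y1).sub_mem (h.mono .x1y1 hw2) (h.mono .y0y1 hwv))
    simp [U, L, Fin.sum_univ_succ] at e1 e2 e3 e4 e5 e6 e7 e8 e9 e10 e11 e12 ⊢
    have f00 := congrFun e12 0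
    have f01 := congrFun e12 1
    have f02 := congrFun e12 2
    have f03 := congrFun e12 3
    simp at f00 f01 f02 f03
    have h0 : ((s : ℚ) - t) * w 1 = 0 := by grind
    simpa [sub_eq_zero, hst] using h0

end ShG

inductive ShH | c0 | x1 | x2 | y0 | y1 | y2 | z0

namespace ShH

inductive Q : ShH → ShH → Prop
  | y0c0 : Q y0 c0
  | y0z0 : Q y0 z0
  | y0y1 : Q y0 y1
  | y1y2 : Q y1 y2
  | x1x2 : Q x1 x2
  | x1y1 : Q x1 y1
  | x2y2 : Q x2 y2

inductive E : ShH → ShH → Prop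
  | y0c0 : E y0 c0
  | y0z0 : E y0 z0
  | y0y1 : E y0 y1
  | y1y2 : E y1 y2
  | x1x2 : E x1 x2
  | x1y1 : E x1 y1
  | x2y2 : E x2 y2
  | y0y2 : E y0 y2
  | x1y2 : E x1 y2

def U : ShH → Submodule ℚ (Fin 2 → ℚ)
  | x1 => lin [![0, 1]]
  | x2 => lin [![0, 1]]
  | _ => ⊤

def L (t : ℕ) : ShH → Submodule ℚ (Fin 2 → ℚ)
  | c0 => lin [![1, 0]]
  | z0 => lin [![1, -1]]
  | y2 => lin [![(t : ℚ), -1]]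
  | _ => ⊥

instance : Finite ShH := Finite.of_surjective ![c0, x1, x2, y0, y1, y2, z0]
  (by rintro ⟨⟩ <;> simp [Fin.exists_fin_succ])

theorem false_of_isCleaving {P : RayCategory} {I : ∀ a b : P.Obj, P.Hom a b → Prop}
    (hrep : RepFin P Set.univ I) (hI : IsTwoSided P I) {o : ShH → P.Obj}
    {m : ∀ b b', P.Hom (o b) (o b')} (hc : IsCleaving P I Q E o m) : False := by
  refine hrep.false_of_subquotients hI hc (fun _ => U) L ?_ ?_ x1 ![1, 0]
    (LinearMap.proj 0) ?_ ?_ ?_ ?_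
  · rintro t _ _ ⟨⟩ <;> simp [U, L]
  · rintro t _ _ _ (⟨⟨⟩, ⟨⟩⟩ | ⟨⟨⟩, ⟨⟩⟩) hE <;> exact absurd (by constructor) hE
  · simp [U]
  · simp
  · simp [L]
  · intro s t hst R h w hw
    have e1 := h.mem hw
    obtain ⟨a, hwa⟩ := h.total (b := y0) (v := ![1, 0]) (by simp [U])
    have e2 := h.mem hwa
    obtain ⟨b, hwb⟩ := h.total (b := y0) (v := ![0, 1]) (by simp [U])
    have e3 := h.mem hwb
    have e4 := h.zero (h.mono .y0c0 hwb)
    have e5 := h.zero (h.mono .y0z0 ((R y0).add_mem hwa hwb))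
    have e6 := h.zero (h.mono .y1y2 (h.mono .y0y1 ((R y0).add_mem hwa ((R y0).smul_mem (s : ℚ)
      hwb))))
    have e7 := h.zero ((R y1).sub_mem (h.mono .y0y1 hwa) (h.mono .x1y1 hw))
    simp [U, L] at e1 e2 e3 e4 e5 e6 e7 ⊢
    have f00 := congrFun e7 0
    have f01 := congrFun e7 1
    simp at f00 f01
    have h0 : ((s : ℚ) - t) * w 0 = 0 := by grind
    simpa [sub_eq_zero, hst] using h0

end ShH

inductive ShI | x1 | x2 | x3 | x4 | y0 | y1 | y2 | z0

namespace ShI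

inductive Q : ShI → ShI → Prop
  | x1x2 : Q x1 x2
  | x2x3 : Q x2 x3
  | x3x4 : Q x3 x4
  | x1y1 : Q x1 y1
  | x2y2 : Q x2 y2
  | y0y1 : Q y0 y1
  | y1y2 : Q y1 y2
  | y0z0 : Q y0 z0

inductive E : ShI → ShI → Prop
  | x1x2 : E x1 x2
  | x2x3 : E x2 x3
  | x3x4 : E x3 x4
  | x1y1 : E x1 y1
  | x2y2 : E x2 y2
  | y0y1 : E y0 y1
  | y1y2 : E y1 y2
  | y0z0 : E y0 z0
  | x1x3 : E x1 x3
  | x1x4 : E x1 x4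
  | x2x4 : E x2 x4
  | x1y2 : E x1 y2
  | y0y2 : E y0 y2

def U : ShI → Submodule ℚ (Fin 4 → ℚ)
  | x1 => lin [![1, 0, 0, 0], ![0, 0, 0, 1]]
  | x2 => lin [![0, 0, 0, 1]]
  | x3 => lin [![0, 0, 0, 1]]
  | x4 => lin [![0, 0, 0, 1]]
  | y0 => lin [![1, 0, 0, 0], ![0, 1, 0, 0]]
  | y1 => lin [![1, 0, 0, 0]]
  | z0 => lin [![1, 0, 0, 0], ![0, 1, 0, 0]]
  | _ => ⊤

def L (t : ℕ) : ShI → Submodule ℚ (Fin 4 → ℚ)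
  | x3 => lin [![0, 1, 0, 0], ![0, 0, 1, 0], ![0, 0, 0, 1]]
  | x4 => lin [![0, 0, 1, 0], ![0, 0, 0, 1]]
  | z0 => lin [![1, 0, 0, 0], ![0, 1, 0, 0], ![0, 0, 1, 0]]
  | y2 => lin [![1, 1, -1, 0], ![1, (t : ℚ), 0, -1]]
  | _ => ⊥

instance : Finite ShI := Finite.of_surjective ![x1, x2, x3, x4, y0, y1, y2, z0]
  (by rintro ⟨⟩ <;> simp [Fin.exists_fin_succ])

theorem false_of_isCleaving {P : RayCategory} {I : ∀ a b : P.Obj, P.Hom a b → Prop}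
    (hrep : RepFin P Set.univ I) (hI : IsTwoSided P I) {o : ShI → P.Obj}
    {m : ∀ b b', P.Hom (o b) (o b')} (hc : IsCleaving P I Q E o m) : False := by
  refine hrep.false_of_subquotients hI hc (fun _ => U) L ?_ ?_ x1 ![0, 1, 0, 0]
    (LinearMap.proj 1) ?_ ?_ ?_ ?_
  · rintro t _ _ ⟨⟩ <;> refine ⟨fun v hv => ?_, fun v hv => ?_⟩ <;>
      simp [U, L, Fin.sum_univ_succ] at hv ⊢ <;>
      first | grind | simp [hv]
  · rintro t _ _ _ (⟨⟨⟩, ⟨⟩⟩ | ⟨⟨⟩, ⟨⟩⟩) hE <;> exact absurd (by constructor) hE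
  · simp [U, Fin.sum_univ_succ]
  · simp
  · simp [L]
  · intro s t hst R h w hw
    have e1 := h.mem hw
    obtain ⟨w0, hw0⟩ := h.total (b := x2) (v := ![1, 0, 0, 0]) (by simp [U, Fin.sum_univ_succ])
    have e2 := h.mem hw0
    obtain ⟨w2, hw2⟩ := h.total (b := x1) (v := ![0, 0, 1, 0]) (by simp [U, Fin.sum_univ_succ])
    have e3 := h.mem hw2
    obtain ⟨v, hwv⟩ := h.total (b := y0) (v := ![0, 0, 1, 0]) (by simp [U, Fin.sum_univ_succ])
    have e4 := h.mem hwv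
    obtain ⟨w3, hw3⟩ := h.total (b := y0) (v := ![0, 0, 0, 1]) (by simp [U, Fin.sum_univ_succ])
    have e5 := h.mem hw3
    have e6 := h.zero (h.mono .x2x3 hw0)
    have e7 := h.zero (h.mono .x3x4 (h.mono .x2x3 (h.mono .x1x2 hw)))
    have e8 := h.zero (h.mono .y0z0 hw3)
    have e9 := h.zero ((R y2).add_mem (h.mono .x2y2 hw0) ((R y2).add_mem (h.mono .x2y2 (h.mono
      .x1x2 hw2)) (h.mono .y1y2 (h.mono .y0y1 hw3))))
    have e10 := h.zero ((R y2).add_mem (h.mono .x2y2 (h.mono .x1x2 hw)) ((R y2).add_mem (h.mono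
      .x2y2 (h.mono .x1x2 hw2)) ((R y2).smul_mem (s : ℚ) (h.mono .y1y2 (h.mono .y0y1 hw3)))))
    have e11 := h.zero ((R y1).sub_mem (h.mono .x1y1 hw2) (h.mono .y0y1 hwv))
    simp [U, L, Fin.sum_univ_succ] at e1 e2 e3 e4 e5 e6 e7 e8 e9 e10 e11 ⊢
    have f00 := congrFun e11 0
    have f01 := congrFun e11 1
    have f02 := congrFun e11 2
    have f03 := congrFun e11 3
    simp at f00 f01 f02 f03
    have h0 : ((s : ℚ) - t) * w 1 = 0 := by grind
    simpa [sub_eq_zero, hst] using h0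

end ShI

inductive ShJ | x2 | x3 | x4 | y0 | y1 | y2 | y3 | z0 | z1

namespace ShJ

inductive Q : ShJ → ShJ → Prop
  | x2x3 : Q x2 x3
  | x3x4 : Q x3 x4
  | x2y2 : Q x2 y2
  | x3y3 : Q x3 y3
  | y0y1 : Q y0 y1
  | y1y2 : Q y1 y2
  | y2y3 : Q y2 y3
  | y0z0 : Q y0 z0
  | y1z1 : Q y1 z1

inductive E : ShJ → ShJ → Prop
  | x2x3 : E x2 x3
  | x3x4 : E x3 x4
  | x2y2 : E x2 y2
  | x3y3 : E x3 y3
  | y0y1 : E y0 y1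
  | y1y2 : E y1 y2
  | y2y3 : E y2 y3
  | y0z0 : E y0 z0
  | y1z1 : E y1 z1
  | x2x4 : E x2 x4
  | x2y3 : E x2 y3
  | y0y2 : E y0 y2
  | y0y3 : E y0 y3
  | y1y3 : E y1 y3

def U : ShJ → Submodule ℚ (Fin 6 → ℚ)
  | x2 => lin [![1, 0, 0, 0, 0, 0], ![0, 1, 0, 0, 0, 0], ![0, 0, 0, 0, 0, 1]]
  | x3 => lin [![1, 0, 0, 0, 0, 0], ![0, 1, 0, 0, 0, 0]]
  | x4 => lin [![1, 0, 0, 0, 0, 0], ![0, 1, 0, 0, 0, 0]]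
  | y0 => lin [![0, 0, 1, 0, 0, 0], ![0, 0, 0, 1, 0, 0], ![0, 0, 0, 0, 1, 0], ![0, 0, 0, 0, 0, 1]]
  | y1 => lin [![0, 0, 0, 0, 1, 0], ![0, 0, 0, 0, 0, 1]]
  | y2 => lin [![0, 0, 0, 0, 0, 1]]
  | z0 => lin [![0, 0, 1, 0, 0, 0], ![0, 0, 0, 1, 0, 0], ![0, 0, 0, 0, 1, 0], ![0, 0, 0, 0, 0, 1]]
  | z1 => lin [![0, 0, 0, 0, 1, 0], ![0, 0, 0, 0, 0, 1]]
  | _ => ⊤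

def L (t : ℕ) : ShJ → Submodule ℚ (Fin 6 → ℚ)
  | x4 => lin [![1, 0, 0, 0, 0, 0], ![0, 1, 0, 0, 0, 0], ![0, 0, 1, 0, 0, 0], ![0, 0, 0, 1, 0, 0]]
  | y3 => lin [![1, 1, (t : ℚ), -1, 0, 0], ![1, 0, 0, 0, -1, 0], ![1, 0, 1, 0, 0, -1]]
  | z0 => lin [![0, 1, 0, 0, 0, 0], ![0, 0, 1, 0, 0, 0], ![0, 0, 0, 1, 0, 0], ![0, 0, 0, 0, 1, 0], ![0, 0, 0, 0, 0, 1]]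
  | z1 => lin [![0, 0, 0, 1, 0, 0], ![0, 0, 0, 0, 1, 0], ![0, 0, 0, 0, 0, 1]]
  | _ => ⊥

instance : Finite ShJ := Finite.of_surjective ![x2, x3, x4, y0, y1, y2, y3, z0, z1]
  (by rintro ⟨⟩ <;> simp [Fin.exists_fin_succ])

theorem false_of_isCleaving {P : RayCategory} {I : ∀ a b : P.Obj, P.Hom a b → Prop}
    (hrep : RepFin P Set.univ I) (hI : IsTwoSided P I) {o : ShJ → P.Obj}
    {m : ∀ b b', P.Hom (o b) (o b')} (hc : IsCleaving P I Q E o m) : False := by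
  refine hrep.false_of_subquotients hI hc (fun _ => U) L ?_ ?_ x2 ![0, 0, 1, 0, 0, 0]
    (LinearMap.proj 2) ?_ ?_ ?_ ?_
  · rintro t _ _ ⟨⟩ <;> refine ⟨fun v hv => ?_, fun v hv => ?_⟩ <;>
      simp [U, L, Fin.sum_univ_succ] at hv ⊢ <;>
      first | grind | simp [hv]
  · rintro t _ _ _ (⟨⟨⟩, ⟨⟩⟩ | ⟨⟨⟩, ⟨⟩⟩) hE <;> first
      | exact absurd (by constructor) hE
      | (intro v hv; simp [U, L, Fin.sum_univ_succ] at hv ⊢; grind)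
  · simp [U, Fin.sum_univ_succ]
  · simp
  · simp [L]
  · intro s t hst R h w hw
    have e1 := h.mem hw
    obtain ⟨w0, hw0⟩ := h.total (b := y0) (v := ![1, 0, 0, 0, 0, 0]) (by simp [U, Fin.sum_univ_succ])
    have e2 := h.mem hw0
    obtain ⟨w1, hw1⟩ := h.total (b := y0) (v := ![0, 1, 0, 0, 0, 0]) (by simp [U, Fin.sum_univ_succ])
    have e3 := h.mem hw1
    obtain ⟨w3, hw3⟩ := h.total (b := x2) (v := ![0, 0, 0, 1, 0, 0]) (by simp [U, Fin.sum_univ_succ])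
    have e4 := h.mem hw3
    obtain ⟨w4, hw4⟩ := h.total (b := x2) (v := ![0, 0, 0, 0, 1, 0]) (by simp [U, Fin.sum_univ_succ])
    have e5 := h.mem hw4
    obtain ⟨w5, hw5⟩ := h.total (b := x3) (v := ![0, 0, 0, 0, 0, 1]) (by simp [U, Fin.sum_univ_succ])
    have e6 := h.mem hw5
    obtain ⟨u, hwu⟩ := h.total (b := y1) (v := ![0, 0, 1, 0, 0, 0]) (by simp [U, Fin.sum_univ_succ])
    have e7 := h.mem hwu
    obtain ⟨v, hwv⟩ := h.total (b := y1) (v := ![0, 0, 0, 1, 0, 0]) (by simp [U, Fin.sum_univ_succ])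
    have e8 := h.mem hwv
    have e9 := h.zero (h.mono .x3x4 (h.mono .x2x3 hw4))
    have e10 := h.zero (h.mono .x3x4 hw5)
    have e11 := h.zero (h.mono .y0z0 hw0)
    have e12 := h.zero (h.mono .y1z1 hwu)
    have e13 := h.zero ((R y3).add_mem (h.mono .y2y3 (h.mono .y1y2 (h.mono .y0y1 hw0))) ((R
      y3).add_mem (h.mono .x3y3 (h.mono .x2x3 hw3)) ((R y3).add_mem (h.mono .x3y3 (h.mono .x2x3
      hw4)) (h.mono .x3y3 hw5))))
    have e14 := h.zero ((R y3).add_mem (h.mono .y2y3 (h.mono .y1y2 (h.mono .y0y1 hw1))) (h.mono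
      .x3y3 (h.mono .x2x3 hw3)))
    have e15 := h.zero ((R y3).add_mem (h.mono .x3y3 (h.mono .x2x3 hw)) ((R y3).add_mem ((R
      y3).smul_mem (s : ℚ) (h.mono .x3y3 (h.mono .x2x3 hw3))) (h.mono .x3y3 hw5)))
    have e16 := h.zero ((R y2).sub_mem (h.mono .x2y2 hw) (h.mono .y1y2 hwu))
    have e17 := h.zero ((R y2).sub_mem (h.mono .x2y2 hw3) (h.mono .y1y2 hwv))
    simp [U, L, Fin.sum_univ_succ] at e1 e2 e3 e4 e5 e6 e7 e8 e9 e10 e11 e12 e13 e14 e15 e16 e17 ⊢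
    have f00 := congrFun e16 0
    have f01 := congrFun e16 1
    have f02 := congrFun e16 2
    have f03 := congrFun e16 3
    have f04 := congrFun e16 4
    have f05 := congrFun e16 5
    have f10 := congrFun e17 0
    have f11 := congrFun e17 1
    have f12 := congrFun e17 2
    have f13 := congrFun e17 3
    have f14 := congrFun e17 4
    have f15 := congrFun e17 5
    simp at f00 f01 f02 f03 f04 f05 f10 f11 f12 f13 f14 f15
    have h0 : ((s : ℚ) - t) * w 2 = 0 := by grind
    simpa [sub_eq_zero, hst] using h0

end ShJ

inductive ShK | c1 | x1 | x2 | x3 | y0 | y1 | y2 | z0 | z1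

namespace ShK

inductive Q : ShK → ShK → Prop
  | x1x2 : Q x1 x2
  | x2x3 : Q x2 x3
  | x1y1 : Q x1 y1
  | x2y2 : Q x2 y2
  | y0y1 : Q y0 y1
  | y1y2 : Q y1 y2
  | y0z0 : Q y0 z0
  | y1z1 : Q y1 z1
  | c1z1 : Q c1 z1

inductive E : ShK → ShK → Prop
  | x1x2 : E x1 x2
  | x2x3 : E x2 x3
  | x1y1 : E x1 y1
  | x2y2 : E x2 y2
  | y0y1 : E y0 y1
  | y1y2 : E y1 y2
  | y0z0 : E y0 z0
  | y1z1 : E y1 z1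
  | c1z1 : E c1 z1
  | x1x3 : E x1 x3
  | x1y2 : E x1 y2
  | x1z1 : E x1 z1
  | y0y2 : E y0 y2

def U : ShK → Submodule ℚ (Fin 6 → ℚ)
  | x1 => lin [![1, 0, 0, 0, 0, 0], ![0, 1, 0, 0, 0, 0], ![0, 0, 0, 0, 0, 1]]
  | x2 => lin [![1, 0, 0, 0, 0, 0], ![0, 1, 0, 0, 0, 0]]
  | x3 => lin [![1, 0, 0, 0, 0, 0], ![0, 1, 0, 0, 0, 0]]
  | y0 => lin [![0, 0, 1, 0, 0, 0], ![0, 0, 0, 1, 0, 0], ![0, 0, 0, 0, 1, 0], ![0, 0, 0, 0, 0, 1]]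
  | y1 => lin [![0, 0, 0, 0, 0, 1]]
  | z0 => lin [![0, 0, 1, 0, 0, 0], ![0, 0, 0, 1, 0, 0], ![0, 0, 0, 0, 1, 0], ![0, 0, 0, 0, 0, 1]]
  | z1 => lin [![0, 0, 0, 0, 0, 1]]
  | c1 => lin [![0, 0, 0, 0, 1, 0], ![0, 0, 0, 0, 0, 1]]
  | _ => ⊤

def L (t : ℕ) : ShK → Submodule ℚ (Fin 6 → ℚ)
  | x3 => lin [![1, 0, 0, 0, 0, 0], ![0, 1, 0, 0, 0, 0], ![0, 0, 1, 0, 0, 0], ![0, 0, 0, 1, 0, 0]]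
  | y2 => lin [![1, 1, (t : ℚ), -1, 0, 0], ![1, 0, 0, 0, -1, 0], ![1, 0, 1, 0, 0, -1]]
  | z0 => lin [![0, 1, 0, 0, 0, 0], ![0, 0, 1, 0, 0, 0], ![0, 0, 0, 1, 0, 0], ![0, 0, 0, 0, 1, 0], ![0, 0, 0, 0, 0, 1]]
  | z1 => lin [![0, 0, 0, 1, 0, 0], ![0, 0, 0, 0, 1, 0], ![0, 0, 0, 0, 0, 1]]
  | c1 => lin [![0, 0, 0, 1, 0, 0], ![0, 0, 0, 0, 1, 0], ![0, 0, 0, 0, 0, 1]]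
  | _ => ⊥

instance : Finite ShK := Finite.of_surjective ![c1, x1, x2, x3, y0, y1, y2, z0, z1]
  (by rintro ⟨⟩ <;> simp [Fin.exists_fin_succ])

theorem false_of_isCleaving {P : RayCategory} {I : ∀ a b : P.Obj, P.Hom a b → Prop}
    (hrep : RepFin P Set.univ I) (hI : IsTwoSided P I) {o : ShK → P.Obj}
    {m : ∀ b b', P.Hom (o b) (o b')} (hc : IsCleaving P I Q E o m) : False := by
  refine hrep.false_of_subquotients hI hc (fun _ => U) L ?_ ?_ x1 ![0, 0, 1, 0, 0, 0]
    (LinearMap.proj 2) ?_ ?_ ?_ ?_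
  · rintro t _ _ ⟨⟩ <;> refine ⟨fun v hv => ?_, fun v hv => ?_⟩ <;>
      simp [U, L, Fin.sum_univ_succ] at hv ⊢ <;>
      first | grind | simp [hv]
  · rintro t _ _ _ (⟨⟨⟩, ⟨⟩⟩ | ⟨⟨⟩, ⟨⟩⟩) hE <;> first
      | exact absurd (by constructor) hE
      | (intro v hv; simp [U, L, Fin.sum_univ_succ] at hv ⊢; grind)
  · simp [U, Fin.sum_univ_succ]
  · simp
  · simp [L]
  · intro s t hst R h w hw
    have e1 := h.mem hw
    obtain ⟨w0, hw0⟩ := h.total (b := y0) (v := ![1, 0, 0, 0, 0, 0]) (by simp [U, Fin.sum_univ_succ])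
    have e2 := h.mem hw0
    obtain ⟨w1, hw1⟩ := h.total (b := y0) (v := ![0, 1, 0, 0, 0, 0]) (by simp [U, Fin.sum_univ_succ])
    have e3 := h.mem hw1
    obtain ⟨w3, hw3⟩ := h.total (b := x1) (v := ![0, 0, 0, 1, 0, 0]) (by simp [U, Fin.sum_univ_succ])
    have e4 := h.mem hw3
    obtain ⟨w4, hw4⟩ := h.total (b := x1) (v := ![0, 0, 0, 0, 1, 0]) (by simp [U, Fin.sum_univ_succ])
    have e5 := h.mem hw4
    obtain ⟨w5, hw5⟩ := h.total (b := x2) (v := ![0, 0, 0, 0, 0, 1]) (by simp [U, Fin.sum_univ_succ])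
    have e6 := h.mem hw5
    obtain ⟨u, hwu⟩ := h.total (b := c1) (v := ![0, 0, 0, 1, 0, 0]) (by simp [U, Fin.sum_univ_succ])
    have e7 := h.mem hwu
    have e8 := h.zero (h.mono .x2x3 (h.mono .x1x2 hw4))
    have e9 := h.zero (h.mono .x2x3 hw5)
    have e10 := h.zero (h.mono .y0z0 hw0)
    have e11 := h.zero (h.mono .y1z1 (h.mono .x1y1 hw))
    have e12 := h.zero ((R z1).sub_mem (h.mono .y1z1 (h.mono .x1y1 hw3)) (h.mono .c1z1 hwu))
    have e13 := h.zero ((R y2).add_mem (h.mono .y1y2 (h.mono .y0y1 hw0)) ((R y2).add_mem (h.mono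
      .x2y2 (h.mono .x1x2 hw3)) ((R y2).add_mem (h.mono .x2y2 (h.mono .x1x2 hw4)) (h.mono .x2y2
      hw5))))
    have e14 := h.zero ((R y2).add_mem (h.mono .y1y2 (h.mono .y0y1 hw1)) (h.mono .x2y2 (h.mono
      .x1x2 hw3)))
    have e15 := h.zero ((R y2).add_mem (h.mono .x2y2 (h.mono .x1x2 hw)) ((R y2).add_mem ((R
      y2).smul_mem (s : ℚ) (h.mono .x2y2 (h.mono .x1x2 hw3))) (h.mono .x2y2 hw5)))
    simp [U, L, Fin.sum_univ_succ] at e1 e2 e3 e4 e5 e6 e7 e8 e9 e10 e11 e12 e13 e14 e15 ⊢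
    have h0 : ((s : ℚ) - t) * w 2 = 0 := by grind
    simpa [sub_eq_zero, hst] using h0

end ShK

inductive ShL | c0 | x1 | x2 | x3 | y0 | y1 | y2 | z0 | z1

namespace ShL

inductive Q : ShL → ShL → Prop
  | x1x2 : Q x1 x2
  | x2x3 : Q x2 x3
  | x1y1 : Q x1 y1
  | x2y2 : Q x2 y2
  | y0y1 : Q y0 y1
  | y1y2 : Q y1 y2
  | y0z0 : Q y0 z0
  | y1z1 : Q y1 z1
  | z0c0 : Q z0 c0

inductive E : ShL → ShL → Prop
  | x1x2 : E x1 x2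
  | x2x3 : E x2 x3
  | x1y1 : E x1 y1
  | x2y2 : E x2 y2
  | y0y1 : E y0 y1
  | y1y2 : E y1 y2
  | y0z0 : E y0 z0
  | y1z1 : E y1 z1
  | z0c0 : E z0 c0
  | x1x3 : E x1 x3
  | x1y2 : E x1 y2
  | x1z1 : E x1 z1
  | y0y2 : E y0 y2
  | y0c0 : E y0 c0

def U : ShL → Submodule ℚ (Fin 6 → ℚ)
  | x1 => lin [![1, 0, 0, 0, 0, 0], ![0, 1, 0, 0, 0, 0], ![0, 0, 0, 0, 0, 1]]
  | x2 => lin [![1, 0, 0, 0, 0, 0], ![0, 1, 0, 0, 0, 0]]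
  | x3 => lin [![1, 0, 0, 0, 0, 0], ![0, 1, 0, 0, 0, 0]]
  | y0 => lin [![0, 0, 0, 1, 0, 0], ![0, 0, 0, 0, 1, 0], ![0, 0, 0, 0, 0, 1]]
  | y1 => lin [![0, 0, 0, 0, 0, 1]]
  | z0 => lin [![0, 0, 0, 1, 0, 0], ![0, 0, 0, 0, 1, 0], ![0, 0, 0, 0, 0, 1]]
  | z1 => lin [![0, 0, 0, 0, 0, 1]]
  | c0 => lin [![0, 0, 0, 1, 0, 0], ![0, 0, 0, 0, 1, 0], ![0, 0, 0, 0, 0, 1]]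
  | _ => ⊤

def L (t : ℕ) : ShL → Submodule ℚ (Fin 6 → ℚ)
  | x3 => lin [![1, 0, 0, 0, 0, 0], ![0, 1, 0, 0, 0, 0], ![0, 0, 1, 0, 0, 0], ![0, 0, 0, 1, 0, 0]]
  | y2 => lin [![1, 1, (t : ℚ), -1, 0, 0], ![1, 0, 0, 0, -1, 0], ![1, 0, 1, 0, 0, -1]]
  | z0 => lin [![0, 1, 0, 0, 0, 0], ![0, 0, 1, 0, 0, 0], ![0, 0, 0, 1, 0, 0], ![0, 0, 0, 0, 1, 0], ![0, 0, 0, 0, 0, 1]]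
  | z1 => lin [![0, 0, 0, 0, 1, 0], ![0, 0, 0, 0, 0, 1]]
  | c0 => lin [![0, 0, 1, 0, 0, 0], ![0, 0, 0, 1, 0, 0], ![0, 0, 0, 0, 1, 0], ![0, 0, 0, 0, 0, 1]]
  | _ => ⊥

instance : Finite ShL := Finite.of_surjective ![c0, x1, x2, x3, y0, y1, y2, z0, z1]
  (by rintro ⟨⟩ <;> simp [Fin.exists_fin_succ])

theorem false_of_isCleaving {P : RayCategory} {I : ∀ a b : P.Obj, P.Hom a b → Prop}
    (hrep : RepFin P Set.univ I) (hI : IsTwoSided P I) {o : ShL → P.Obj}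
    {m : ∀ b b', P.Hom (o b) (o b')} (hc : IsCleaving P I Q E o m) : False := by
  refine hrep.false_of_subquotients hI hc (fun _ => U) L ?_ ?_ x1 ![0, 0, 1, 0, 0, 0]
    (LinearMap.proj 2) ?_ ?_ ?_ ?_
  · rintro t _ _ ⟨⟩ <;> refine ⟨fun v hv => ?_, fun v hv => ?_⟩ <;>
      simp [U, L, Fin.sum_univ_succ] at hv ⊢ <;>
      first | grind | simp [hv]
  · rintro t _ _ _ (⟨⟨⟩, ⟨⟩⟩ | ⟨⟨⟩, ⟨⟩⟩) hE <;> first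
      | exact absurd (by constructor) hE
      | (intro v hv; simp [U, L, Fin.sum_univ_succ] at hv ⊢; grind)
  · simp [U, Fin.sum_univ_succ]
  · simp
  · simp [L]
  · intro s t hst R h w hw
    have e1 := h.mem hw
    obtain ⟨w0, hw0⟩ := h.total (b := y0) (v := ![1, 0, 0, 0, 0, 0]) (by simp [U, Fin.sum_univ_succ])
    have e2 := h.mem hw0
    obtain ⟨w1, hw1⟩ := h.total (b := y0) (v := ![0, 1, 0, 0, 0, 0]) (by simp [U, Fin.sum_univ_succ])
    have e3 := h.mem hw1
    obtain ⟨w3, hw3⟩ := h.total (b := x1) (v := ![0, 0, 0, 1, 0, 0]) (by simp [U, Fin.sum_univ_succ])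
    have e4 := h.mem hw3
    obtain ⟨w4, hw4⟩ := h.total (b := x1) (v := ![0, 0, 0, 0, 1, 0]) (by simp [U, Fin.sum_univ_succ])
    have e5 := h.mem hw4
    obtain ⟨w5, hw5⟩ := h.total (b := x2) (v := ![0, 0, 0, 0, 0, 1]) (by simp [U, Fin.sum_univ_succ])
    have e6 := h.mem hw5
    obtain ⟨u, hwu⟩ := h.total (b := y0) (v := ![0, 0, 1, 0, 0, 0]) (by simp [U, Fin.sum_univ_succ])
    have e7 := h.mem hwu
    have e8 := h.zero (h.mono .x2x3 (h.mono .x1x2 hw4))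
    have e9 := h.zero (h.mono .x2x3 hw5)
    have e10 := h.zero (h.mono .y0z0 hw0)
    have e11 := h.zero (h.mono .z0c0 (h.mono .y0z0 hw1))
    have e12 := h.zero (h.mono .y1z1 (h.mono .x1y1 hw3))
    have e13 := h.zero ((R y2).add_mem (h.mono .y1y2 (h.mono .y0y1 hw0)) ((R y2).add_mem (h.mono
      .x2y2 (h.mono .x1x2 hw3)) ((R y2).add_mem (h.mono .x2y2 (h.mono .x1x2 hw4)) (h.mono .x2y2
      hw5))))
    have e14 := h.zero ((R y2).add_mem (h.mono .y1y2 (h.mono .y0y1 hw1)) (h.mono .x2y2 (h.mono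
      .x1x2 hw3)))
    have e15 := h.zero ((R y2).add_mem (h.mono .x2y2 (h.mono .x1x2 hw)) ((R y2).add_mem ((R
      y2).smul_mem (s : ℚ) (h.mono .x2y2 (h.mono .x1x2 hw3))) (h.mono .x2y2 hw5)))
    have e16 := h.zero ((R y1).sub_mem (h.mono .x1y1 hw) (h.mono .y0y1 hwu))
    simp [U, L, Fin.sum_univ_succ] at e1 e2 e3 e4 e5 e6 e7 e8 e9 e10 e11 e12 e13 e14 e15 e16 ⊢
    have f00 := congrFun e16 0
    have f01 := congrFun e16 1
    have f02 := congrFun e16 2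
    have f03 := congrFun e16 3
    have f04 := congrFun e16 4
    have f05 := congrFun e16 5
    simp at f00 f01 f02 f03 f04 f05
    have h0 : ((s : ℚ) - t) * w 2 = 0 := by grind
    simpa [sub_eq_zero, hst] using h0

end ShL

/-- The opposite ray category. -/
@[reducible] def RayCategory.op (P : RayCategory) : RayCategory where
  Obj := P.Obj
  Hom a b := P.Hom b a
  id := P.id
  comp g f := P.comp f g
  zero a b := P.zero b a
  comp_id f := P.id_comp f
  id_comp f := P.comp_id f
  assoc h g f := (P.assoc f g h).symm
  zero_comp f := P.comp_zero f
  comp_zero f := P.zero_comp f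
  no_iso f g h1 h2 := P.no_iso g f h1 h2
  finite_target := P.finite_source
  finite_source := P.finite_target
  pipow := P.pipow
  pipow_zero := P.pipow_zero
  pipow_succ x n := by
    have h : P.comp (P.pipow x 1) (P.pipow x n) = P.comp (P.pipow x n) (P.pipow x 1) := by
      rw [← P.pipow_add, ← P.pipow_add, Nat.add_comm]
    exact (P.pipow_succ x n).trans h
  nilp := P.nilp
  nilp_pos := P.nilp_pos
  endo_cyclic := P.endo_cyclic
  pipow_nilp := P.pipow_nilp
  pipow_nilp_ne := P.pipow_nilp_ne
  hom_cyclic x y := by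
    obtain ⟨g, h⟩ := P.hom_cyclic y x
    exact ⟨g, h.symm⟩
  cancel kappa mu nu lam h1 h2 := by
    refine P.cancel lam mu nu kappa ?_ ?_
    · rw [← P.assoc, ← P.assoc]; exact h1
    · rw [← P.assoc]; exact h2

/-- The opposite of a family of morphisms. -/
def RayCategory.opIdeal {P : RayCategory} (I : ∀ a b : P.Obj, P.Hom a b → Prop) :
    ∀ a b : P.op.Obj, P.op.Hom a b → Prop :=
  fun a b f => I b a f

section Duality

variable {P : RayCategory} {k : Type} [Field k] {I : ∀ a b : P.Obj, P.Hom a b → Prop}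

/-- The dual of a module, as a module over the opposite category. -/
@[reducible] def RMod.dual (M : RMod P k Set.univ I) : RMod P.op k Set.univ (RayCategory.opIdeal I) where
  M x := Module.Dual k (M.M x)
  act {x y} f := (M.act (x := y) (y := x) f).dualMap
  act_id x hx := by
    have h := M.act_id x hx
    change (M.act (P.id x)).dualMap = _
    rw [h, LinearMap.dualMap_id]
  act_comp {x y z} hx hy hz g f := by
    have h := M.act_comp hz hy hx f g
    change (M.act (P.comp f g)).dualMap = _
    rw [h]
    rfl
  act_zero {x y} hx hy := by
    have h := M.act_zero hy hx
    change (M.act (P.zero y x)).dualMap = _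
    rw [h]
    exact LinearMap.map_zero _
  supp x hx := absurd (Set.mem_univ x) hx
  killed {a b} f hf := by
    have h := M.killed (a := b) (b := a) f hf
    change (M.act (x := b) (y := a) f).dualMap = _
    rw [h]
    exact LinearMap.map_zero _

/-- The dual over `P` of a module over the opposite category. -/
@[reducible] def RMod.predual (M : RMod P.op k Set.univ (RayCategory.opIdeal I)) : RMod P k Set.univ I :=
  RMod.dual (P := P.op) M

/-- The transpose of a morphism. -/
def RModHom.dual {M N : RMod P k Set.univ I} (φ : RModHom M N) : RModHom N.dual M.dual where
  app x := (φ.app x).dualMap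
  natural {x y} f := by
    refine LinearMap.ext fun ξ => LinearMap.ext fun v => ?_
    have h := LinearMap.congr_fun (φ.natural (x := y) (y := x) f) v
    exact congrArg (ξ : Module.Dual k (N.M x)) h.symm

/-- The transpose over `P` of a morphism over the opposite category. -/
def RModHom.predual {M N : RMod P.op k Set.univ (RayCategory.opIdeal I)} (φ : RModHom M N) :
    RModHom N.predual M.predual :=
  RModHom.dual (P := P.op) φ

/-- Evaluation into the bidual. -/
def RModHom.eval (M : RMod P k Set.univ I) : RModHom M M.dual.predual where
  app x := Module.Dual.eval k (M.M x)
  natural _ := rfl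

lemma RModHom.eval_bijective {M : RMod P k Set.univ I} (hM : M.FinDim) (x : P.Obj) :
    Function.Bijective ((RModHom.eval M).app x) := by
  have := hM.1 x
  exact Module.bijective_dual_eval k (M.M x)

lemma RMod.FinDim.dual {M : RMod P k Set.univ I} (hM : M.FinDim) : M.dual.FinDim := by
  refine ⟨fun x => ?_, hM.2.subset ?_⟩
  · have := hM.1 x
    exact inferInstanceAs (FiniteDimensional k (Module.Dual k (M.M x)))
  · rintro x ⟨ξ, hξ⟩
    by_contra h
    refine hξ (LinearMap.ext fun v => ?_)
    have hv : v = 0 := by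
      by_contra hv
      exact h ⟨v, hv⟩
    rw [hv]
    exact map_zero (ξ : Module.Dual k (M.M x))

lemma RMod.exists_dual_ne_zero {M : RMod P k Set.univ I} {x : P.Obj}
    (h : ∃ m : M.M x, m ≠ 0) : ∃ ξ : M.dual.M x, ξ ≠ 0 := by
  obtain ⟨m, hm⟩ := h
  by_contra! h
  exact hm ((Module.forall_dual_apply_eq_zero_iff k m).1 fun ξ => by rw [h ξ]; rfl)

lemma RMod.Indec.dual {M : RMod P k Set.univ I} (hf : M.FinDim) (hM : M.Indec) :
    M.dual.Indec := by
  obtain ⟨⟨x, hx⟩, hM⟩ := hM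
  refine ⟨⟨x, RMod.exists_dual_ne_zero hx⟩, fun e he => ?_⟩
  have hb := RModHom.eval_bijective hf
  let e' : RModHom M M := ((RModHom.eval M).inv hb).comp (e.predual.comp (RModHom.eval M))
  have key : ∀ (x : P.Obj) (m : M.M x) (ξ : Module.Dual k (M.M x)),
      ξ (e'.app x m) = (e.app x ξ : Module.Dual k (M.M x)) m := fun x m ξ =>
    LinearMap.congr_fun (RModHom.app_inv (RModHom.eval M) hb x
      ((e.predual.comp (RModHom.eval M)).app x m)) ξ
  have idem : ∀ x, (e'.app x).comp (e'.app x) = e'.app x := by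
    intro x
    refine LinearMap.ext fun m => (hb x).1 (LinearMap.ext fun ξ => ?_)
    change ξ (e'.app x (e'.app x m)) = ξ (e'.app x m)
    rw [key, key, key]
    exact LinearMap.congr_fun (LinearMap.congr_fun (he x) ξ) m
  refine (hM e' idem).imp (fun h x => ?_) fun h x => ?_
  · refine LinearMap.ext fun ξ => LinearMap.ext fun m => ?_
    refine (key x m ξ).symm.trans ?_
    rw [h x]
    exact map_zero (ξ : Module.Dual k (M.M x))
  · refine LinearMap.ext fun ξ => LinearMap.ext fun m => ?_
    refine (key x m ξ).symm.trans ?_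
    rw [h x]
    rfl

lemma RMod.FinDim.predual {M : RMod P.op k Set.univ (RayCategory.opIdeal I)} (hM : M.FinDim) :
    M.predual.FinDim :=
  RMod.FinDim.dual (P := P.op) hM

lemma RMod.Indec.predual {M : RMod P.op k Set.univ (RayCategory.opIdeal I)} (hf : M.FinDim)
    (hM : M.Indec) : M.predual.Indec :=
  RMod.Indec.dual (P := P.op) hf hM

/-- Representation-finiteness passes to the opposite category. -/
theorem RepFin.op {P : RayCategory} {I : ∀ a b : P.Obj, P.Hom a b → Prop}
    (h : RepFin P Set.univ I) : RepFin P.op Set.univ (RayCategory.opIdeal I) := by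
  intro k _ x
  obtain ⟨ι, hι, rep, h⟩ := h k x
  refine ⟨ι, hι, fun i => (rep i).dual, fun N hf hN hx => ?_⟩
  obtain ⟨i, φ, hφ⟩ := h N.predual hf.predual (hN.predual hf)
    (RMod.exists_dual_ne_zero (P := P.op) hx)
  refine ⟨i, ?_⟩
  have hb : ∀ y, Function.Bijective ((RModHom.eval (P := P.op) N).app y) :=
    RModHom.eval_bijective (P := P.op) hf
  have hd : ∀ y, Function.Bijective (φ.dual.app y) := fun y =>
    LinearMap.dualMap_bijective_iff.2 (hφ y)
  let ψ : RModHom N (rep i).dual := φ.dual.comp (RModHom.eval (P := P.op) N)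
  have hψ : ∀ y, Function.Bijective (ψ.app y) := fun y => (hd y).comp (hb y)
  exact ⟨ψ.inv hψ, fun y => (LinearEquiv.ofBijective (ψ.app y) (hψ y)).symm.bijective⟩

end Duality

infixr:80 "⊚" => RayCategory.comp _

namespace RayCategory

variable {P : RayCategory}

lemma pow_add {a : P.Obj} (f : P.Hom a a) (i j : ℕ) :
    P.pow f (i + j) = P.pow f i ⊚ P.pow f j := by
  induction i with
  | zero => rw [Nat.zero_add, pow, P.id_comp]
  | succ n ih => rw [Nat.succ_add, pow, ih, pow, P.assoc]

lemma pow_one {a : P.Obj} (f : P.Hom a a) : P.pow f 1 = f := by rw [pow, pow, P.comp_id]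

lemma pow_succ' {a : P.Obj} (f : P.Hom a a) (i : ℕ) : P.pow f (i + 1) = P.pow f i ⊚ f := by
  rw [pow_add, pow_one]

lemma not_isId_of_ne {a b : P.Obj} (h : a ≠ b) (f : P.Hom a b) : ¬ P.IsId f :=
  fun ⟨h', _⟩ => h h'

lemma op_pow {a : P.Obj} (f : P.Hom a a) (i : ℕ) : P.op.pow (x := a) f i = P.pow f i := by
  induction i with
  | zero => rfl
  | succ n ih =>
    rw [pow_succ' f n, ← ih]
    rfl

lemma isTwoSided_idealOf {a b : P.Obj} (f : P.Hom a b) : IsTwoSided P (IdealOf P f) where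
  zero s t := ⟨P.zero b t, P.zero s a, by rw [P.zero_comp]⟩
  left := by
    rintro s t u g _ ⟨p, q, rfl⟩
    exact ⟨g ⊚ p, q, by simp only [P.assoc]⟩
  right := by
    rintro s t u _ f ⟨p, q, rfl⟩
    exact ⟨p, q ⊚ f, by simp only [P.assoc]⟩

lemma eq_id_of_comp_eq_self {a b : P.Obj} {g : P.Hom a b} {f : P.Hom a a} (h : g ⊚ f = g)
    (h0 : g ≠ P.zero a b) : f = P.id a :=
  cancel_left (h.trans (P.comp_id g).symm) (by rwa [h])

lemma eq_id_of_self_comp_eq {a b : P.Obj} {g : P.Hom a b} {f : P.Hom b b} (h : f ⊚ g = g)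
    (h0 : g ≠ P.zero a b) : f = P.id b :=
  cancel_right (h.trans (P.id_comp g).symm) (by rwa [h])

lemma left_ne_zero {a b c : P.Obj} {g : P.Hom b c} {f : P.Hom a b} (h : g ⊚ f ≠ P.zero a c) :
    g ≠ P.zero b c := by
  rintro rfl
  exact h (P.zero_comp f)

lemma right_ne_zero {a b c : P.Obj} {g : P.Hom b c} {f : P.Hom a b} (h : g ⊚ f ≠ P.zero a c) :
    f ≠ P.zero a b := by
  rintro rfl
  exact h (P.comp_zero g)

lemma ne_id_of_pow_eq_zero {a : P.Obj} {f : P.Hom a a} {n : ℕ} (h : P.pow f n = P.zero a a) :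
    f ≠ P.id a := by
  rintro rfl
  have h1 : ∀ m, P.pow (P.id a) m = P.id a := by
    intro m
    induction m with
    | zero => rfl
    | succ m ih => rw [pow, ih, P.comp_id]
  exact id_ne_zero a ((h1 n).symm.trans h)

lemma eq_id_left {a : P.Obj} {f g : P.Hom a a} (h : f ⊚ g = P.id a) : f = P.id a :=
  isId_iff.1 (isId_of_comp_eq_id h).2

lemma eq_id_right {a : P.Obj} {f g : P.Hom a a} (h : f ⊚ g = P.id a) : g = P.id a :=
  isId_iff.1 (isId_of_comp_eq_id h).1

/-- Every nonzero morphism is a power of an endomorphism of its source followed by a morphism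
which cannot be divided any further. -/
lemma exists_eq_comp_pow {a b : P.Obj} {f : P.Hom a a} (hf : ∃ n, P.pow f n = P.zero a a)
    {g : P.Hom a b} (hg : g ≠ P.zero a b) :
    ∃ (i : ℕ) (φ : P.Hom a b), g = φ ⊚ P.pow f i ∧ ∀ ν : P.Hom a b, ν ⊚ f ≠ φ := by
  classical
  obtain ⟨n, hn⟩ := hf
  have hb : ∀ i, (∃ φ : P.Hom a b, g = φ ⊚ P.pow f i) → i < n := by
    rintro i ⟨φ, rfl⟩
    by_contra hi
    obtain ⟨j, rfl⟩ := Nat.exists_eq_add_of_le (not_lt.1 hi)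
    rw [pow_add, hn, P.zero_comp, P.comp_zero] at hg
    exact hg rfl
  by_contra hcon
  push Not at hcon
  have : ∀ i, ∃ φ : P.Hom a b, g = φ ⊚ P.pow f i := by
    intro i
    induction i with
    | zero => exact ⟨g, (P.comp_id g).symm⟩
    | succ i ih =>
      obtain ⟨φ, hφ⟩ := ih
      obtain ⟨ν, rfl⟩ := hcon i φ hφ
      exact ⟨ν, by rw [hφ, P.assoc]; rfl⟩
  exact lt_irrefl n (hb n (this n))

end RayCategory

open RayCategory

/-- The full subcategory on two points of a ray category is a dumb-bell. -/
structure Dumbbell (P : RayCategory) {x y : P.Obj} (lam : P.Hom x x) (mu : P.Hom x y)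
    (rho : P.Hom y y) : Prop where
  ne : x ≠ y
  comm : mu ⊚ lam = rho ⊚ mu
  endo_left : ∀ f : P.Hom x x, ∃ i : ℕ, f = P.pow lam i
  endo_right : ∀ f : P.Hom y y, ∃ i : ℕ, f = P.pow rho i
  hom : ∀ f : P.Hom x y, f = P.zero x y ∨ ∃ i : ℕ, f = mu ⊚ P.pow lam i
  hom_zero : ∀ f : P.Hom y x, f = P.zero y x
  nilp_left : ∃ n : ℕ, P.pow lam n = P.zero x x
  nilp_right : ∃ n : ℕ, P.pow rho n = P.zero y y
  ne_zero : mu ⊚ lam ⊚ lam ≠ P.zero x y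
  rep : RepFin P Set.univ (IdealOf P ((rho ⊚ rho) ⊚ mu))

namespace Dumbbell

variable {P : RayCategory} {x y : P.Obj} {lam : P.Hom x x} {mu : P.Hom x y} {rho : P.Hom y y}

lemma of_data {r s : ℕ} (h : DumbBellData P x y lam mu rho r s)
    (hrep : RepFin P Set.univ (IdealOf P ((rho ⊚ rho) ⊚ mu))) : Dumbbell P lam mu rho := by
  obtain ⟨h1, -, -, -, -, h2, h3, h4, -, -, h5, -, h6, h7, h8, h9, h10⟩ := h
  refine ⟨h1, h2, h6, h7, h8, h10, ⟨r, h3⟩, ⟨s, h4⟩, ?_, hrep⟩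
  have := h9 2 (by omega)
  rwa [pow, pow_one] at this

variable (d : Dumbbell P lam mu rho)
include d

lemma comm2 : rho ⊚ rho ⊚ mu = mu ⊚ lam ⊚ lam := by
  rw [← d.comm, ← P.assoc, ← d.comm, P.assoc]

lemma comm_pow (i : ℕ) : mu ⊚ P.pow lam i = P.pow rho i ⊚ mu := by
  induction i with
  | zero => rw [pow, pow, P.comp_id, P.id_comp]
  | succ n ih => rw [pow_succ', pow, ← P.assoc, ih, P.assoc, d.comm, ← P.assoc, ← pow_succ', pow]

lemma lam_ne_id : lam ≠ P.id x := ne_id_of_pow_eq_zero d.nilp_left.choose_spec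

lemma rho_ne_id : rho ≠ P.id y := ne_id_of_pow_eq_zero d.nilp_right.choose_spec

lemma comm_ne_zero : mu ⊚ lam ≠ P.zero x y := by
  have h := d.ne_zero
  rw [← P.assoc] at h
  exact left_ne_zero h

lemma mu_ne_zero : mu ≠ P.zero x y := left_ne_zero d.ne_zero

lemma lam_lam_ne_zero : lam ⊚ lam ≠ P.zero x x := right_ne_zero d.ne_zero

lemma lam_ne_zero : lam ≠ P.zero x x := left_ne_zero d.lam_lam_ne_zero

lemma rho_rho_ne_zero : rho ⊚ rho ≠ P.zero y y := by
  have h := d.ne_zero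
  rw [← d.comm2, ← P.assoc] at h
  exact left_ne_zero h

lemma rho_ne_zero : rho ≠ P.zero y y := left_ne_zero d.rho_rho_ne_zero

lemma hom_x (f : P.Hom x y) : ∃ g, f = mu ⊚ g := by
  obtain rfl | ⟨i, rfl⟩ := d.hom f
  · exact ⟨P.zero x x, (P.comp_zero mu).symm⟩
  · exact ⟨_, rfl⟩

lemma hom_y (f : P.Hom x y) : ∃ g, f = g ⊚ mu := by
  obtain rfl | ⟨i, rfl⟩ := d.hom f
  · exact ⟨P.zero y y, (P.zero_comp mu).symm⟩
  · exact ⟨_, d.comm_pow i⟩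

lemma rho_comp_ne (ν : P.Hom x y) : rho ⊚ ν ≠ mu := by
  intro h
  obtain ⟨g, rfl⟩ := d.hom_y ν
  rw [← P.assoc] at h
  exact d.rho_ne_id (eq_id_left (eq_id_of_self_comp_eq h d.mu_ne_zero))

lemma comp_lam_ne (ν : P.Hom x y) : ν ⊚ lam ≠ mu := by
  intro h
  obtain ⟨g, rfl⟩ := d.hom_x ν
  rw [P.assoc] at h
  exact d.lam_ne_id (eq_id_right (eq_id_of_comp_eq_self h d.mu_ne_zero))

/-- the ideal generated by `ρ²μ` -/
abbrev ideal (_ : Dumbbell P lam mu rho) : ∀ a b : P.Obj, P.Hom a b → Prop :=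
  IdealOf P ((rho ⊚ rho) ⊚ mu)

lemma two : IsTwoSided P d.ideal := isTwoSided_idealOf _

lemma op : Dumbbell P.op (x := y) (y := x) rho mu lam where
  ne := d.ne.symm
  comm := d.comm.symm
  endo_left f := by
    obtain ⟨i, hi⟩ := d.endo_right f
    exact ⟨i, hi.trans (op_pow rho i).symm⟩
  endo_right f := by
    obtain ⟨i, hi⟩ := d.endo_left f
    exact ⟨i, hi.trans (op_pow lam i).symm⟩
  hom f := by
    obtain h | ⟨i, hi⟩ := d.hom f
    · exact Or.inl h
    · refine Or.inr ⟨i, ?_⟩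
      rw [hi, d.comm_pow, ← op_pow rho i]
  hom_zero := d.hom_zero
  nilp_left := by
    obtain ⟨n, hn⟩ := d.nilp_right
    exact ⟨n, (op_pow rho n).trans hn⟩
  nilp_right := by
    obtain ⟨n, hn⟩ := d.nilp_left
    exact ⟨n, (op_pow lam n).trans hn⟩
  ne_zero := by
    change (rho ⊚ rho) ⊚ mu ≠ P.zero x y
    rw [P.assoc, d.comm2]
    exact d.ne_zero
  rep := by
    have h := d.rep.op
    have e : opIdeal (IdealOf P ((rho ⊚ rho) ⊚ mu)) =
        IdealOf P.op (a := y) (b := x) (P.op.comp (P.op.comp lam lam) mu) := by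
      funext a b f
      refine propext ⟨?_, ?_⟩
      · rintro ⟨g, h, rfl⟩
        refine ⟨h, g, ?_⟩
        change P.comp g (P.comp (P.comp (P.comp rho rho) mu) h) =
          P.comp (P.comp g (P.comp mu (P.comp lam lam))) h
        rw [P.assoc rho rho mu, d.comm2, P.assoc g]
      · rintro ⟨h, g, rfl⟩
        refine ⟨g, h, ?_⟩
        change P.comp (P.comp g (P.comp mu (P.comp lam lam))) h =
          P.comp g (P.comp (P.comp (P.comp rho rho) mu) h)
        rw [P.assoc rho rho mu, d.comm2, P.assoc g]
    rw [e] at h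
    exact h

lemma mem_right {c : P.Obj} {f : P.Hom x c} (h : d.ideal x c f) : ∃ g, f = g ⊚ mu ⊚ lam ⊚ lam := by
  obtain ⟨g, h, rfl⟩ := h
  obtain ⟨i, rfl⟩ := d.endo_left h
  refine ⟨g ⊚ P.pow rho i, ?_⟩
  rw [← d.comm2, P.assoc (rho ⊚ rho), d.comm_pow, P.assoc g, ← P.assoc (rho ⊚ rho), P.assoc rho rho,
    ← pow, ← pow, pow_succ', pow_succ']
  simp only [P.assoc]

lemma mem_left {c : P.Obj} {f : P.Hom c y} (h : d.ideal c y f) : ∃ g, f = rho ⊚ rho ⊚ mu ⊚ g := by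
  obtain ⟨g, h, rfl⟩ := h
  obtain ⟨i, rfl⟩ := d.endo_right g
  refine ⟨P.pow lam i ⊚ h, ?_⟩
  rw [← P.assoc mu, d.comm_pow, P.assoc (P.pow rho i), ← P.assoc rho (P.pow rho i),
    ← P.assoc rho (rho ⊚ _), ← pow, ← pow, pow_succ', pow_succ']
  simp only [P.assoc]

lemma mem_x {c : P.Obj} {f : P.Hom c x} (h : d.ideal c x f) : f = P.zero c x := by
  obtain ⟨g, h, rfl⟩ := h
  rw [d.hom_zero g, P.zero_comp]

lemma mem_y {c : P.Obj} {f : P.Hom y c} (h : d.ideal y c f) : f = P.zero y c := by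
  obtain ⟨g, h, rfl⟩ := h
  rw [d.hom_zero h, P.comp_zero, P.comp_zero]

lemma id_notMem (a : P.Obj) : ¬ d.ideal a a (P.id a) := by
  rintro ⟨g, h, e⟩
  have h1 : P.IsId h := (isId_of_comp_eq_id (g := g ⊚ (rho ⊚ rho) ⊚ mu) (f := h)
    (by rw [P.assoc]; exact e.symm)).1
  have h2 : P.IsId g := (isId_of_comp_eq_id e.symm).2
  obtain ⟨rfl, -⟩ := h1
  exact d.ne h2.choose.symm

lemma mu_notMem : ¬ d.ideal x y mu := by
  intro h
  obtain ⟨g, h⟩ := d.mem_left h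
  exact d.rho_comp_ne _ h.symm

lemma mu_lam_notMem : ¬ d.ideal x y (mu ⊚ lam) := by
  intro h
  obtain ⟨g, h⟩ := d.mem_left h
  rw [d.comm] at h
  refine d.rho_comp_ne _ (cancel_left h ?_).symm
  rw [← d.comm]
  exact d.comm_ne_zero

/-- the facts about a dumb-bell that every diagram uses -/
lemma basic : (¬ P.IsId lam ∧ ¬ P.IsId mu ∧ ¬ P.IsId rho) ∧
    (¬ d.ideal x x lam ∧ ¬ d.ideal x x (lam ⊚ lam) ∧ ¬ d.ideal y y rho ∧
      ¬ d.ideal y y (rho ⊚ rho) ∧ ¬ d.ideal x y mu ∧ ¬ d.ideal x y (mu ⊚ lam)) ∧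
    rho ⊚ mu = mu ⊚ lam ∧ (∀ ν : P.Hom x y, rho ⊚ ν ≠ mu) ∧ ∀ ν : P.Hom x y, ν ⊚ lam ≠ mu :=
  ⟨⟨fun h => d.lam_ne_id (isId_iff.1 h), not_isId_of_ne d.ne _, fun h => d.rho_ne_id (isId_iff.1 h)⟩,
   ⟨fun h => d.lam_ne_zero (d.mem_x h), fun h => d.lam_lam_ne_zero (d.mem_x h),
    fun h => d.rho_ne_zero (d.mem_y h), fun h => d.rho_rho_ne_zero (d.mem_y h),
    d.mu_notMem, d.mu_lam_notMem⟩, d.comm.symm, d.rho_comp_ne, d.comp_lam_ne⟩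

lemma comp_left_ne_of_notMem {a : P.Obj} {f : P.Hom a x} (hf : ¬ d.ideal a x f) (g : P.Hom a y)
    (ν : P.Hom y x) : ν ⊚ g ≠ f := by
  rintro rfl
  rw [d.hom_zero ν, P.zero_comp] at hf
  exact hf (d.two.zero _ _)

lemma comp_right_ne_of_notMem {b : P.Obj} {f : P.Hom y b} (hf : ¬ d.ideal y b f)
    (h : P.Hom x b) (ν : P.Hom y x) : h ⊚ ν ≠ f := by
  rintro rfl
  rw [d.hom_zero ν, P.comp_zero] at hf
  exact hf (d.two.zero _ _)

end Dumbbell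

namespace Crown

/-- the points of the diagram -/
@[reducible] def obj {P : RayCategory} (u1 u2 v1 v2 : P.Obj) : Crown → P.Obj
  | .b1 => u1
  | .b2 => u2
  | .a1 => v1
  | .a2 => v2

/-- the morphisms of the diagram -/
@[reducible] def hom {P : RayCategory} {u1 u2 v1 v2 : P.Obj} (f11 : P.Hom u1 v1)
    (f12 : P.Hom u2 v1) (f21 : P.Hom u1 v2) (f22 : P.Hom u2 v2) :
    ∀ b b', P.Hom (obj u1 u2 v1 v2 b) (obj u1 u2 v1 v2 b')
  | .b1, .a1 => f11
  | .b1, .a2 => f21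
  | .b2, .a1 => f12
  | .b2, .a2 => f22
  | _, _ => P.zero _ _

theorem false {P : RayCategory} {x y : P.Obj} {lam : P.Hom x x} {mu : P.Hom x y} {rho : P.Hom y y}
    (d : Dumbbell P lam mu rho) {u1 u2 v1 v2 : P.Obj} (f11 : P.Hom u1 v1)
    (f12 : P.Hom u2 v1) (f21 : P.Hom u1 v2) (f22 : P.Hom u2 v2) (_ : ¬ P.IsId f11)
    (_ : ¬ P.IsId f12) (_ : ¬ P.IsId f21) (_ : ¬ P.IsId f22) (_ : ¬ d.ideal u1 v1 f11)
    (_ : ¬ d.ideal u2 v1 f12) (_ : ¬ d.ideal u1 v2 f21) (_ : ¬ d.ideal u2 v2 f22)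
    (_ : ∀ g, g ⊚ f11 ≠ f21) (_ : ∀ g, g ⊚ f12 ≠ f22) (_ : ∀ g, g ⊚ f21 ≠ f11)
    (_ : ∀ g, g ⊚ f22 ≠ f12) (_ : ∀ f, f11 ⊚ f ≠ f12) (_ : ∀ f, f21 ⊚ f ≠ f22)
    (_ : ∀ f, f12 ⊚ f ≠ f11) (_ : ∀ f, f22 ⊚ f ≠ f21) : False := by
  refine false_of_isCleaving d.rep d.two (o := obj u1 u2 v1 v2)
    (m := hom f11 f12 f21 f22) ⟨?_, ?_, ?_, ?_, fun _ => d.id_notMem _, ?_, ?_, ?_, ?_, ?_⟩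
  · rintro _ _ ⟨⟩ <;> constructor
  · rintro _ ⟨⟩
  · rintro _ _ ⟨⟩ ⟨⟩
  · rintro _ _ ⟨⟩ <;> assumption
  · rintro _ _ ⟨⟩ <;> assumption
  · rintro _ _ _ ⟨⟩ ⟨⟩
  · rintro _ _ _ ⟨⟩ ⟨⟩
  · rintro _ _ _ ⟨⟩ ⟨⟩ hne hE <;> first | exact absurd rfl hne | assumption
  · rintro _ _ _ ⟨⟩ ⟨⟩ hne hE <;> first | exact absurd rfl hne | assumption

end Crown

namespace ShA

/-- the points of the diagram -/
@[reducible] def obj {P : RayCategory} (x y c : P.Obj) : ShA → P.Obj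
  | .x1 | .x2 | .x3 => x
  | .c1 | .c2 => c
  | .y0 | .y1 | .y2 => y

/-- the morphisms of the diagram -/
@[reducible] def hom {P : RayCategory} {x y c : P.Obj} (lam : P.Hom x x) (mu : P.Hom x y) (rho
    : P.Hom y y) (eta : P.Hom c y) (kap : P.Hom c x) (phi : P.Hom x c) :
    ∀ b b', P.Hom (obj x y c b) (obj x y c b')
  | .x1, .c1 => phi
  | .c1, .x2 => kap
  | .x2, .c2 => phi
  | .c2, .x3 => kap
  | .c1, .y1 => eta
  | .c2, .y2 => eta
  | .y0, .y1 => rho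
  | .y1, .y2 => rho
  | .x1, .x2 => lam
  | .x1, .c2 => phi ⊚ lam
  | .x1, .x3 => lam ⊚ lam
  | .x1, .y1 => mu
  | .x1, .y2 => mu ⊚ lam
  | .c1, .c2 => phi ⊚ kap
  | .c1, .x3 => lam ⊚ kap
  | .c1, .y2 => rho ⊚ eta
  | .x2, .x3 => lam
  | .x2, .y2 => mu
  | .y0, .y2 => rho ⊚ rho
  | _, _ => P.zero _ _

theorem false {P : RayCategory} {x y c : P.Obj} {lam : P.Hom x x} {mu : P.Hom x y} {rho :
    P.Hom y y} (d : Dumbbell P lam mu rho) (eta : P.Hom c y) (kap : P.Hom c x) (phi : P.Hom x c)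
    (_ : ¬ P.IsId eta) (_ : ¬ P.IsId kap) (_ : ¬ P.IsId phi) (hp : ¬ d.ideal x c phi) (hk : ¬
    d.ideal c x kap) (hh : ¬ d.ideal c y eta) (hpl : ¬ d.ideal x c (phi ⊚ lam)) (hpk : ¬ d.ideal c
    c (phi ⊚ kap)) (hlk : ¬ d.ideal c x (lam ⊚ kap)) (hrh : ¬ d.ideal c y (rho ⊚ eta)) (_ : kap ⊚
    phi = lam) (_ : eta ⊚ phi = mu) (_ : phi ⊚ kap ⊚ phi = phi ⊚ lam) (_ : lam ⊚ kap ⊚ phi = lam ⊚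
    lam) (_ : rho ⊚ eta ⊚ phi = mu ⊚ lam) (_ : mu ⊚ kap = rho ⊚ eta) (_ : kap ⊚ phi ⊚ lam = lam ⊚
    lam) (_ : kap ⊚ phi ⊚ kap = lam ⊚ kap) (_ : eta ⊚ phi ⊚ lam = mu ⊚ lam) (_ : eta ⊚ phi ⊚ kap =
    rho ⊚ eta) (_ : ∀ ν : P.Hom y c, eta ⊚ ν ≠ rho) (_ : ∀ ν : P.Hom y c, eta ⊚ ν ≠ rho ⊚ rho) (_
    : ∀ ν : P.Hom c y, rho ⊚ ν ≠ eta) (_ : ∀ ν : P.Hom x y, ν ⊚ kap ≠ eta) (_ : ∀ ν : P.Hom y c, ν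
    ⊚ eta ≠ phi ⊚ kap) : False := by
  obtain ⟨⟨_, _, _⟩, ⟨hl, hll, hr, hrr, hm, hml⟩, _, _, _⟩ := d.basic
  have := d.comp_left_ne_of_notMem hk eta
  have := d.comp_left_ne_of_notMem hlk eta
  refine false_of_isCleaving d.rep d.two (o := obj x y c)
    (m := hom lam mu rho eta kap phi) ⟨?_, ?_, ?_, ?_, fun _ => d.id_notMem _, ?_, ?_, ?_, ?_, ?_⟩
  · rintro _ _ ⟨⟩ <;> constructor
  · rintro _ ⟨⟩
  · rintro _ _ ⟨⟩ ⟨⟩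
  · rintro _ _ ⟨⟩ <;> assumption
  · rintro _ _ ⟨⟩ <;> assumption
  · rintro _ _ _ ⟨⟩ ⟨⟩ ⟨⟩ <;> first | rfl | assumption
  · rintro _ _ _ ⟨⟩ ⟨⟩ ⟨⟩ <;> first | rfl | assumption |
      (refine (P.assoc _ _ _).trans ?_; first | rfl | assumption)
  · rintro _ _ _ ⟨⟩ ⟨⟩ hne hE <;>
      first | exact absurd rfl hne | exact absurd (by constructor) hE | assumption
  · rintro _ _ _ ⟨⟩ ⟨⟩ hne hE <;>
      first | exact absurd rfl hne | exact absurd (by constructor) hE | assumption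

end ShA

namespace ShB

/-- the points of the diagram -/
@[reducible] def obj {P : RayCategory} (x y c : P.Obj) : ShB → P.Obj
  | .x1 | .x2 | .x3 => x
  | .c1 | .c2 => c
  | .y0 | .y1 | .y2 => y

/-- the morphisms of the diagram -/
@[reducible] def hom {P : RayCategory} {x y c : P.Obj} (lam : P.Hom x x) (mu : P.Hom x y) (rho
    : P.Hom y y) (kap : P.Hom c x) (phi : P.Hom x c) :
    ∀ b b', P.Hom (obj x y c b) (obj x y c b')
  | .x1, .c1 => phi
  | .c1, .x2 => kap
  | .x2, .c2 => phi
  | .c2, .x3 => kap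
  | .x1, .y1 => mu
  | .x2, .y2 => mu
  | .y0, .y1 => rho
  | .y1, .y2 => rho
  | .x1, .x2 => lam
  | .x1, .c2 => phi ⊚ lam
  | .x1, .x3 => lam ⊚ lam
  | .x1, .y2 => mu ⊚ lam
  | .c1, .c2 => phi ⊚ kap
  | .c1, .x3 => lam ⊚ kap
  | .c1, .y2 => mu ⊚ kap
  | .x2, .x3 => lam
  | .y0, .y2 => rho ⊚ rho
  | _, _ => P.zero _ _

theorem false {P : RayCategory} {x y c : P.Obj} {lam : P.Hom x x} {mu : P.Hom x y} {rho :
    P.Hom y y} (d : Dumbbell P lam mu rho) (kap : P.Hom c x) (phi : P.Hom x c) (_ : ¬ P.IsId kap)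
    (_ : ¬ P.IsId phi) (hp : ¬ d.ideal x c phi) (hk : ¬ d.ideal c x kap) (hpl : ¬ d.ideal x c (phi
    ⊚ lam)) (hpk : ¬ d.ideal c c (phi ⊚ kap)) (hlk : ¬ d.ideal c x (lam ⊚ kap)) (hmk : ¬ d.ideal c
    y (mu ⊚ kap)) (_ : kap ⊚ phi = lam) (_ : phi ⊚ kap ⊚ phi = phi ⊚ lam) (_ : lam ⊚ kap ⊚ phi =
    lam ⊚ lam) (_ : mu ⊚ kap ⊚ phi = mu ⊚ lam) (_ : kap ⊚ phi ⊚ lam = lam ⊚ lam) (_ : kap ⊚ phi ⊚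
    kap = lam ⊚ kap) (_ : ∀ ν : P.Hom c y, rho ⊚ ν ≠ mu ⊚ kap) (_ : ∀ ν : P.Hom c y, ν ⊚ phi ≠ mu)
    (_ : ∀ ν : P.Hom y c, ν ⊚ mu ≠ phi) (_ : ∀ ν : P.Hom y c, ν ⊚ mu ≠ phi ⊚ lam) : False := by
  obtain ⟨⟨_, _, _⟩, ⟨hl, hll, hr, hrr, hm, hml⟩, _, _, _⟩ := d.basic
  have := d.comp_right_ne_of_notMem hr mu
  have := d.comp_right_ne_of_notMem hrr mu
  have := d.comp_left_ne_of_notMem hl mu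
  have := d.comp_left_ne_of_notMem hll mu
  refine false_of_isCleaving d.rep d.two (o := obj x y c)
    (m := hom lam mu rho kap phi) ⟨?_, ?_, ?_, ?_, fun _ => d.id_notMem _, ?_, ?_, ?_, ?_, ?_⟩
  · rintro _ _ ⟨⟩ <;> constructor
  · rintro _ ⟨⟩
  · rintro _ _ ⟨⟩ ⟨⟩
  · rintro _ _ ⟨⟩ <;> assumption
  · rintro _ _ ⟨⟩ <;> assumption
  · rintro _ _ _ ⟨⟩ ⟨⟩ ⟨⟩ <;> first | rfl | assumption
  · rintro _ _ _ ⟨⟩ ⟨⟩ ⟨⟩ <;> first | rfl | assumption |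
      (refine (P.assoc _ _ _).trans ?_; first | rfl | assumption)
  · rintro _ _ _ ⟨⟩ ⟨⟩ hne hE <;>
      first | exact absurd rfl hne | exact absurd (by constructor) hE | assumption
  · rintro _ _ _ ⟨⟩ ⟨⟩ hne hE <;>
      first | exact absurd rfl hne | exact absurd (by constructor) hE | assumption

end ShB

namespace ShC

/-- the points of the diagram -/
@[reducible] def obj {P : RayCategory} (x y c : P.Obj) : ShC → P.Obj
  | .c1 | .c2 | .c3 => c
  | .y0 | .y1 | .y2 => y
  | .x2 | .x3 | .x4 => x

/-- the morphisms of the diagram -/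
@[reducible] def hom {P : RayCategory} {x y c : P.Obj} (lam : P.Hom x x) (mu : P.Hom x y) (rho
    : P.Hom y y) (eta : P.Hom c y) (phi : P.Hom x c) :
    ∀ b b', P.Hom (obj x y c b) (obj x y c b')
  | .c1, .y1 => eta
  | .y0, .y1 => rho
  | .y1, .y2 => rho
  | .x2, .x3 => lam
  | .x3, .x4 => lam
  | .x2, .c2 => phi
  | .c2, .y2 => eta
  | .x3, .c3 => phi
  | .c1, .y2 => rho ⊚ eta
  | .y0, .y2 => rho ⊚ rho
  | .x2, .x4 => lam ⊚ lam
  | .x2, .y2 => mu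
  | .x2, .c3 => phi ⊚ lam
  | _, _ => P.zero _ _

theorem false {P : RayCategory} {x y c : P.Obj} {lam : P.Hom x x} {mu : P.Hom x y} {rho :
    P.Hom y y} (d : Dumbbell P lam mu rho) (eta : P.Hom c y) (phi : P.Hom x c) (_ : ¬ P.IsId eta)
    (_ : ¬ P.IsId phi) (hh : ¬ d.ideal c y eta) (hp : ¬ d.ideal x c phi) (hrh : ¬ d.ideal c y (rho
    ⊚ eta)) (hpl : ¬ d.ideal x c (phi ⊚ lam)) (_ : eta ⊚ phi = mu) (_ : ∀ ν : P.Hom y c, eta ⊚ ν ≠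
    rho) (_ : ∀ ν : P.Hom c y, rho ⊚ ν ≠ eta) (_ : ∀ ν : P.Hom c c, eta ⊚ ν ≠ rho ⊚ eta) (_ : ∀ ν
    : P.Hom y c, eta ⊚ ν ≠ rho ⊚ rho) (_ : ∀ ν : P.Hom x c, ν ⊚ lam ≠ phi) (_ : ∀ ν : P.Hom c x, ν
    ⊚ phi ≠ lam) (_ : ∀ ν : P.Hom c x, ν ⊚ phi ≠ lam ⊚ lam) (_ : ∀ ν : P.Hom c c, ν ⊚ phi ≠ phi ⊚
    lam) : False := by
  obtain ⟨⟨_, _, _⟩, ⟨hl, hll, hr, hrr, hm, hml⟩, _, _, _⟩ := d.basic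
  refine false_of_isCleaving d.rep d.two (o := obj x y c)
    (m := hom lam mu rho eta phi) ⟨?_, ?_, ?_, ?_, fun _ => d.id_notMem _, ?_, ?_, ?_, ?_, ?_⟩
  · rintro _ _ ⟨⟩ <;> constructor
  · rintro _ ⟨⟩
  · rintro _ _ ⟨⟩ ⟨⟩
  · rintro _ _ ⟨⟩ <;> assumption
  · rintro _ _ ⟨⟩ <;> assumption
  · rintro _ _ _ ⟨⟩ ⟨⟩ ⟨⟩ <;> first | rfl | assumption
  · rintro _ _ _ ⟨⟩ ⟨⟩ ⟨⟩ <;> first | rfl | assumption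
  · rintro _ _ _ ⟨⟩ ⟨⟩ hne hE <;>
      first | exact absurd rfl hne | exact absurd (by constructor) hE | assumption
  · rintro _ _ _ ⟨⟩ ⟨⟩ hne hE <;>
      first | exact absurd rfl hne | exact absurd (by constructor) hE | assumption

end ShC

namespace ShD

/-- the points of the diagram -/
@[reducible] def obj {P : RayCategory} (x y c : P.Obj) : ShD → P.Obj
  | .x1 | .x2 => x
  | .c1 | .c0 => c
  | .y1 | .y0 => y

/-- the morphisms of the diagram -/
@[reducible] def hom {P : RayCategory} {x y c : P.Obj} (lam : P.Hom x x) (mu : P.Hom x y) (rho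
    : P.Hom y y) (eta : P.Hom c y) (phi : P.Hom x c) :
    ∀ b b', P.Hom (obj x y c b) (obj x y c b')
  | .x1, .x2 => lam
  | .x1, .c1 => phi
  | .x1, .y1 => mu
  | .y0, .y1 => rho
  | .c0, .y1 => eta
  | _, _ => P.zero _ _

theorem false {P : RayCategory} {x y c : P.Obj} {lam : P.Hom x x} {mu : P.Hom x y} {rho :
    P.Hom y y} (d : Dumbbell P lam mu rho) (eta : P.Hom c y) (phi : P.Hom x c) (_ : ¬ P.IsId eta)
    (_ : ¬ P.IsId phi) (hp : ¬ d.ideal x c phi) (hh : ¬ d.ideal c y eta) (_ : ∀ ν : P.Hom c x, mu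
    ⊚ ν ≠ eta) (_ : ∀ ν : P.Hom c y, rho ⊚ ν ≠ eta) (_ : ∀ ν : P.Hom x c, eta ⊚ ν ≠ mu) (_ : ∀ ν :
    P.Hom y c, eta ⊚ ν ≠ rho) (_ : ∀ ν : P.Hom x c, ν ⊚ lam ≠ phi) (_ : ∀ ν : P.Hom c x, ν ⊚ phi ≠
    lam) (_ : ∀ ν : P.Hom c y, ν ⊚ phi ≠ mu) (_ : ∀ ν : P.Hom y c, ν ⊚ mu ≠ phi) : False := by
  obtain ⟨⟨_, _, _⟩, ⟨hl, hll, hr, hrr, hm, hml⟩, _, _, _⟩ := d.basic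
  have := d.comp_right_ne_of_notMem hr mu
  have := d.comp_left_ne_of_notMem hl mu
  refine false_of_isCleaving d.rep d.two (o := obj x y c)
    (m := hom lam mu rho eta phi) ⟨?_, ?_, ?_, ?_, fun _ => d.id_notMem _, ?_, ?_, ?_, ?_, ?_⟩
  · rintro _ _ ⟨⟩ <;> constructor
  · rintro _ ⟨⟩
  · rintro _ _ ⟨⟩ ⟨⟩
  · rintro _ _ ⟨⟩ <;> assumption
  · rintro _ _ ⟨⟩ <;> assumption
  · rintro _ _ _ ⟨⟩ ⟨⟩ ⟨⟩
  · rintro _ _ _ ⟨⟩ ⟨⟩ ⟨⟩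
  · rintro _ _ _ ⟨⟩ ⟨⟩ hne hE <;>
      first | exact absurd rfl hne | exact absurd (by constructor) hE | assumption
  · rintro _ _ _ ⟨⟩ ⟨⟩ hne hE <;>
      first | exact absurd rfl hne | exact absurd (by constructor) hE | assumption

end ShD

namespace ShE

/-- the points of the diagram -/
@[reducible] def obj {P : RayCategory} (x y c : P.Obj) : ShE → P.Obj
  | .c0 | .c1 => c
  | .x1 | .x2 => x
  | .y0 | .y1 | .y2 => y

/-- the morphisms of the diagram -/
@[reducible] def hom {P : RayCategory} {x y c : P.Obj} (lam : P.Hom x x) (mu : P.Hom x y) (rho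
    : P.Hom y y) (kap : P.Hom c x) (phi : P.Hom x c) :
    ∀ b b', P.Hom (obj x y c b) (obj x y c b')
  | .x1, .x2 => lam
  | .x1, .c1 => phi
  | .c0, .x2 => kap
  | .x1, .y1 => mu
  | .x2, .y2 => mu
  | .y0, .y1 => rho
  | .y1, .y2 => rho
  | .x1, .y2 => mu ⊚ lam
  | .c0, .y2 => mu ⊚ kap
  | .y0, .y2 => rho ⊚ rho
  | _, _ => P.zero _ _

theorem false {P : RayCategory} {x y c : P.Obj} {lam : P.Hom x x} {mu : P.Hom x y} {rho :
    P.Hom y y} (d : Dumbbell P lam mu rho) (kap : P.Hom c x) (phi : P.Hom x c) (_ : ¬ P.IsId kap)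
    (_ : ¬ P.IsId phi) (hp : ¬ d.ideal x c phi) (hk : ¬ d.ideal c x kap) (hmk : ¬ d.ideal c y (mu
    ⊚ kap)) (_ : ∀ ν : P.Hom c x, lam ⊚ ν ≠ kap) (_ : ∀ ν : P.Hom x c, kap ⊚ ν ≠ lam) (_ : ∀ ν :
    P.Hom c y, rho ⊚ ν ≠ mu ⊚ kap) (_ : ∀ ν : P.Hom x c, ν ⊚ lam ≠ phi) (_ : ∀ ν : P.Hom c x, ν ⊚
    phi ≠ lam) (_ : ∀ ν : P.Hom c y, ν ⊚ phi ≠ mu) (_ : ∀ ν : P.Hom c y, ν ⊚ phi ≠ mu ⊚ lam) (_ :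
    ∀ ν : P.Hom y c, ν ⊚ mu ≠ phi) : False := by
  obtain ⟨⟨_, _, _⟩, ⟨hl, hll, hr, hrr, hm, hml⟩, _, _, _⟩ := d.basic
  have := d.comp_right_ne_of_notMem hr mu
  have := d.comp_right_ne_of_notMem hrr mu
  have := d.comp_left_ne_of_notMem hl mu
  refine false_of_isCleaving d.rep d.two (o := obj x y c)
    (m := hom lam mu rho kap phi) ⟨?_, ?_, ?_, ?_, fun _ => d.id_notMem _, ?_, ?_, ?_, ?_, ?_⟩
  · rintro _ _ ⟨⟩ <;> constructor
  · rintro _ ⟨⟩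
  · rintro _ _ ⟨⟩ ⟨⟩
  · rintro _ _ ⟨⟩ <;> assumption
  · rintro _ _ ⟨⟩ <;> assumption
  · rintro _ _ _ ⟨⟩ ⟨⟩ ⟨⟩ <;> first | rfl | assumption
  · rintro _ _ _ ⟨⟩ ⟨⟩ ⟨⟩ <;> first | rfl | assumption
  · rintro _ _ _ ⟨⟩ ⟨⟩ hne hE <;>
      first | exact absurd rfl hne | exact absurd (by constructor) hE | assumption
  · rintro _ _ _ ⟨⟩ ⟨⟩ hne hE <;>
      first | exact absurd rfl hne | exact absurd (by constructor) hE | assumption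

end ShE

namespace ShF

/-- the points of the diagram -/
@[reducible] def obj {P : RayCategory} (x y c : P.Obj) : ShF → P.Obj
  | .c1 => c
  | .x1 | .x2 | .x3 => x
  | .y0 | .y1 | .y2 => y

/-- the morphisms of the diagram -/
@[reducible] def hom {P : RayCategory} {x y c : P.Obj} (lam : P.Hom x x) (mu : P.Hom x y) (rho
    : P.Hom y y) (phi : P.Hom x c) :
    ∀ b b', P.Hom (obj x y c b) (obj x y c b')
  | .x1, .x2 => lam
  | .x2, .x3 => lam
  | .x1, .y1 => mu
  | .x2, .y2 => mu
  | .y0, .y1 => rho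
  | .y1, .y2 => rho
  | .x1, .c1 => phi
  | .x1, .x3 => lam ⊚ lam
  | .x1, .y2 => mu ⊚ lam
  | .y0, .y2 => rho ⊚ rho
  | _, _ => P.zero _ _

theorem false {P : RayCategory} {x y c : P.Obj} {lam : P.Hom x x} {mu : P.Hom x y} {rho :
    P.Hom y y} (d : Dumbbell P lam mu rho) (phi : P.Hom x c) (_ : ¬ P.IsId phi) (hp : ¬ d.ideal x
    c phi) (_ : ∀ ν : P.Hom x c, ν ⊚ lam ≠ phi) (_ : ∀ ν : P.Hom y c, ν ⊚ mu ≠ phi) (_ : ∀ ν :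
    P.Hom c x, ν ⊚ phi ≠ lam) (_ : ∀ ν : P.Hom c y, ν ⊚ phi ≠ mu) (_ : ∀ ν : P.Hom c x, ν ⊚ phi ≠
    lam ⊚ lam) (_ : ∀ ν : P.Hom c y, ν ⊚ phi ≠ mu ⊚ lam) : False := by
  obtain ⟨⟨_, _, _⟩, ⟨hl, hll, hr, hrr, hm, hml⟩, _, _, _⟩ := d.basic
  have := d.comp_right_ne_of_notMem hr mu
  have := d.comp_right_ne_of_notMem hrr mu
  have := d.comp_left_ne_of_notMem hl mu
  have := d.comp_left_ne_of_notMem hll mu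
  refine false_of_isCleaving d.rep d.two (o := obj x y c)
    (m := hom lam mu rho phi) ⟨?_, ?_, ?_, ?_, fun _ => d.id_notMem _, ?_, ?_, ?_, ?_, ?_⟩
  · rintro _ _ ⟨⟩ <;> constructor
  · rintro _ ⟨⟩
  · rintro _ _ ⟨⟩ ⟨⟩
  · rintro _ _ ⟨⟩ <;> assumption
  · rintro _ _ ⟨⟩ <;> assumption
  · rintro _ _ _ ⟨⟩ ⟨⟩ ⟨⟩ <;> first | rfl | assumption
  · rintro _ _ _ ⟨⟩ ⟨⟩ ⟨⟩ <;> first | rfl | assumption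
  · rintro _ _ _ ⟨⟩ ⟨⟩ hne hE <;>
      first | exact absurd rfl hne | exact absurd (by constructor) hE | assumption
  · rintro _ _ _ ⟨⟩ ⟨⟩ hne hE <;>
      first | exact absurd rfl hne | exact absurd (by constructor) hE | assumption

end ShF

namespace ShG

/-- the points of the diagram -/
@[reducible] def obj {P : RayCategory} (x y c z : P.Obj) : ShG → P.Obj
  | .c3 => c
  | .x1 | .x2 | .x3 => x
  | .y0 | .y1 | .y2 => y
  | .z0 => z

/-- the morphisms of the diagram -/
@[reducible] def hom {P : RayCategory} {x y c z : P.Obj} (lam : P.Hom x x) (mu : P.Hom x y)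
    (rho : P.Hom y y) (f : P.Hom c x) (tau : P.Hom y z) :
    ∀ b b', P.Hom (obj x y c z b) (obj x y c z b')
  | .x1, .x2 => lam
  | .x2, .x3 => lam
  | .c3, .x3 => f
  | .x1, .y1 => mu
  | .x2, .y2 => mu
  | .y0, .y1 => rho
  | .y1, .y2 => rho
  | .y0, .z0 => tau
  | .x1, .x3 => lam ⊚ lam
  | .x1, .y2 => mu ⊚ lam
  | .y0, .y2 => rho ⊚ rho
  | _, _ => P.zero _ _

theorem false {P : RayCategory} {x y c z : P.Obj} {lam : P.Hom x x} {mu : P.Hom x y} {rho :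
    P.Hom y y} (d : Dumbbell P lam mu rho) (f : P.Hom c x) (tau : P.Hom y z) (_ : ¬ P.IsId f) (_ :
    ¬ P.IsId tau) (hf : ¬ d.ideal c x f) (ht : ¬ d.ideal y z tau) (_ : ∀ ν : P.Hom c x, lam ⊚ ν ≠
    f) (_ : ∀ ν : P.Hom x c, f ⊚ ν ≠ lam) (_ : ∀ ν : P.Hom x c, f ⊚ ν ≠ lam ⊚ lam) (_ : ∀ ν :
    P.Hom y z, ν ⊚ rho ≠ tau) (_ : ∀ ν : P.Hom z y, ν ⊚ tau ≠ rho) (_ : ∀ ν : P.Hom z y, ν ⊚ tau ≠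
    rho ⊚ rho) : False := by
  obtain ⟨⟨_, _, _⟩, ⟨hl, hll, hr, hrr, hm, hml⟩, _, _, _⟩ := d.basic
  have := d.comp_right_ne_of_notMem hr mu
  have := d.comp_right_ne_of_notMem hrr mu
  have := d.comp_left_ne_of_notMem hl mu
  have := d.comp_left_ne_of_notMem hll mu
  refine false_of_isCleaving d.rep d.two (o := obj x y c z)
    (m := hom lam mu rho f tau) ⟨?_, ?_, ?_, ?_, fun _ => d.id_notMem _, ?_, ?_, ?_, ?_, ?_⟩
  · rintro _ _ ⟨⟩ <;> constructor
  · rintro _ ⟨⟩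
  · rintro _ _ ⟨⟩ ⟨⟩
  · rintro _ _ ⟨⟩ <;> assumption
  · rintro _ _ ⟨⟩ <;> assumption
  · rintro _ _ _ ⟨⟩ ⟨⟩ ⟨⟩ <;> first | rfl | assumption
  · rintro _ _ _ ⟨⟩ ⟨⟩ ⟨⟩ <;> first | rfl | assumption
  · rintro _ _ _ ⟨⟩ ⟨⟩ hne hE <;>
      first | exact absurd rfl hne | exact absurd (by constructor) hE | assumption
  · rintro _ _ _ ⟨⟩ ⟨⟩ hne hE <;>
      first | exact absurd rfl hne | exact absurd (by constructor) hE | assumption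

end ShG

namespace ShH

/-- the points of the diagram -/
@[reducible] def obj {P : RayCategory} (x y c z : P.Obj) : ShH → P.Obj
  | .c0 => c
  | .z0 => z
  | .x1 | .x2 => x
  | .y0 | .y1 | .y2 => y

/-- the morphisms of the diagram -/
@[reducible] def hom {P : RayCategory} {x y c z : P.Obj} (lam : P.Hom x x) (mu : P.Hom x y)
    (rho : P.Hom y y) (f : P.Hom y c) (tau : P.Hom y z) :
    ∀ b b', P.Hom (obj x y c z b) (obj x y c z b')
  | .y0, .c0 => f
  | .y0, .z0 => tau
  | .y0, .y1 => rho
  | .y1, .y2 => rho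
  | .x1, .x2 => lam
  | .x1, .y1 => mu
  | .x2, .y2 => mu
  | .y0, .y2 => rho ⊚ rho
  | .x1, .y2 => mu ⊚ lam
  | _, _ => P.zero _ _

theorem false {P : RayCategory} {x y c z : P.Obj} {lam : P.Hom x x} {mu : P.Hom x y} {rho :
    P.Hom y y} (d : Dumbbell P lam mu rho) (f : P.Hom y c) (tau : P.Hom y z) (_ : ¬ P.IsId f) (_ :
    ¬ P.IsId tau) (hg : ¬ d.ideal y c f) (ht : ¬ d.ideal y z tau) (_ : ∀ ν : P.Hom c z, ν ⊚ f ≠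
    tau) (_ : ∀ ν : P.Hom c y, ν ⊚ f ≠ rho) (_ : ∀ ν : P.Hom c y, ν ⊚ f ≠ rho ⊚ rho) (_ : ∀ ν :
    P.Hom z c, ν ⊚ tau ≠ f) (_ : ∀ ν : P.Hom z y, ν ⊚ tau ≠ rho) (_ : ∀ ν : P.Hom z y, ν ⊚ tau ≠
    rho ⊚ rho) (_ : ∀ ν : P.Hom y c, ν ⊚ rho ≠ f) (_ : ∀ ν : P.Hom y z, ν ⊚ rho ≠ tau) : False :=
    by
  obtain ⟨⟨_, _, _⟩, ⟨hl, hll, hr, hrr, hm, hml⟩, _, _, _⟩ := d.basic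
  have := d.comp_right_ne_of_notMem hr mu
  have := d.comp_right_ne_of_notMem hrr mu
  have := d.comp_left_ne_of_notMem hl mu
  refine false_of_isCleaving d.rep d.two (o := obj x y c z)
    (m := hom lam mu rho f tau) ⟨?_, ?_, ?_, ?_, fun _ => d.id_notMem _, ?_, ?_, ?_, ?_, ?_⟩
  · rintro _ _ ⟨⟩ <;> constructor
  · rintro _ ⟨⟩
  · rintro _ _ ⟨⟩ ⟨⟩
  · rintro _ _ ⟨⟩ <;> assumption
  · rintro _ _ ⟨⟩ <;> assumption
  · rintro _ _ _ ⟨⟩ ⟨⟩ ⟨⟩ <;> first | rfl | assumption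
  · rintro _ _ _ ⟨⟩ ⟨⟩ ⟨⟩ <;> first | rfl | assumption
  · rintro _ _ _ ⟨⟩ ⟨⟩ hne hE <;>
      first | exact absurd rfl hne | exact absurd (by constructor) hE | assumption
  · rintro _ _ _ ⟨⟩ ⟨⟩ hne hE <;>
      first | exact absurd rfl hne | exact absurd (by constructor) hE | assumption

end ShH

namespace ShI

/-- the points of the diagram -/
@[reducible] def obj {P : RayCategory} (x y z : P.Obj) : ShI → P.Obj
  | .x1 | .x2 | .x3 | .x4 => x
  | .y0 | .y1 | .y2 => y
  | .z0 => z

/-- the morphisms of the diagram -/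
@[reducible] def hom {P : RayCategory} {x y z : P.Obj} (lam : P.Hom x x) (mu : P.Hom x y) (rho
    : P.Hom y y) (tau : P.Hom y z) :
    ∀ b b', P.Hom (obj x y z b) (obj x y z b')
  | .x1, .x2 => lam
  | .x2, .x3 => lam
  | .x3, .x4 => lam
  | .x1, .y1 => mu
  | .x2, .y2 => mu
  | .y0, .y1 => rho
  | .y1, .y2 => rho
  | .y0, .z0 => tau
  | .x1, .x3 => lam ⊚ lam
  | .x1, .x4 => lam ⊚ lam ⊚ lam
  | .x2, .x4 => lam ⊚ lam
  | .x1, .y2 => mu ⊚ lam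
  | .y0, .y2 => rho ⊚ rho
  | _, _ => P.zero _ _

theorem false {P : RayCategory} {x y z : P.Obj} {lam : P.Hom x x} {mu : P.Hom x y} {rho :
    P.Hom y y} (d : Dumbbell P lam mu rho) (tau : P.Hom y z) (_ : ¬ P.IsId tau) (ht : ¬ d.ideal y
    z tau) (hlll : ¬ d.ideal x x (lam ⊚ lam ⊚ lam)) (_ : ∀ ν : P.Hom y z, ν ⊚ rho ≠ tau) (_ : ∀ ν
    : P.Hom z y, ν ⊚ tau ≠ rho) (_ : ∀ ν : P.Hom z y, ν ⊚ tau ≠ rho ⊚ rho) : False := by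
  obtain ⟨⟨_, _, _⟩, ⟨hl, hll, hr, hrr, hm, hml⟩, _, _, _⟩ := d.basic
  have := d.comp_right_ne_of_notMem hr mu
  have := d.comp_right_ne_of_notMem hrr mu
  have := d.comp_left_ne_of_notMem hl mu
  have := d.comp_left_ne_of_notMem hll mu
  have := d.comp_left_ne_of_notMem hlll mu
  refine false_of_isCleaving d.rep d.two (o := obj x y z)
    (m := hom lam mu rho tau) ⟨?_, ?_, ?_, ?_, fun _ => d.id_notMem _, ?_, ?_, ?_, ?_, ?_⟩
  · rintro _ _ ⟨⟩ <;> constructor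
  · rintro _ ⟨⟩
  · rintro _ _ ⟨⟩ ⟨⟩
  · rintro _ _ ⟨⟩ <;> assumption
  · rintro _ _ ⟨⟩ <;> assumption
  · rintro _ _ _ ⟨⟩ ⟨⟩ ⟨⟩ <;> first | rfl | assumption
  · rintro _ _ _ ⟨⟩ ⟨⟩ ⟨⟩ <;> first | rfl | assumption |
      (refine (P.assoc _ _ _).trans ?_; rfl)
  · rintro _ _ _ ⟨⟩ ⟨⟩ hne hE <;>
      first | exact absurd rfl hne | exact absurd (by constructor) hE | assumption
  · rintro _ _ _ ⟨⟩ ⟨⟩ hne hE <;>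
      first | exact absurd rfl hne | exact absurd (by constructor) hE | assumption

end ShI

namespace ShJ

/-- the points of the diagram -/
@[reducible] def obj {P : RayCategory} (x y z : P.Obj) : ShJ → P.Obj
  | .x2 | .x3 | .x4 => x
  | .y0 | .y1 | .y2 | .y3 => y
  | .z0 | .z1 => z

/-- the morphisms of the diagram -/
@[reducible] def hom {P : RayCategory} {x y z : P.Obj} (lam : P.Hom x x) (mu : P.Hom x y) (rho
    : P.Hom y y) (tau : P.Hom y z) :
    ∀ b b', P.Hom (obj x y z b) (obj x y z b')
  | .x2, .x3 => lam
  | .x3, .x4 => lam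
  | .x2, .y2 => mu
  | .x3, .y3 => mu
  | .y0, .y1 => rho
  | .y1, .y2 => rho
  | .y2, .y3 => rho
  | .y0, .z0 => tau
  | .y1, .z1 => tau
  | .x2, .x4 => lam ⊚ lam
  | .x2, .y3 => mu ⊚ lam
  | .y0, .y2 => rho ⊚ rho
  | .y0, .y3 => rho ⊚ rho ⊚ rho
  | .y1, .y3 => rho ⊚ rho
  | _, _ => P.zero _ _

theorem false {P : RayCategory} {x y z : P.Obj} {lam : P.Hom x x} {mu : P.Hom x y} {rho :
    P.Hom y y} (d : Dumbbell P lam mu rho) (tau : P.Hom y z) (_ : ¬ P.IsId tau) (ht : ¬ d.ideal y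
    z tau) (hrrr : ¬ d.ideal y y (rho ⊚ rho ⊚ rho)) (_ : ∀ ν : P.Hom y z, ν ⊚ rho ≠ tau) (_ : ∀ ν
    : P.Hom z y, ν ⊚ tau ≠ rho) (_ : ∀ ν : P.Hom z y, ν ⊚ tau ≠ rho ⊚ rho) (_ : ∀ ν : P.Hom z y, ν
    ⊚ tau ≠ rho ⊚ rho ⊚ rho) : False := by
  obtain ⟨⟨_, _, _⟩, ⟨hl, hll, hr, hrr, hm, hml⟩, _, _, _⟩ := d.basic
  have := d.comp_right_ne_of_notMem hr mu
  have := d.comp_right_ne_of_notMem hrr mu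
  have := d.comp_right_ne_of_notMem hrrr mu
  have := d.comp_left_ne_of_notMem hl mu
  have := d.comp_left_ne_of_notMem hll mu
  refine false_of_isCleaving d.rep d.two (o := obj x y z)
    (m := hom lam mu rho tau) ⟨?_, ?_, ?_, ?_, fun _ => d.id_notMem _, ?_, ?_, ?_, ?_, ?_⟩
  · rintro _ _ ⟨⟩ <;> constructor
  · rintro _ ⟨⟩
  · rintro _ _ ⟨⟩ ⟨⟩
  · rintro _ _ ⟨⟩ <;> assumption
  · rintro _ _ ⟨⟩ <;> assumption
  · rintro _ _ _ ⟨⟩ ⟨⟩ ⟨⟩ <;> first | rfl | assumption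
  · rintro _ _ _ ⟨⟩ ⟨⟩ ⟨⟩ <;> first | rfl | assumption |
      (refine (P.assoc _ _ _).trans ?_; rfl)
  · rintro _ _ _ ⟨⟩ ⟨⟩ hne hE <;>
      first | exact absurd rfl hne | exact absurd (by constructor) hE | assumption
  · rintro _ _ _ ⟨⟩ ⟨⟩ hne hE <;>
      first | exact absurd rfl hne | exact absurd (by constructor) hE | assumption

end ShJ

namespace ShK

/-- the points of the diagram -/
@[reducible] def obj {P : RayCategory} (x y c z : P.Obj) : ShK → P.Obj
  | .c1 => c
  | .x1 | .x2 | .x3 => x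
  | .y0 | .y1 | .y2 => y
  | .z0 | .z1 => z

/-- the morphisms of the diagram -/
@[reducible] def hom {P : RayCategory} {x y c z : P.Obj} (lam : P.Hom x x) (mu : P.Hom x y)
    (rho : P.Hom y y) (tau : P.Hom y z) (om : P.Hom c z) :
    ∀ b b', P.Hom (obj x y c z b) (obj x y c z b')
  | .x1, .x2 => lam
  | .x2, .x3 => lam
  | .x1, .y1 => mu
  | .x2, .y2 => mu
  | .y0, .y1 => rho
  | .y1, .y2 => rho
  | .y0, .z0 => tau
  | .y1, .z1 => tau
  | .c1, .z1 => om
  | .x1, .x3 => lam ⊚ lam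
  | .x1, .y2 => mu ⊚ lam
  | .x1, .z1 => tau ⊚ mu
  | .y0, .y2 => rho ⊚ rho
  | _, _ => P.zero _ _

theorem false {P : RayCategory} {x y c z : P.Obj} {lam : P.Hom x x} {mu : P.Hom x y} {rho :
    P.Hom y y} (d : Dumbbell P lam mu rho) (tau : P.Hom y z) (om : P.Hom c z) (_ : ¬ P.IsId tau)
    (_ : ¬ P.IsId om) (ht : ¬ d.ideal y z tau) (hw : ¬ d.ideal c z om) (htm : ¬ d.ideal x z (tau ⊚
    mu)) (_ : ∀ ν : P.Hom c y, tau ⊚ ν ≠ om) (_ : ∀ ν : P.Hom y c, om ⊚ ν ≠ tau) (_ : ∀ ν : P.Hom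
    x c, om ⊚ ν ≠ tau ⊚ mu) (_ : ∀ ν : P.Hom x z, ν ⊚ lam ≠ tau ⊚ mu) (_ : ∀ ν : P.Hom y z, ν ⊚
    rho ≠ tau) (_ : ∀ ν : P.Hom z y, ν ⊚ tau ≠ rho) (_ : ∀ ν : P.Hom z y, ν ⊚ tau ≠ rho ⊚ rho) :
    False := by
  obtain ⟨⟨_, _, _⟩, ⟨hl, hll, hr, hrr, hm, hml⟩, _, _, _⟩ := d.basic
  have := d.comp_right_ne_of_notMem hr mu
  have := d.comp_right_ne_of_notMem hrr mu
  have := d.comp_left_ne_of_notMem hl mu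
  have := d.comp_left_ne_of_notMem hll mu
  refine false_of_isCleaving d.rep d.two (o := obj x y c z)
    (m := hom lam mu rho tau om) ⟨?_, ?_, ?_, ?_, fun _ => d.id_notMem _, ?_, ?_, ?_, ?_, ?_⟩
  · rintro _ _ ⟨⟩ <;> constructor
  · rintro _ ⟨⟩
  · rintro _ _ ⟨⟩ ⟨⟩
  · rintro _ _ ⟨⟩ <;> assumption
  · rintro _ _ ⟨⟩ <;> assumption
  · rintro _ _ _ ⟨⟩ ⟨⟩ ⟨⟩ <;> first | rfl | assumption
  · rintro _ _ _ ⟨⟩ ⟨⟩ ⟨⟩ <;> first | rfl | assumption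
  · rintro _ _ _ ⟨⟩ ⟨⟩ hne hE <;>
      first | exact absurd rfl hne | exact absurd (by constructor) hE | assumption
  · rintro _ _ _ ⟨⟩ ⟨⟩ hne hE <;>
      first | exact absurd rfl hne | exact absurd (by constructor) hE | assumption

end ShK

namespace ShL

/-- the points of the diagram -/
@[reducible] def obj {P : RayCategory} (x y c z : P.Obj) : ShL → P.Obj
  | .c0 => c
  | .x1 | .x2 | .x3 => x
  | .y0 | .y1 | .y2 => y
  | .z0 | .z1 => z

/-- the morphisms of the diagram -/
@[reducible] def hom {P : RayCategory} {x y c z : P.Obj} (lam : P.Hom x x) (mu : P.Hom x y)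
    (rho : P.Hom y y) (tau : P.Hom y z) (ze : P.Hom z c) :
    ∀ b b', P.Hom (obj x y c z b) (obj x y c z b')
  | .x1, .x2 => lam
  | .x2, .x3 => lam
  | .x1, .y1 => mu
  | .x2, .y2 => mu
  | .y0, .y1 => rho
  | .y1, .y2 => rho
  | .y0, .z0 => tau
  | .y1, .z1 => tau
  | .z0, .c0 => ze
  | .x1, .x3 => lam ⊚ lam
  | .x1, .y2 => mu ⊚ lam
  | .x1, .z1 => tau ⊚ mu
  | .y0, .y2 => rho ⊚ rho
  | .y0, .c0 => ze ⊚ tau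
  | _, _ => P.zero _ _

theorem false {P : RayCategory} {x y c z : P.Obj} {lam : P.Hom x x} {mu : P.Hom x y} {rho :
    P.Hom y y} (d : Dumbbell P lam mu rho) (tau : P.Hom y z) (ze : P.Hom z c) (_ : ¬ P.IsId tau)
    (_ : ¬ P.IsId ze) (ht : ¬ d.ideal y z tau) (hv : ¬ d.ideal z c ze) (htm : ¬ d.ideal x z (tau ⊚
    mu)) (hvt : ¬ d.ideal y c (ze ⊚ tau)) (_ : ∀ ν : P.Hom x z, ν ⊚ lam ≠ tau ⊚ mu) (_ : ∀ ν :
    P.Hom y z, ν ⊚ rho ≠ tau) (_ : ∀ ν : P.Hom y c, ν ⊚ rho ≠ ze ⊚ tau) (_ : ∀ ν : P.Hom z y, ν ⊚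
    tau ≠ rho) (_ : ∀ ν : P.Hom z y, ν ⊚ tau ≠ rho ⊚ rho) : False := by
  obtain ⟨⟨_, _, _⟩, ⟨hl, hll, hr, hrr, hm, hml⟩, _, _, _⟩ := d.basic
  have := d.comp_right_ne_of_notMem hr mu
  have := d.comp_right_ne_of_notMem hrr mu
  have := d.comp_left_ne_of_notMem hl mu
  have := d.comp_left_ne_of_notMem hll mu
  refine false_of_isCleaving d.rep d.two (o := obj x y c z)
    (m := hom lam mu rho tau ze) ⟨?_, ?_, ?_, ?_, fun _ => d.id_notMem _, ?_, ?_, ?_, ?_, ?_⟩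
  · rintro _ _ ⟨⟩ <;> constructor
  · rintro _ ⟨⟩
  · rintro _ _ ⟨⟩ ⟨⟩
  · rintro _ _ ⟨⟩ <;> assumption
  · rintro _ _ ⟨⟩ <;> assumption
  · rintro _ _ _ ⟨⟩ ⟨⟩ ⟨⟩ <;> first | rfl | assumption
  · rintro _ _ _ ⟨⟩ ⟨⟩ ⟨⟩ <;> first | rfl | assumption
  · rintro _ _ _ ⟨⟩ ⟨⟩ hne hE <;>
      first | exact absurd rfl hne | exact absurd (by constructor) hE | assumption
  · rintro _ _ _ ⟨⟩ ⟨⟩ hne hE <;>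
      first | exact absurd rfl hne | exact absurd (by constructor) hE | assumption

end ShL

namespace Dumbbell

variable {P : RayCategory} {x y : P.Obj} {lam : P.Hom x x} {mu : P.Hom x y} {rho : P.Hom y y}
variable (d : Dumbbell P lam mu rho)
include d

lemma notMem_left {a b c : P.Obj} {g : P.Hom b c} {f : P.Hom a b} (h : ¬ d.ideal a c (g ⊚ f)) :
    ¬ d.ideal b c g := fun h' => h (d.two.right g f h')

lemma notMem_right {a b c : P.Obj} {g : P.Hom b c} {f : P.Hom a b} (h : ¬ d.ideal a c (g ⊚ f)) :
    ¬ d.ideal a b f := fun h' => h (d.two.left g f h')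

lemma eq_mu_of_rho_comp {ν : P.Hom x y} (h : rho ⊚ ν = mu ⊚ lam) : ν = mu := by
  refine cancel_left (g := rho) (h.trans d.comm) ?_
  rw [h]
  exact d.comm_ne_zero

lemma eq_lam_of_mu_comp {ν : P.Hom x x} (h : mu ⊚ ν = mu ⊚ lam) : ν = lam :=
  cancel_left h (h ▸ d.comm_ne_zero)

lemma eq_lam_of_lam_comp {ν : P.Hom x x} (h : lam ⊚ ν = lam ⊚ lam) : ν = lam :=
  cancel_left h (h ▸ d.lam_lam_ne_zero)

lemma eq_rho_of_comp_mu {ν : P.Hom y y} (h : ν ⊚ mu = rho ⊚ mu) : ν = rho :=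
  cancel_right h (by rw [h, ← d.comm]; exact d.comm_ne_zero)

lemma eq_mu_of_comp_lam {ν : P.Hom x y} (h : ν ⊚ lam = mu ⊚ lam) : ν = mu :=
  cancel_right h (h ▸ d.comm_ne_zero)

variable {c : P.Obj} (hx : x ≠ c) (hy : y ≠ c)

include hx hy in
lemma not_factor_both {φ : P.Hom x c} {κ : P.Hom c x} {η : P.Hom c y} (h1 : κ ⊚ φ = lam)
    (h2 : η ⊚ φ = mu) : False := by
  obtain ⟨⟨_, _, nr⟩, ⟨hl, hll, hr, hrr, hm, hml⟩, _, _, _⟩ := d.basic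
  have k1 : ∀ {w} (f : P.Hom w x), κ ⊚ φ ⊚ f = lam ⊚ f := fun f => by rw [← P.assoc, h1]
  have k2 : ∀ {w} (f : P.Hom w x), η ⊚ φ ⊚ f = mu ⊚ f := fun f => by rw [← P.assoc, h2]
  have k3 : ∀ {w} (ν : P.Hom y c) (f : P.Hom w y), κ ⊚ ν ⊚ f = P.zero w x := fun ν f => by
    rw [← P.assoc, d.hom_zero (κ ⊚ ν), P.zero_comp]
  have e1 : mu ⊚ κ = rho ⊚ η := by
    refine cancel_right (f := φ) ?_ ?_
    · rw [P.assoc, h1, P.assoc, h2, d.comm]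
    · rw [P.assoc, h1]
      exact d.comm_ne_zero
  have e1' : ∀ {w} (f : P.Hom w c), mu ⊚ κ ⊚ f = rho ⊚ η ⊚ f := fun f => by
    rw [← P.assoc, e1, P.assoc]
  have e2 : ∀ ν : P.Hom y c, η ⊚ ν ≠ rho := by
    intro ν h
    have h3 : ν ⊚ mu = φ ⊚ lam := by
      refine cancel_left (g := η) ?_ ?_
      · rw [← P.assoc, h, ← P.assoc, h2, d.comm]
      · rw [← P.assoc, h, ← d.comm]
        exact d.comm_ne_zero
    refine d.lam_lam_ne_zero ?_
    rw [← k1, ← h3, k3]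
  have hpk : ¬ d.ideal c c (φ ⊚ κ) := by
    refine d.notMem_left (f := φ) (d.notMem_right (g := κ) ?_)
    rw [P.assoc, h1, k1]
    exact hll
  have hlk : ¬ d.ideal c x (lam ⊚ κ) := d.notMem_left (f := φ) (by rwa [P.assoc, h1])
  have hh : ¬ d.ideal c y η := d.notMem_left (f := φ) (by rwa [h2])
  have e3 : ∀ ν : P.Hom c y, rho ⊚ ν ≠ η := fun ν h =>
    d.rho_comp_ne (ν ⊚ φ) (by rw [← P.assoc, h, h2])
  have e4 : ∀ (ν : P.Hom y c) (f : P.Hom c y), ν ⊚ f ≠ φ ⊚ κ := by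
    intro ν f h
    apply d.two.ne_zero hlk
    rw [← k1, ← h, k3]
  by_cases hrr' : ∃ ν : P.Hom y c, η ⊚ ν = rho ⊚ rho
  · obtain ⟨ν, hν⟩ := hrr'
    have e5 : ν ⊚ η = φ ⊚ κ ⊚ φ ⊚ κ := by
      refine cancel_left (g := η) ?_ ?_
      · rw [k2, e1', k2, e1, ← P.assoc, hν, P.assoc]
      · refine left_ne_zero (f := φ) ?_
        rw [P.assoc, P.assoc, h2, ← P.assoc, hν, P.assoc, d.comm2]
        exact d.ne_zero
    refine Crown.false d (φ ⊚ κ) ν η rho (fun h => ?_) (not_isId_of_ne hy _)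
      (not_isId_of_ne hy.symm _) nr hpk (fun h => ?_) hh hr (fun g h => ?_) (fun g h => ?_)
      (fun g => e4 g η) (fun g h => ?_) (fun f h => ?_) e2 (e4 ν) e3
    · exact hx.symm (isId_of_comp_eq_id (isId_iff.1 h)).1.1
    · rw [d.mem_y h, P.comp_zero] at hν
      exact d.rho_rho_ne_zero hν.symm
    · refine d.comp_lam_ne (g ⊚ φ) ?_
      rw [← h2, ← h, P.assoc, P.assoc, P.assoc, h1]
    · refine d.comp_lam_ne (g ⊚ φ) (d.eq_mu_of_comp_lam ?_)
      have h3 : g ⊚ ν ⊚ mu = mu ⊚ lam := by rw [← P.assoc, h, d.comm]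
      rw [← h3, ← h2, ← P.assoc ν, e5]
      simp only [P.assoc, h1]
      rw [k1]
    · refine e2 g (cancel_right (f := rho) ?_ ?_)
      · rw [P.assoc, h, hν]
      · rw [P.assoc, h, hν]
        exact d.rho_rho_ne_zero
    · rw [P.assoc, d.hom_zero (κ ⊚ f), P.comp_zero] at h
      rw [← h, P.comp_zero] at hν
      exact d.rho_rho_ne_zero hν.symm
  · push Not at hrr'
    refine ShA.false d η κ φ (not_isId_of_ne hy.symm _) (not_isId_of_ne hx.symm _)
      (not_isId_of_ne hx _) (d.notMem_right (g := κ) (by rwa [h1]))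
      (d.notMem_left (f := φ) (by rwa [h1])) hh (d.notMem_right (g := κ) (by rwa [k1])) hpk hlk
      (d.notMem_left (f := φ) ?_) h1 h2 (by rw [h1]) (by rw [h1]) (by rw [h2, d.comm]) e1 (k1 _)
      (k1 _) (k2 _) (by rw [k2, e1]) e2 hrr' e3 (fun ν h => ?_) (fun ν => e4 ν η)
    · rwa [P.assoc, h2, ← d.comm]
    · exact d.comp_lam_ne ν (by rw [← h1, ← P.assoc, h, h2])

include hx hy in
lemma comp_ne_lam (κ : P.Hom c x) (φ : P.Hom x c) : κ ⊚ φ ≠ lam := by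
  intro h1
  obtain ⟨_, ⟨hl, hll, hr, hrr, hm, hml⟩, _, _, _⟩ := d.basic
  have k1 : ∀ {w} (f : P.Hom w x), κ ⊚ φ ⊚ f = lam ⊚ f := fun f => by rw [← P.assoc, h1]
  have k3 : ∀ {w} (ν : P.Hom y c) (f : P.Hom w y), κ ⊚ ν ⊚ f = P.zero w x := fun ν f => by
    rw [← P.assoc, d.hom_zero (κ ⊚ ν), P.zero_comp]
  have hB : ∀ η : P.Hom c y, η ⊚ φ ≠ mu := fun η h => d.not_factor_both hx hy h1 h
  refine ShB.false d κ φ (not_isId_of_ne hx.symm _) (not_isId_of_ne hx _)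
    (d.notMem_right (g := κ) (by rwa [h1])) (d.notMem_left (f := φ) (by rwa [h1]))
    (d.notMem_right (g := κ) (by rwa [k1])) (d.notMem_left (f := φ) (d.notMem_right (g := κ) ?_))
    (d.notMem_left (f := φ) (by rwa [P.assoc, h1])) (d.notMem_left (f := φ) (by rwa [P.assoc, h1]))
    h1 (by rw [h1]) (by rw [h1]) (by rw [h1]) (k1 _) (k1 _) (fun ν h => ?_) hB (fun ν h => ?_)
    (fun ν h => ?_)
  · rwa [P.assoc, h1, k1]
  · refine hB ν (d.eq_mu_of_rho_comp ?_)
    rw [← P.assoc, h, P.assoc, h1]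
  · exact d.lam_ne_zero (by rw [← h1, ← h, k3])
  · exact d.lam_lam_ne_zero (by rw [← k1, ← h, k3])

include hx hy in
lemma comp_ne_rho (η : P.Hom c y) (ν : P.Hom y c) : η ⊚ ν ≠ rho :=
  d.op.comp_ne_lam (c := c) hy hx ν η

include hx hy in
lemma not_factor_lam_lam {φ : P.Hom x c} {κ : P.Hom c x} {η : P.Hom c y} (h1 : κ ⊚ φ = lam ⊚ lam)
    (h2 : η ⊚ φ = mu) : False := by
  obtain ⟨⟨nl, nm, nr⟩, ⟨hl, hll, hr, hrr, hm, hml⟩, _, _, _⟩ := d.basic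
  have hk : ¬ d.ideal c x κ := d.notMem_left (f := φ) (by rwa [h1])
  have e1 : (rho ⊚ η) ⊚ φ = mu ⊚ lam := by rw [P.assoc, h2, d.comm]
  refine Crown.false d κ lam (rho ⊚ η) mu (not_isId_of_ne hx.symm _) nl (not_isId_of_ne hy.symm _)
    nm hk hl (d.notMem_left (f := φ) (by rwa [e1])) hm (fun g h => ?_) d.comp_lam_ne
    (d.comp_left_ne_of_notMem hk _) (d.comp_left_ne_of_notMem hl _) (d.comp_ne_lam hx hy κ)
    (fun f h => ?_) (fun f h => ?_) (fun f h => ?_)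
  · refine d.comp_lam_ne g (d.eq_mu_of_comp_lam ?_)
    rw [P.assoc, ← h1, ← P.assoc, h, e1]
  · exact d.rho_comp_ne (η ⊚ f) (by rw [← P.assoc, h])
  · refine d.comp_ne_lam hx hy f φ (d.eq_lam_of_lam_comp ?_)
    rw [← P.assoc, h, h1]
  · refine d.comp_ne_lam hx hy f φ (d.eq_lam_of_mu_comp ?_)
    rw [← P.assoc, h, e1]

include hx hy in
lemma not_factor_rho_rho {φ : P.Hom x c} {ν : P.Hom y c} {η : P.Hom c y} (h1 : η ⊚ ν = rho ⊚ rho)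
    (h2 : η ⊚ φ = mu) : False :=
  d.op.not_factor_lam_lam (c := c) hy hx (φ := η) (κ := ν) (η := φ) h1 h2

include hx hy in
lemma comp_ne_mu (η : P.Hom c y) (φ : P.Hom x c) : η ⊚ φ ≠ mu := by
  intro h2
  obtain ⟨⟨nl, nm, nr⟩, ⟨hl, hll, hr, hrr, hm, hml⟩, _, _, _⟩ := d.basic
  have k2 : ∀ {w} (f : P.Hom w x), η ⊚ φ ⊚ f = mu ⊚ f := fun f => by rw [← P.assoc, h2]
  by_cases hσ : ∃ σ : P.Hom c c, σ ⊚ φ = φ ⊚ lam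
  · obtain ⟨σ, hσ⟩ := hσ
    have e1 : η ⊚ σ = rho ⊚ η := by
      refine cancel_right (f := φ) ?_ ?_
      · rw [P.assoc, hσ, k2, P.assoc, h2, d.comm]
      · rw [P.assoc, hσ, k2]
        exact d.comm_ne_zero
    have e2 : (σ ⊚ σ) ⊚ φ = (φ ⊚ lam) ⊚ lam := by rw [P.assoc, hσ, ← P.assoc, hσ]
    have z1 : η ⊚ (σ ⊚ σ) ⊚ φ ≠ P.zero x y := by
      rw [e2, P.assoc, k2]
      exact d.ne_zero
    have z2 : σ ⊚ σ ≠ P.zero c c := left_ne_zero (right_ne_zero z1)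
    have e3 : (η ⊚ σ) ⊚ φ = mu ⊚ lam := by rw [P.assoc, hσ, k2]
    refine Crown.false d (σ ⊚ σ) (σ ⊚ φ) (η ⊚ σ) mu (fun h => ?_) (not_isId_of_ne hx _)
      (not_isId_of_ne hy.symm _) nm (fun h => ?_)
      (d.notMem_right (g := η) (by rwa [← P.assoc, e3])) (d.notMem_left (f := φ) (by rwa [e3])) hm
      (fun g h => ?_) (fun g h => ?_) (fun g h => ?_) (fun g h => ?_) (fun f h => ?_)
      (fun f h => ?_) (fun f h => ?_) (fun f h => ?_)
    · rw [eq_id_left (isId_iff.1 h), P.id_comp] at hσ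
      exact d.lam_ne_id (eq_id_of_comp_eq_self hσ.symm (right_ne_zero (h2 ▸ d.mu_ne_zero)))
    · obtain ⟨g, hg⟩ := d.mem_right (d.two.right _ φ h)
      have e4 : φ = g ⊚ mu := by
        refine cancel_right (f := lam ⊚ lam) ?_ ?_
        · rw [← P.assoc, ← e2, hg, P.assoc]
        · rw [← P.assoc, ← e2]
          exact right_ne_zero z1
      rw [e4, ← P.assoc] at h2
      exact hy.symm (isId_of_comp_eq_id (eq_id_of_self_comp_eq h2 d.mu_ne_zero)).2.1
    · refine d.comp_lam_ne (g ⊚ φ) ?_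
      rw [← P.assoc] at h
      have e4 : g ⊚ σ = η := by
        refine cancel_right h ?_
        rw [h]
        exact left_ne_zero (e3 ▸ d.comm_ne_zero)
      rw [P.assoc, ← hσ, ← P.assoc, e4, h2]
    · exact d.comp_lam_ne (g ⊚ φ) (by rw [P.assoc, ← hσ, h])
    · rw [← P.assoc] at h
      have e4 : g ⊚ η = σ := cancel_right h (h ▸ z2)
      refine d.comp_ne_rho hx hy η g (cancel_right (f := η) ?_ ?_)
      · rw [P.assoc, e4, e1]
      · rw [P.assoc, e4]
        exact left_ne_zero (e3 ▸ d.comm_ne_zero)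
    · refine d.comp_ne_rho hx hy η g (d.eq_rho_of_comp_mu ?_)
      rw [P.assoc, h, ← P.assoc, e3, d.comm]
    · rw [P.assoc] at h
      have e4 : σ ⊚ f = φ := by
        refine cancel_left h ?_
        rw [h]
        exact right_ne_zero (g := η) (by rw [← P.assoc, e3]; exact d.comm_ne_zero)
      exact d.rho_comp_ne (η ⊚ f) (by rw [← P.assoc, ← e1, P.assoc, e4, h2])
    · exact d.rho_comp_ne (η ⊚ f) (by rw [← P.assoc, ← e1, h])
    · rw [P.assoc] at h
      have e4 : φ ⊚ f = σ := cancel_left h (h ▸ z2)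
      refine d.comp_ne_lam hx hy f φ (cancel_left (g := φ) ?_ ?_)
      · rw [← P.assoc, e4, hσ]
      · rw [← P.assoc, e4]
        exact right_ne_zero (g := η) (by rw [← P.assoc, e3]; exact d.comm_ne_zero)
    · refine d.comp_ne_lam hx hy f φ (d.eq_lam_of_mu_comp ?_)
      rw [← P.assoc, h, e3]
  · push Not at hσ
    refine ShC.false d η φ (not_isId_of_ne hy.symm _) (not_isId_of_ne hx _)
      (d.notMem_left (f := φ) (by rwa [h2])) (d.notMem_right (g := η) (by rwa [h2]))
      (d.notMem_left (f := φ) (by rwa [P.assoc, h2, ← d.comm]))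
      (d.notMem_right (g := η) (by rwa [k2])) h2 (d.comp_ne_rho hx hy η) (fun ν h => ?_)
      (fun ν h => ?_) (fun ν h => d.not_factor_rho_rho hx hy h h2) (fun ν h => ?_)
      (fun ν => d.comp_ne_lam hx hy ν φ) (fun ν h => d.not_factor_lam_lam hx hy h h2) hσ
    · exact d.rho_comp_ne (ν ⊚ φ) (by rw [← P.assoc, h, h2])
    · refine hσ ν (cancel_left (g := η) ?_ ?_)
      · rw [k2, ← P.assoc, h, P.assoc, h2, d.comm]
      · rw [← P.assoc, h, P.assoc, h2, ← d.comm]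
        exact d.comm_ne_zero
    · exact d.comp_lam_ne (η ⊚ ν) (by rw [P.assoc, h, h2])

include hx hy in
/-- Every morphism from `x` to a third point factors through `μ`. -/
lemma exists_eq_comp_mu (f : P.Hom x c) : ∃ g : P.Hom y c, f = g ⊚ mu := by
  by_cases hf : f = P.zero x c
  · exact ⟨P.zero y c, by rw [hf, P.zero_comp]⟩
  obtain ⟨i, φ, rfl, h1⟩ := exists_eq_comp_pow d.nilp_left hf
  by_cases h2 : ∃ g : P.Hom y c, g ⊚ mu = φ
  · obtain ⟨g, rfl⟩ := h2
    exact ⟨g ⊚ P.pow rho i, by rw [P.assoc, P.assoc, d.comm_pow]⟩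
  exfalso
  push Not at h2
  have hp : ¬ d.ideal x c φ := by
    intro h
    obtain ⟨g, hg⟩ := d.mem_right h
    exact h1 (g ⊚ mu ⊚ lam) (by rw [hg]; simp only [P.assoc])
  by_cases h3 : ∃ η : P.Hom c y, η ⊚ φ = mu ⊚ lam
  · obtain ⟨η, h3⟩ := h3
    refine ShD.false d η φ (not_isId_of_ne hy.symm _) (not_isId_of_ne hx _) hp
      (d.notMem_left (f := φ) (h3 ▸ d.mu_lam_notMem)) (fun ν h => ?_) (fun ν h => ?_)
      (d.comp_ne_mu hx hy η) (d.comp_ne_rho hx hy η) h1 (fun ν => d.comp_ne_lam hx hy ν φ)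
      (fun ν => d.comp_ne_mu hx hy ν φ) h2
    · refine d.comp_ne_lam hx hy ν φ (d.eq_lam_of_mu_comp ?_)
      rw [← P.assoc, h, h3]
    · refine d.comp_ne_mu hx hy ν φ (d.eq_mu_of_rho_comp ?_)
      rw [← P.assoc, h, h3]
  push Not at h3
  by_cases h4 : ∃ κ : P.Hom c x, κ ⊚ φ = lam ⊚ lam
  · obtain ⟨κ, h4⟩ := h4
    have z1 : (mu ⊚ κ) ⊚ φ ≠ P.zero x y := by
      rw [P.assoc, h4]
      exact d.ne_zero
    refine ShE.false d κ φ (not_isId_of_ne hx.symm _) (not_isId_of_ne hx _) hp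
      (d.notMem_left (f := φ) (h4 ▸ d.basic.2.1.2.1)) (fun h => ?_) (fun ν h => ?_)
      (d.comp_ne_lam hx hy κ) (fun ν h => ?_) h1 (fun ν => d.comp_ne_lam hx hy ν φ)
      (fun ν => d.comp_ne_mu hx hy ν φ) h3 h2
    · obtain ⟨g, hg⟩ := d.mem_left h
      have e1 : κ = lam ⊚ lam ⊚ g := by
        refine cancel_left (g := mu) ?_ (left_ne_zero z1)
        rw [hg, ← P.assoc mu, d.comm, P.assoc, ← P.assoc mu, d.comm, P.assoc]
      rw [e1, P.assoc, P.assoc] at h4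
      have e2 := d.eq_lam_of_lam_comp h4
      have e3 : g ⊚ φ = P.id x := eq_id_of_comp_eq_self e2 d.lam_ne_zero
      exact hx (isId_of_comp_eq_id e3).1.1
    · refine d.comp_ne_lam hx hy ν φ (d.eq_lam_of_lam_comp ?_)
      rw [← P.assoc, h, h4]
    · refine h3 ν (cancel_left (g := rho) ?_ ?_)
      · rw [← P.assoc, h, P.assoc, h4, ← P.assoc, ← P.assoc, d.comm]
      · rw [← P.assoc, h]
        exact z1
  push Not at h4
  exact ShF.false d φ (not_isId_of_ne hx _) hp h1 h2 (fun ν => d.comp_ne_lam hx hy ν φ)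
    (fun ν => d.comp_ne_mu hx hy ν φ) h4 h3

include hx hy in
/-- Every morphism from a third point to `y` factors through `μ`. -/
lemma exists_eq_mu_comp (f : P.Hom c y) : ∃ g : P.Hom c x, f = mu ⊚ g :=
  d.op.exists_eq_comp_mu (c := c) hy hx f

include hx hy in
lemma endo_through_eq_zero (ν : P.Hom c y) (g : P.Hom y c) : ν ⊚ g = P.zero y y := by
  obtain ⟨h, rfl⟩ := d.exists_eq_mu_comp hx hy ν
  rw [P.assoc, d.hom_zero (h ⊚ g), P.comp_zero]

end Dumbbell

namespace RayCategory

variable {P : RayCategory}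

lemma heq_comp_of_isId {a b c : P.Obj} {g : P.Hom b c} (hg : P.IsId g) (f : P.Hom a b) :
    HEq (g ⊚ f) f := by
  obtain ⟨rfl, hg⟩ := hg
  rw [eq_of_heq hg, P.id_comp]

lemma IsIrreducible.pow_eq {a : P.Obj} {f : P.Hom a a} (hf : f ≠ P.id a) {i : ℕ}
    (h : P.IsIrreducible (P.pow f i)) : P.pow f i = f := by
  cases i with
  | zero => exact absurd (isId_iff.2 rfl) h.2.1
  | succ n =>
    obtain h1 | h1 := h.2.2 a f (P.pow f n) rfl
    · exact absurd (isId_iff.1 h1) hf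
    · rw [pow, isId_iff.1 h1, P.comp_id]

lemma IsIrreducible.heq_of_comp_eq {a b c : P.Obj} {f : P.Hom a b} (hf : P.IsIrreducible f)
    (hc : a ≠ c) {g : P.Hom a c} {ν : P.Hom c b} (h : ν ⊚ g = f) : HEq g f := by
  obtain h1 | h1 := hf.2.2 c ν g h.symm
  · exact h ▸ (heq_comp_of_isId h1 g).symm
  · exact absurd h1 (not_isId_of_ne hc _)

end RayCategory

namespace Dumbbell

variable {P : RayCategory} {x y : P.Obj} {lam : P.Hom x x} {mu : P.Hom x y} {rho : P.Hom y y}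
variable (d : Dumbbell P lam mu rho)
include d

lemma eq_lam_of_irreducible {f : P.Hom x x} (hf : P.IsIrreducible f) : f = lam := by
  obtain ⟨i, rfl⟩ := d.endo_left f
  exact hf.pow_eq d.lam_ne_id

lemma eq_rho_of_irreducible {f : P.Hom y y} (hf : P.IsIrreducible f) : f = rho := by
  obtain ⟨i, rfl⟩ := d.endo_right f
  exact hf.pow_eq d.rho_ne_id

lemma eq_mu_of_irreducible {f : P.Hom x y} (hf : P.IsIrreducible f) : f = mu := by
  obtain ⟨g, rfl⟩ := d.hom_y f
  obtain h | h := hf.2.2 y g mu rfl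
  · rw [isId_iff.1 h, P.id_comp]
  · exact absurd h (not_isId_of_ne d.ne _)

lemma not_irreducible_of_ne {c : P.Obj} (hx : x ≠ c) (hy : y ≠ c) (f : P.Hom x c) :
    ¬ P.IsIrreducible f := by
  intro hf
  obtain ⟨g, rfl⟩ := d.exists_eq_comp_mu hx hy f
  obtain h | h := hf.2.2 y g mu rfl
  · exact not_isId_of_ne hy _ h
  · exact not_isId_of_ne d.ne _ h

lemma heq_of_irreducible_from_left (c : P.Obj) (f : P.Hom x c) (hf : P.IsIrreducible f) :
    HEq f lam ∨ HEq f mu := by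
  by_cases hx : x = c
  · subst hx
    exact Or.inl (heq_of_eq (d.eq_lam_of_irreducible hf))
  by_cases hy : y = c
  · subst hy
    exact Or.inr (heq_of_eq (d.eq_mu_of_irreducible hf))
  exact absurd hf (d.not_irreducible_of_ne hx hy f)

lemma comp_rho_ne_of_irreducible {c : P.Obj} {f : P.Hom y c} (hf : P.IsIrreducible f)
    (hc : y ≠ c) (ν : P.Hom y c) : ν ⊚ rho ≠ f := by
  intro h
  obtain h | h := hf.2.2 y ν rho h.symm
  · exact not_isId_of_ne hc _ h
  · exact d.rho_ne_id (isId_iff.1 h)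

variable {z : P.Obj} {tau : P.Hom y z} (htau : P.IsIrreducible tau) (hne : ¬ HEq tau rho)
include htau

lemma left_ne_target : x ≠ z := by
  rintro rfl
  exact htau.1 (d.hom_zero tau)

lemma notMem_of_irreducible : ¬ d.ideal y z tau := fun h => htau.1 (d.mem_y h)

include hne

lemma right_ne_target : y ≠ z := by
  rintro rfl
  exact hne (heq_of_eq (d.eq_rho_of_irreducible htau))

lemma comp_rho_ne (ν : P.Hom y z) : ν ⊚ rho ≠ tau :=
  d.comp_rho_ne_of_irreducible htau (d.right_ne_target htau hne) ν

lemma comp_eq_zero_of_irreducible (ν : P.Hom z y) : ν ⊚ tau = P.zero y y :=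
  d.endo_through_eq_zero (d.left_ne_target htau) (d.right_ne_target htau hne) ν tau

lemma comp_ne_of_ne_zero {f : P.Hom y y} (hf : f ≠ P.zero y y) (ν : P.Hom z y) : ν ⊚ tau ≠ f := by
  rw [d.comp_eq_zero_of_irreducible htau hne]
  exact hf.symm

lemma hom_to_left_eq_zero {c : P.Obj} (hx : x ≠ c) (hy : y ≠ c) (f : P.Hom c x) :
    f = P.zero c x := by
  by_contra hf
  obtain ⟨n, hn⟩ := d.nilp_left
  obtain ⟨i, φ, e, h1⟩ := exists_eq_comp_pow (P := P.op) (a := x) (b := c) (f := lam)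
    ⟨n, (op_pow lam n).trans hn⟩ (g := f) hf
  have hφ : φ ≠ P.zero c x := by
    rintro rfl
    exact hf (e.trans (P.comp_zero _))
  refine ShG.false d φ tau (not_isId_of_ne hx.symm _)
    (not_isId_of_ne (d.right_ne_target htau hne) _) (fun h => hφ (d.mem_x h))
    (d.notMem_of_irreducible htau) h1 (d.comp_ne_lam hx hy φ) (fun ν h => ?_)
    (d.comp_rho_ne htau hne) (d.comp_ne_of_ne_zero htau hne d.rho_ne_zero)
    (d.comp_ne_of_ne_zero htau hne d.rho_rho_ne_zero)
  obtain ⟨g, rfl⟩ := d.exists_eq_comp_mu hx hy ν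
  rw [← P.assoc, d.hom_zero (φ ⊚ g), P.zero_comp] at h
  exact d.lam_lam_ne_zero h.symm

lemma hom_to_right_eq_zero {c : P.Obj} (hx : x ≠ c) (hy : y ≠ c) (f : P.Hom c y) :
    f = P.zero c y := by
  obtain ⟨g, rfl⟩ := d.exists_eq_mu_comp hx hy f
  rw [d.hom_to_left_eq_zero htau hne hx hy g, P.comp_zero]

lemma heq_of_irreducible_to_left (c : P.Obj) (f : P.Hom c x) (hf : P.IsIrreducible f) :
    HEq f lam ∨ HEq f mu := by
  by_cases hx : x = c
  · subst hx
    exact Or.inl (heq_of_eq (d.eq_lam_of_irreducible hf))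
  by_cases hy : y = c
  · subst hy
    exact absurd (d.hom_zero f) hf.1
  exact absurd (d.hom_to_left_eq_zero htau hne hx hy f) hf.1

/-- Morphisms from `y` to a third point are comparable with `τ`, up to powers of `ρ`. -/
lemma factor_cases {c : P.Obj} (hx : x ≠ c) (hy : y ≠ c) {f : P.Hom y c} (hf : f ≠ P.zero y c) :
    (∃ ν, ν ⊚ rho = f) ∨ (∃ ν, ν ⊚ tau = f) ∨ ∃ ν, ν ⊚ f = tau := by
  by_contra hcon
  push Not at hcon
  obtain ⟨h1, h2, h3⟩ := hcon
  exact ShH.false d f tau (not_isId_of_ne hy _) (not_isId_of_ne (d.right_ne_target htau hne) _)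
    (fun h => hf (d.mem_y h)) (d.notMem_of_irreducible htau) h3
    (fun ν h => d.rho_ne_zero (by rw [← h, d.endo_through_eq_zero hx hy ν f]))
    (fun ν h => d.rho_rho_ne_zero (by rw [← h, d.endo_through_eq_zero hx hy ν f])) h2
    (d.comp_ne_of_ne_zero htau hne d.rho_ne_zero) (d.comp_ne_of_ne_zero htau hne d.rho_rho_ne_zero)
    h1 (d.comp_rho_ne htau hne)

lemma heq_of_irreducible_from_right {c : P.Obj} (hy : y ≠ c) {f : P.Hom y c}
    (hf : P.IsIrreducible f) : HEq f tau := by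
  have hx : x ≠ c := by
    rintro rfl
    exact hf.1 (d.hom_zero f)
  obtain ⟨ν, h⟩ | ⟨ν, h⟩ | ⟨ν, h⟩ := d.factor_cases htau hne hx hy hf.1
  · exact absurd h (d.comp_rho_ne_of_irreducible hf hy ν)
  · obtain h1 | h1 := hf.2.2 z ν tau h.symm
    · exact h ▸ heq_comp_of_isId h1 tau
    · exact absurd h1 (not_isId_of_ne (d.right_ne_target htau hne) _)
  · exact htau.heq_of_comp_eq hy h

lemma lam_pow_three : P.pow lam 3 = P.zero x x := by
  by_contra h
  have e : P.pow lam 3 = lam ⊚ lam ⊚ lam := by rw [pow, pow, pow_one]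
  rw [e] at h
  exact ShI.false d tau (not_isId_of_ne (d.right_ne_target htau hne) _)
    (d.notMem_of_irreducible htau) (fun h1 => h (d.mem_x h1)) (d.comp_rho_ne htau hne)
    (d.comp_ne_of_ne_zero htau hne d.rho_ne_zero) (d.comp_ne_of_ne_zero htau hne d.rho_rho_ne_zero)

lemma rho_pow_three : P.pow rho 3 = P.zero y y := by
  by_contra h
  have e : P.pow rho 3 = rho ⊚ rho ⊚ rho := by rw [pow, pow, pow_one]
  rw [e] at h
  exact ShJ.false d tau (not_isId_of_ne (d.right_ne_target htau hne) _)
    (d.notMem_of_irreducible htau) (fun h1 => h (d.mem_y h1)) (d.comp_rho_ne htau hne)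
    (d.comp_ne_of_ne_zero htau hne d.rho_ne_zero) (d.comp_ne_of_ne_zero htau hne d.rho_rho_ne_zero)
    (d.comp_ne_of_ne_zero htau hne h)

variable (h0 : tau ⊚ mu ≠ P.zero x z)
include h0

lemma comp_mu_notMem : ¬ d.ideal x z (tau ⊚ mu) := by
  intro h
  obtain ⟨g, hg⟩ := d.mem_right h
  rw [← d.comm2, ← P.assoc, ← P.assoc] at hg
  exact d.comp_rho_ne htau hne (g ⊚ rho) (cancel_right hg h0).symm

lemma comp_lam_ne_comp_mu (ν : P.Hom x z) : ν ⊚ lam ≠ tau ⊚ mu := by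
  intro h
  obtain ⟨g, rfl⟩ := d.exists_eq_comp_mu (d.left_ne_target htau) (d.right_ne_target htau hne) ν
  rw [P.assoc, d.comm, ← P.assoc] at h
  exact d.comp_rho_ne htau hne g (cancel_right h.symm h0).symm

lemma hom_to_target_eq_zero {c : P.Obj} (hx : x ≠ c) (hy : y ≠ c) {f : P.Hom c z}
    (hf : ¬ P.IsId f) : f = P.zero c z := by
  by_contra hz
  have h1 : ∀ ν : P.Hom y c, f ⊚ ν ≠ tau := by
    intro ν h
    obtain h | h := htau.2.2 c f ν h.symm
    · exact hf h
    · exact not_isId_of_ne hy _ h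
  refine ShK.false d tau f (not_isId_of_ne (d.right_ne_target htau hne) _) hf
    (d.notMem_of_irreducible htau) (fun h => ?_) (d.comp_mu_notMem htau hne h0) (fun ν h => ?_)
    h1 (fun ν h => ?_) (d.comp_lam_ne_comp_mu htau hne h0) (d.comp_rho_ne htau hne)
    (d.comp_ne_of_ne_zero htau hne d.rho_ne_zero) (d.comp_ne_of_ne_zero htau hne d.rho_rho_ne_zero)
  · obtain ⟨g, h, rfl⟩ := h
    rw [d.hom_to_left_eq_zero htau hne hx hy h, P.comp_zero, P.comp_zero] at hz
    exact hz rfl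
  · rw [d.hom_to_right_eq_zero htau hne hx hy ν, P.comp_zero] at h
    exact hz h.symm
  · obtain ⟨g, rfl⟩ := d.exists_eq_comp_mu hx hy ν
    rw [← P.assoc] at h
    exact h1 g (cancel_right h.symm h0).symm

lemma heq_of_irreducible_to_target (c : P.Obj) (f : P.Hom c z) (hf : P.IsIrreducible f) :
    HEq f tau := by
  by_cases hx : x = c
  · subst hx
    exact absurd hf
      (d.not_irreducible_of_ne (d.left_ne_target htau) (d.right_ne_target htau hne) f)
  by_cases hy : y = c
  · subst hy
    exact d.heq_of_irreducible_from_right htau hne (d.right_ne_target htau hne) hf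
  exact absurd (d.hom_to_target_eq_zero htau hne h0 hx hy hf.2.1) hf.1

lemma endo_target (f : P.Hom z z) : f = P.id z ∨ f = P.zero z z := by
  by_cases hf : P.IsId f
  · exact Or.inl (isId_iff.1 hf)
  · exact Or.inr (d.hom_to_target_eq_zero htau hne h0 (d.left_ne_target htau)
      (d.right_ne_target htau hne) hf)

lemma exists_eq_endo_comp {c : P.Obj} (hc : z ≠ c) {ze : P.Hom z c} (hze : P.IsIrreducible ze)
    (g : P.Hom z c) : ∃ s : P.Hom c c, g = s ⊚ ze := by
  obtain ⟨G, h | h⟩ := P.hom_cyclic z c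
  · obtain ⟨i, hi⟩ := h ze
    obtain ⟨j, hj⟩ := h g
    obtain h1 | h1 := hze.2.2 c _ _ hi
    · rw [isId_iff.1 h1, P.id_comp] at hi
      exact ⟨_, hi ▸ hj⟩
    · exact absurd h1 (not_isId_of_ne hc _)
  · obtain ⟨i, hi⟩ := h ze
    obtain ⟨j, hj⟩ := h g
    obtain h1 | h1 := d.endo_target htau hne h0 (P.pipow z i)
    · obtain h2 | h2 := d.endo_target htau hne h0 (P.pipow z j)
      · exact ⟨P.id c, by rw [P.id_comp, hi, hj, h1, h2]⟩
      · exact ⟨P.zero c c, by rw [P.zero_comp, hj, h2, P.comp_zero]⟩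
    · rw [h1, P.comp_zero] at hi
      exact absurd hi hze.1

lemma comp_rho_ne_comp {c : P.Obj} (hx : x ≠ c) (hy : y ≠ c) (hc : z ≠ c) {ze : P.Hom z c}
    (hze : P.IsIrreducible ze) (hz : ze ⊚ tau ≠ P.zero y c) (ν : P.Hom y c) :
    ν ⊚ rho ≠ ze ⊚ tau := by
  intro h
  obtain ⟨i, φ, rfl, h1⟩ := exists_eq_comp_pow d.nilp_right (left_ne_zero (h ▸ hz))
  have hφ : φ ≠ P.zero y c := by
    rintro rfl
    rw [P.zero_comp, P.zero_comp] at h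
    exact hz h.symm
  obtain ⟨g, hg⟩ | ⟨g, rfl⟩ | ⟨g, hg⟩ := d.factor_cases htau hne hx hy hφ
  · exact h1 g hg
  · obtain ⟨s, rfl⟩ := d.exists_eq_endo_comp htau hne h0 hc hze g
    have e : ze ⊚ tau = s ⊚ (ze ⊚ tau) ⊚ P.pow rho (i + 1) := by
      rw [RayCategory.pow_succ']
      refine h.symm.trans ?_
      simp only [P.assoc]
    have key : ∀ n : ℕ, ∃ (t : P.Hom c c) (m : ℕ), ze ⊚ tau = t ⊚ (ze ⊚ tau) ⊚ P.pow rho (n + m) := by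
      intro n
      induction n with
      | zero => exact ⟨s, i + 1, by rw [Nat.zero_add]; exact e⟩
      | succ n ih =>
        obtain ⟨t, m, ht⟩ := ih
        refine ⟨t ⊚ s, i + m, ?_⟩
        have e1 : n + 1 + (i + m) = (i + 1) + (n + m) := by omega
        rw [e1, RayCategory.pow_add]
        conv_lhs => rw [ht, e]
        simp only [P.assoc]
    obtain ⟨n, hn⟩ := d.nilp_right
    obtain ⟨t, m, ht⟩ := key n
    rw [RayCategory.pow_add, hn, P.zero_comp, P.comp_zero, P.comp_zero] at ht
    exact hz ht
  · obtain h2 | h2 := htau.2.2 c g φ hg.symm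
    · exact not_isId_of_ne hc.symm _ h2
    · exact not_isId_of_ne hy _ h2

lemma comp_tau_eq_zero (c : P.Obj) (ze : P.Hom z c) (hze : P.IsIrreducible ze) :
    ze ⊚ tau = P.zero y c := by
  have zx := d.left_ne_target htau
  have zy := d.right_ne_target htau hne
  by_contra hz
  by_cases hx : x = c
  · subst hx
    exact hz (d.hom_zero _)
  by_cases hy : y = c
  · subst hy
    exact hz (d.comp_eq_zero_of_irreducible htau hne ze)
  by_cases hc : z = c
  · subst hc
    exact hze.1 (d.hom_to_target_eq_zero htau hne h0 zx zy hze.2.1)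
  have hI : ¬ d.ideal y c (ze ⊚ tau) := fun h => hz (d.mem_y h)
  exact ShL.false d tau ze (not_isId_of_ne zy _) (not_isId_of_ne hc _)
    (d.notMem_of_irreducible htau) (d.notMem_left hI) (d.comp_mu_notMem htau hne h0) hI
    (d.comp_lam_ne_comp_mu htau hne h0) (d.comp_rho_ne htau hne)
    (d.comp_rho_ne_comp htau hne h0 hx hy hc hze hz)
    (d.comp_ne_of_ne_zero htau hne d.rho_ne_zero) (d.comp_ne_of_ne_zero htau hne d.rho_rho_ne_zero)

end Dumbbell

/-- **Proposition 4.1.** Let `C` be a dumb-bell in `P` (points `x`, `y`, loops `λ`, `ρ`,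
arrow `μ`) such that `P/ρ²μ` is representation-finite, and let `τ : y → z` be an arrow
different from `ρ`.  Then: (a) `τ` and `ρ` are the only arrows starting at `y`;
(b) `λ` and `μ` are the only arrows starting or ending at `x`; (c) `λ³ = 0 = ρ³`;
(d) if `τμ ≠ 0` then `τ` is the only arrow ending at `z` and `ζτ = 0` for every arrow
`ζ` starting at `z`. -/
theorem dumbbell_in_min_rep_inf (P : RayCategory) {x y : P.Obj}
    (lam : P.Hom x x) (mu : P.Hom x y) (rho : P.Hom y y) (r s : ℕ)
    (hDB : DumbBellData P x y lam mu rho r s)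
    (hrep : RepFin P Set.univ (IdealOf P (P.comp (P.comp rho rho) mu)))
    (z : P.Obj) (tau : P.Hom y z) (htau : P.IsIrreducible tau) (hne : ¬ HEq tau rho) :
    (∀ (c : P.Obj) (f : P.Hom y c), P.IsIrreducible f → HEq f tau ∨ HEq f rho) ∧
    ((∀ (c : P.Obj) (f : P.Hom x c), P.IsIrreducible f → HEq f lam ∨ HEq f mu) ∧
     (∀ (c : P.Obj) (f : P.Hom c x), P.IsIrreducible f → HEq f lam ∨ HEq f mu)) ∧
    (P.pow lam 3 = P.zero x x ∧ P.pow rho 3 = P.zero y y) ∧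
    (P.comp tau mu ≠ P.zero x z →
      (∀ (c : P.Obj) (f : P.Hom c z), P.IsIrreducible f → HEq f tau) ∧
      (∀ (c : P.Obj) (ze : P.Hom z c), P.IsIrreducible ze →
        P.comp ze tau = P.zero y c)) := by
  have d := Dumbbell.of_data hDB hrep
  refine ⟨fun c f hf => ?_, ⟨d.heq_of_irreducible_from_left,
    d.heq_of_irreducible_to_left htau hne⟩,
    ⟨d.lam_pow_three htau hne, d.rho_pow_three htau hne⟩, fun h0 =>
    ⟨d.heq_of_irreducible_to_target htau hne h0, d.comp_tau_eq_zero htau hne h0⟩⟩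
  by_cases hy : y = c
  · subst hy
    exact Or.inr (heq_of_eq (d.eq_rho_of_irreducible hf))
  · exact Or.inl (d.heq_of_irreducible_from_right htau hne hy hf)
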